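/- Assume G ≅ C_{n1} ⊕ … ⊕ C_{nr} with 1 < n1 | … | nr and D(G) ≥ 4, and let G' ≅ C_{n1'} ⊕ … ⊕ C_{n'_{r'}} with 1 < n1' | … | n'_{r'} be a finite abelian group with 𝓛(G) = 𝓛(G'). If r ≥ nr − 1, n1 ≠ 2, and nr is a prime power, then r(G) = r(G') and n1 = n1'. -/

import Mathlib

/- Common definitions: zero-sum sequences over a finite abelian group,
   sets of lengths, the system of sets of lengths, the Davenport constant,
   sets of distances, elasticities, AAPs, Δ₁(G), ρ(G,d,k), ρ(G,d), ρ*(G,d),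
   cross numbers, K(G₀), K(G,d), LCN-sets, Δ*(G). -/

open scoped Classical

section Defs

variable {G : Type*} [AddCommGroup G]

/-- The support of a sequence (multiset) over `G`. -/
def suppSet (A : Multiset G) : Set G := {g | g ∈ A}

/-- `A` is a minimal zero-sum sequence (an atom of `𝓑(G₀)`) over `G₀ ⊆ G`:
a nontrivial zero-sum sequence with terms in `G₀` such that every proper
nontrivial subsequence has nonzero sum. -/
def IsMinZeroSum (G0 : Set G) (A : Multiset G) : Prop :=
  A ≠ 0 ∧ (∀ g ∈ A, g ∈ G0) ∧ A.sum = 0 ∧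
    ∀ T : Multiset G, T ≤ A → T.sum = 0 → T = 0 ∨ T = A

/-- `B` is a zero-sum sequence over `G₀ ⊆ G` (an element of `𝓑(G₀)`). -/
def IsZeroSumSeq (G0 : Set G) (B : Multiset G) : Prop :=
  (∀ g ∈ B, g ∈ G0) ∧ B.sum = 0

/-- The set of lengths `L(B)` of a zero-sum sequence `B` over `G₀`:
all `k` such that `B` is a product of `k` atoms of `𝓑(G₀)`.
(For the trivial sequence this is `{0}`.) -/
def lengthSet (G0 : Set G) (B : Multiset G) : Set ℕ :=
  {k | ∃ U : Fin k → Multiset G, (∀ i, IsMinZeroSum G0 (U i)) ∧ B = ∑ i, U i}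

/-- The system of sets of lengths `𝓛(G₀)`. -/
def systemL (G0 : Set G) : Set (Set ℕ) :=
  {L | ∃ B : Multiset G, IsZeroSumSeq G0 B ∧ L = lengthSet G0 B}

/-- The Davenport constant `D(G)`: the maximal length of a minimal zero-sum
sequence over `G`. -/
noncomputable def davenport (G : Type*) [AddCommGroup G] : ℕ :=
  sSup {m | ∃ A : Multiset G, IsMinZeroSum (Set.univ : Set G) A ∧ Multiset.card A = m}

/-- The set of successive distances `Δ(L)` of a set `L ⊆ ℕ`. -/
def deltaOf (L : Set ℕ) : Set ℕ :=
  {d | 0 < d ∧ ∃ a, a ∈ L ∧ a + d ∈ L ∧ ∀ c ∈ L, ¬(a < c ∧ c < a + d)}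

/-- `Δ(G₀) = ⋃_{L ∈ 𝓛(G₀)} Δ(L)`. -/
def deltaG0 (G0 : Set G) : Set ℕ := ⋃ L ∈ systemL G0, deltaOf L

/-- `Δ*(G) = {min Δ(G₀) : G₀ ⊆ G with Δ(G₀) ≠ ∅}`. -/
def deltaStar (G : Type*) [AddCommGroup G] : Set ℕ :=
  {d | ∃ G0 : Set G, deltaG0 G0 ≠ ∅ ∧ d = sInf (deltaG0 G0)}

/-- The elasticity `ρ(L) = max L / min L` of a (finite) set `L ⊆ ℕ`,
with the convention `ρ({0}) = 1`. -/
noncomputable def rhoL (L : Set ℕ) : ℝ :=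
  if sInf L = 0 then 1 else ((sSup L : ℕ) : ℝ) / ((sInf L : ℕ) : ℝ)

/-- The elasticity `ρ(G₀) = sup {ρ(L) : L ∈ 𝓛(G₀)}`. -/
noncomputable def rhoG0 (G0 : Set G) : ℝ := sSup (rhoL '' systemL G0)

/-- `L` (a set of naturals) is an almost arithmetical progression (AAP)
with difference `d`, length `ℓ` and bound `M`:
`L = y + (L' ∪ {0, d, …, ℓd} ∪ L'') ⊆ y + dℤ` with `L' ⊆ [−M, −1]` and
`L'' ⊆ ℓd + [1, M]`. -/
def IsAAP (L : Set ℕ) (d ℓ M : ℕ) : Prop :=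
  ∃ (y : ℤ) (L1 L2 : Set ℤ),
    L1 ⊆ Set.Icc (-(M : ℤ)) (-1) ∧
    L2 ⊆ Set.Icc ((ℓ : ℤ) * d + 1) ((ℓ : ℤ) * d + M) ∧
    ((fun x : ℕ => (x : ℤ)) '' L) =
      (fun x => y + x) '' (L1 ∪ (fun i : ℤ => (d : ℤ) * i) '' Set.Icc (0 : ℤ) (ℓ : ℤ) ∪ L2) ∧
    (∀ x ∈ L, (d : ℤ) ∣ ((x : ℤ) - y))

/-- `Δ₁(G)`: the set of `d ∈ ℕ` such that for every `k` there is some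
`L ∈ 𝓛(G)` which is an AAP with difference `d` and length at least `k`. -/
def delta1 (G : Type*) [AddCommGroup G] : Set ℕ :=
  {d | 0 < d ∧ ∀ k : ℕ, ∃ L ∈ systemL (Set.univ : Set G), ∃ ℓ ≥ k, ∃ M : ℕ, IsAAP L d ℓ M}

/-- `ρ(G, d, k)`: the supremum of elasticities of sets of lengths of `G` which
are AAPs with difference `d` and length at least `k`. -/
noncomputable def rhoGdk (G : Type*) [AddCommGroup G] (d k : ℕ) : ℝ :=
  sSup (rhoL '' {L | L ∈ systemL (Set.univ : Set G) ∧ ∃ ℓ ≥ k, ∃ M : ℕ, IsAAP L d ℓ M})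

/-- `ρ(G, d)`: the limit of the decreasing sequence `(ρ(G, d, k))_k`,
i.e. its infimum. -/
noncomputable def rhoGd (G : Type*) [AddCommGroup G] (d : ℕ) : ℝ :=
  ⨅ k : ℕ, rhoGdk G d k

/-- `ρ*(G, d) = max {ρ(G₀) : G₀ ⊆ G non-half-factorial with d ∣ min Δ(G₀)}`. -/
noncomputable def rhoStar (G : Type*) [AddCommGroup G] (d : ℕ) : ℝ :=
  sSup {x | ∃ G0 : Set G, deltaG0 G0 ≠ ∅ ∧ d ∣ sInf (deltaG0 G0) ∧ x = rhoG0 G0}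

/-- The cross number `k(S) = Σ_{g ∈ S} 1/ord(g)` of a sequence `S`. -/
noncomputable def crossNum (S : Multiset G) : ℝ :=
  (S.map (fun g => (1 : ℝ) / (addOrderOf g))).sum

/-- `K(G₀) = max {k(A) : A ∈ 𝓐(G₀)}`, the cross number of `G₀`. -/
noncomputable def KG0 (G0 : Set G) : ℝ :=
  sSup {x | ∃ A : Multiset G, IsMinZeroSum G0 A ∧ x = crossNum A}

/-- `K(G, d) = max {K(G₀) : G₀ ⊆ G non-half-factorial with d ∣ min Δ(G₀)}`. -/
noncomputable def KGd (G : Type*) [AddCommGroup G] (d : ℕ) : ℝ :=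
  sSup {x | ∃ G0 : Set G, deltaG0 G0 ≠ ∅ ∧ d ∣ sInf (deltaG0 G0) ∧ x = KG0 G0}

/-- `G₀` is an LCN-set: `k(A) ≥ 1` for every atom `A` of `𝓑(G₀)`. -/
def IsLCN (G0 : Set G) : Prop :=
  ∀ A : Multiset G, IsMinZeroSum G0 A → 1 ≤ crossNum A

end Defs

section ZSProof
set_option linter.all false


namespace ZS

variable {G : Type*} [AddCommGroup G]

/-- minimal zero-sum sequences over the whole group -/
def Atom (A : Multiset G) : Prop :=
  A ≠ 0 ∧ A.sum = 0 ∧ ∀ T : Multiset G, T ≤ A → T.sum = 0 → T = 0 ∨ T = A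

def Over (S : Set G) (B : Multiset G) : Prop := ∀ g ∈ B, g ∈ S

def HasLen (B : Multiset G) (l : ℕ) : Prop :=
  ∃ F : Multiset (Multiset G), (∀ A ∈ F, Atom A) ∧ F.sum = B ∧ Multiset.card F = l

def DSet (d : ℕ) (S : Set G) : Prop :=
  ∀ B, Over S B → ∀ l1 l2, HasLen B l1 → HasLen B l2 → (d : ℤ) ∣ (l1 : ℤ) - l2

def Elast (G : Type*) [AddCommGroup G] (d : ℕ) (R : ℚ) : Prop :=
  ∀ S : Set G, DSet d S → ∀ B, Over S B → ∀ l1 l2, HasLen B l1 → HasLen B l2 → (l2 : ℚ) ≤ R * l1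

/-- weight of a sequence -/
def wt (w : G → ℚ) (B : Multiset G) : ℚ := (B.map w).sum

@[simp] lemma wt_zero (w : G → ℚ) : wt w 0 = 0 := by simp [wt]
@[simp] lemma wt_add (w : G → ℚ) (A B : Multiset G) : wt w (A + B) = wt w A + wt w B := by
  simp [wt]
@[simp] lemma wt_cons (w : G → ℚ) (a : G) (B : Multiset G) : wt w (a ::ₘ B) = w a + wt w B := by
  simp [wt]
@[simp] lemma wt_singleton (w : G → ℚ) (a : G) : wt w {a} = w a := by
  simp [wt]
@[simp] lemma wt_replicate (w : G → ℚ) (m : ℕ) (a : G) :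
    wt w (Multiset.replicate m a) = m * w a := by
  simp [wt]
@[simp] lemma wt_nsmul (w : G → ℚ) (m : ℕ) (A : Multiset G) : wt w (m • A) = m * wt w A := by
  simp [wt, Multiset.map_nsmul, Multiset.sum_nsmul]

lemma wt_sum (w : G → ℚ) (F : Multiset (Multiset G)) : wt w F.sum = (F.map (wt w)).sum := by
  induction F using Multiset.induction_on with
  | empty => simp
  | cons a F ih => simp [ih]

lemma wt_finsum {ι : Type*} (s : Finset ι) (w : G → ℚ) (F : ι → Multiset G) :
    wt w (∑ i ∈ s, F i) = ∑ i ∈ s, wt w (F i) := by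
  induction s using Finset.induction_on with
  | empty => simp
  | insert a s h ih => simp [Finset.sum_insert h, ih]

lemma wt_congr {w w' : G → ℚ} {B : Multiset G} (h : ∀ g ∈ B, w g = w' g) : wt w B = wt w' B := by
  unfold wt; rw [Multiset.map_congr rfl h]

lemma wt_mono {w w' : G → ℚ} {B : Multiset G} (h : ∀ g ∈ B, w g ≤ w' g) : wt w B ≤ wt w' B := by
  unfold wt; exact Multiset.sum_map_le_sum_map _ _ h

lemma wt_nonneg {w : G → ℚ} {B : Multiset G} (h : ∀ g ∈ B, 0 ≤ w g) : 0 ≤ wt w B := by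
  have := wt_mono (w := fun _ => 0) h
  simpa [wt] using this

lemma mem_sum {F : Multiset (Multiset G)} {g : G} : g ∈ F.sum ↔ ∃ A ∈ F, g ∈ A :=
  Multiset.mem_join

lemma sum_sum (F : Multiset (Multiset G)) : F.sum.sum = (F.map Multiset.sum).sum :=
  by
  induction F using Multiset.induction_on with
  | empty => simp
  | cons a F ih => simp [ih]

lemma card_sum (F : Multiset (Multiset G)) :
    Multiset.card F.sum = (F.map Multiset.card).sum := by
  induction F using Multiset.induction_on with
  | empty => simp
  | cons a F ih => simp [ih]

lemma le_sum {F : Multiset (Multiset G)} {A : Multiset G} (h : A ∈ F) : A ≤ F.sum := by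
  obtain ⟨F', rfl⟩ := Multiset.exists_cons_of_mem h
  simp

lemma Atom.sum_fac {F : Multiset (Multiset G)} (hF : ∀ A ∈ F, Atom A) : F.sum.sum = 0 := by
  rw [sum_sum, Multiset.sum_eq_zero]
  intro x hx
  obtain ⟨A, hA, rfl⟩ := Multiset.mem_map.1 hx
  exact (hF A hA).2.1

lemma HasLen.sum_eq {B : Multiset G} {l : ℕ} (h : HasLen B l) : B.sum = 0 := by
  obtain ⟨F, hF, rfl, rfl⟩ := h
  exact Atom.sum_fac hF

lemma HasLen.zero : HasLen (0 : Multiset G) 0 := ⟨0, by simp, by simp, by simp⟩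

lemma Atom.hasLen {A : Multiset G} (h : Atom A) : HasLen A 1 :=
  ⟨{A}, by simpa using h, by simp, by simp⟩

lemma HasLen.add {A B : Multiset G} {l m : ℕ} (h : HasLen A l) (h' : HasLen B m) :
    HasLen (A + B) (l + m) := by
  obtain ⟨F, hF, rfl, rfl⟩ := h
  obtain ⟨F', hF', rfl, rfl⟩ := h'
  refine ⟨F + F', ?_, by simp, by simp⟩
  intro A hA
  rcases Multiset.mem_add.1 hA with h | h
  exacts [hF _ h, hF' _ h]

lemma HasLen.nsmul {A : Multiset G} {l : ℕ} (h : HasLen A l) (k : ℕ) :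
    HasLen (k • A) (k * l) := by
  induction k with
  | zero => simpa using HasLen.zero
  | succ k ih => rw [succ_nsmul, Nat.succ_mul]; exact ih.add h

lemma HasLen.finsum {ι : Type*} (s : Finset ι) {f : ι → Multiset G} {l : ι → ℕ}
    (h : ∀ i ∈ s, HasLen (f i) (l i)) : HasLen (∑ i ∈ s, f i) (∑ i ∈ s, l i) := by
  induction s using Finset.induction_on with
  | empty => simpa using HasLen.zero
  | insert a s ha ih =>
    rw [Finset.sum_insert ha, Finset.sum_insert ha]
    exact (h a (by simp)).add (ih fun i hi => h i (by simp [hi]))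

lemma hasLen_fac {F : Multiset (Multiset G)} (hF : ∀ A ∈ F, Atom A) :
    HasLen F.sum (Multiset.card F) := ⟨F, hF, rfl, rfl⟩

lemma exists_fac (B : Multiset G) (h : B.sum = 0) :
    ∃ F : Multiset (Multiset G), (∀ A ∈ F, Atom A) ∧ F.sum = B := by
  induction hn : Multiset.card B using Nat.strong_induction_on generalizing B with
  | _ n ih =>
    by_cases h0 : B = 0
    · exact ⟨0, by simp, by simp [h0]⟩
    by_cases hA : Atom B
    · exact ⟨{B}, by simpa using hA, by simp⟩
    have : ∃ T, T ≤ B ∧ T.sum = 0 ∧ T ≠ 0 ∧ T ≠ B := by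
      by_contra hc
      push Not at hc
      exact hA ⟨h0, h, fun T hT hs => by
        by_cases hT0 : T = 0
        · exact Or.inl hT0
        · exact Or.inr (hc T hT hs hT0)⟩
    obtain ⟨T, hT, hs, hT0, hTB⟩ := this
    obtain ⟨T', rfl⟩ := Multiset.le_iff_exists_add.1 hT
    have hT' : T' ≠ 0 := by rintro rfl; simp at hTB
    have h1 : 0 < Multiset.card T := Multiset.card_pos.2 hT0
    have h2 : 0 < Multiset.card T' := Multiset.card_pos.2 hT'
    rw [Multiset.card_add] at hn
    rw [Multiset.sum_add, hs, zero_add] at h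
    obtain ⟨F, hF, hFs⟩ := ih (Multiset.card T) (by omega) T hs rfl
    obtain ⟨F', hF', hFs'⟩ := ih (Multiset.card T') (by omega) T' h rfl
    refine ⟨F + F', ?_, by simp [hFs, hFs']⟩
    intro A hA
    rcases Multiset.mem_add.1 hA with h | h
    exacts [hF _ h, hF' _ h]

lemma exists_len (B : Multiset G) (h : B.sum = 0) : ∃ l, HasLen B l := by
  obtain ⟨F, hF, hs⟩ := exists_fac B h
  exact ⟨_, F, hF, hs, rfl⟩

lemma exists_len_pos (B : Multiset G) (h : B.sum = 0) (h0 : B ≠ 0) : ∃ l, 0 < l ∧ HasLen B l := by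
  obtain ⟨F, hF, hs⟩ := exists_fac B h
  refine ⟨_, ?_, F, hF, hs, rfl⟩
  rw [Multiset.card_pos]
  rintro rfl
  simp at hs
  exact h0 hs.symm

lemma Atom.eq_of_le {A V : Multiset G} (hA : Atom A) (hV : Atom V) (h : A ≤ V) : A = V :=
  (hV.2.2 A h hA.2.1).resolve_left hA.1

lemma Atom.eq_of_le' {A V : Multiset G} (h0 : A ≠ 0) (hs : A.sum = 0) (hV : Atom V) (h : A ≤ V) :
    A = V :=
  (hV.2.2 A h hs).resolve_left h0

lemma Over.add {S : Set G} {A B : Multiset G} (hA : Over S A) (hB : Over S B) : Over S (A + B) := by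
  intro g hg
  rcases Multiset.mem_add.1 hg with h | h
  exacts [hA _ h, hB _ h]

lemma Over.mono {S : Set G} {A B : Multiset G} (hB : Over S B) (h : A ≤ B) : Over S A :=
  fun g hg => hB g (Multiset.mem_of_le h hg)

lemma Over.mono_set {S T : Set G} {A : Multiset G} (hB : Over S A) (h : S ⊆ T) : Over T A :=
  fun g hg => h (hB g hg)

lemma Over.nsmul {S : Set G} {A : Multiset G} (hA : Over S A) (k : ℕ) : Over S (k • A) :=
  fun g hg => hA g (Multiset.mem_of_mem_nsmul hg)

lemma Over.replicate {S : Set G} {a : G} (h : a ∈ S) (k : ℕ) : Over S (Multiset.replicate k a) :=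
  fun g hg => by rw [Multiset.eq_of_mem_replicate hg]; exact h

lemma Over.finsum {ι : Type*} {S : Set G} (s : Finset ι) {f : ι → Multiset G}
    (h : ∀ i ∈ s, Over S (f i)) : Over S (∑ i ∈ s, f i) := by
  intro g hg
  obtain ⟨i, hi, hg⟩ := Multiset.mem_sum.1 hg
  exact h i hi g hg

lemma Over.of_sum {S : Set G} {F : Multiset (Multiset G)} (h : Over S F.sum) {A : Multiset G}
    (hA : A ∈ F) : Over S A := h.mono (le_sum hA)

lemma Over.sum {S : Set G} {F : Multiset (Multiset G)} (h : ∀ A ∈ F, Over S A) : Over S F.sum := by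
  intro g hg
  obtain ⟨A, hA, hg⟩ := mem_sum.1 hg
  exact h A hA g hg

lemma DSet.mono {d : ℕ} {S T : Set G} (h : DSet d T) (hST : S ⊆ T) : DSet d S :=
  fun B hB => h B (hB.mono_set hST)

lemma wt_bounds {S : Set G} {w : G → ℚ} {R : ℚ}
    (h : ∀ A, Atom A → Over S A → 1 ≤ wt w A ∧ wt w A ≤ R) {B : Multiset G} (hB : Over S B)
    {l : ℕ} (hl : HasLen B l) : (l : ℚ) ≤ wt w B ∧ wt w B ≤ R * l := by
  obtain ⟨F, hF, rfl, rfl⟩ := hl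
  have : ∀ A ∈ F, 1 ≤ wt w A ∧ wt w A ≤ R := fun A hA => h A (hF A hA) (hB.of_sum hA)
  clear hB hF
  induction F using Multiset.induction_on with
  | empty => simp
  | cons a F ih =>
    have h1 := this a (by simp)
    have h2 := ih (fun A hA => this A (by simp [hA]))
    simp only [Multiset.sum_cons, wt_add, Multiset.card_cons]
    push_cast
    constructor <;> linarith [h1.1, h1.2, h2.1, h2.2]

lemma elast_of_wt {d : ℕ} {R : ℚ}
    (h : ∀ S : Set G, DSet d S → ∃ w : G → ℚ, ∀ A, Atom A → Over S A → 1 ≤ wt w A ∧ wt w A ≤ R) :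
    Elast G d R := by
  intro S hS B hB l1 l2 h1 h2
  obtain ⟨w, hw⟩ := h S hS
  have := wt_bounds hw hB h1
  have := wt_bounds hw hB h2
  linarith

lemma wt_modeq {S : Set G} {w : G → ℚ} {d : ℕ}
    (h : ∀ A, Atom A → Over S A → ∃ z : ℤ, wt w A = 1 + d * z) {B : Multiset G} (hB : Over S B)
    {l : ℕ} (hl : HasLen B l) : ∃ z : ℤ, wt w B = l + d * z := by
  obtain ⟨F, hF, rfl, rfl⟩ := hl
  have : ∀ A ∈ F, ∃ z : ℤ, wt w A = 1 + d * z := fun A hA => h A (hF A hA) (hB.of_sum hA)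
  clear hB hF
  induction F using Multiset.induction_on with
  | empty => exact ⟨0, by simp⟩
  | cons a F ih =>
    obtain ⟨z1, h1⟩ := this a (by simp)
    obtain ⟨z2, h2⟩ := ih (fun A hA => this A (by simp [hA]))
    refine ⟨z1 + z2, ?_⟩
    simp only [Multiset.sum_cons, wt_add, Multiset.card_cons, h1, h2]
    push_cast
    ring

lemma dset_of_wt {S : Set G} {w : G → ℚ} {d : ℕ}
    (h : ∀ A, Atom A → Over S A → ∃ z : ℤ, wt w A = 1 + d * z) : DSet d S := by
  intro B hB l1 l2 h1 h2
  obtain ⟨z1, e1⟩ := wt_modeq h hB h1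
  obtain ⟨z2, e2⟩ := wt_modeq h hB h2
  refine ⟨z2 - z1, ?_⟩
  have : ((l1 : ℤ) - l2 : ℚ) = ((d : ℤ) * (z2 - z1) : ℚ) := by
    push_cast; linarith
  exact_mod_cast this

lemma dset_congr {d : ℕ} {S : Set G} (hS : DSet d S) {B : Multiset G} (hB : Over S B) {l1 l2 : ℕ}
    (h1 : HasLen B l1) (h2 : HasLen B l2) : (d : ℤ) ∣ (l1 : ℤ) - l2 := hS B hB l1 l2 h1 h2

/-- Riesz decomposition -/
lemma cover_pairs (F : Multiset (Multiset G)) (A : Multiset G) (h : A ≤ F.sum) :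
    ∃ P : Multiset (Multiset G × Multiset G), P.map (fun p => p.1 + p.2) = F ∧
      (P.map Prod.fst).sum = A := by
  induction F using Multiset.induction_on generalizing A with
  | empty => exact ⟨0, by simp, by simp at h; simp [h]⟩
  | cons V F ih =>
    rw [Multiset.sum_cons] at h
    obtain ⟨P, hP1, hP2⟩ := ih (A - V) (by rwa [tsub_le_iff_left])
    refine ⟨(A ∩ V, V - A) ::ₘ P, ?_, ?_⟩
    · simp only [Multiset.map_cons, hP1]
      congr 1
      ext x
      simp only [Multiset.count_add, Multiset.count_inter, Multiset.count_sub]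
      omega
    · simp only [Multiset.map_cons, Multiset.sum_cons, hP2]
      ext x
      simp only [Multiset.count_add, Multiset.count_inter, Multiset.count_sub]
      omega

lemma card_le_of_ne (P : Multiset (Multiset G × Multiset G)) (h : ∀ p ∈ P, p.1 ≠ 0) :
    Multiset.card P ≤ Multiset.card (P.map Prod.fst).sum := by
  induction P using Multiset.induction_on with
  | empty => simp
  | cons p P ih =>
    have h1 : 0 < Multiset.card p.1 := Multiset.card_pos.2 (h p (by simp))
    have h2 := ih (fun q hq => h q (by simp [hq]))
    simp only [Multiset.card_cons, Multiset.map_cons, Multiset.sum_cons, Multiset.card_add]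
    omega

/-- pairs version with nonzero first components -/
lemma cover_pairs' (F : Multiset (Multiset G)) (A : Multiset G) (h : A ≤ F.sum) :
    ∃ P : Multiset (Multiset G × Multiset G), P.map (fun p => p.1 + p.2) ≤ F ∧
      (P.map Prod.fst).sum = A ∧ ∀ p ∈ P, p.1 ≠ 0 := by
  obtain ⟨P, h1, h2⟩ := cover_pairs F A h
  refine ⟨P.filter (fun p => p.1 ≠ 0), ?_, ?_, ?_⟩
  · rw [← h1]; exact Multiset.map_le_map (Multiset.filter_le _ _)
  · rw [← h2]
    clear h1 h2
    induction P using Multiset.induction_on with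
    | empty => simp
    | cons p P ih =>
      by_cases hp : p.1 = 0
      · rw [Multiset.filter_cons_of_neg _ (by simpa using hp)]
        simp only [ih, Multiset.map_cons, Multiset.sum_cons, hp, zero_add]
      · rw [Multiset.filter_cons_of_pos _ (by simpa using hp)]
        simp only [ih, Multiset.map_cons, Multiset.sum_cons]
  · intro p hp
    exact (Multiset.mem_filter.1 hp).2

lemma cover (F : Multiset (Multiset G)) (A : Multiset G) (h : A ≤ F.sum) :
    ∃ I : Multiset (Multiset G), I ≤ F ∧ A ≤ I.sum ∧ Multiset.card I ≤ Multiset.card A := by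
  obtain ⟨P, h1, h2, h3⟩ := cover_pairs' F A h
  refine ⟨_, h1, ?_, ?_⟩
  · rw [Multiset.sum_map_add, h2]; simp
  · rw [← h2, Multiset.card_map]; exact card_le_of_ne P h3

end ZS


namespace ZS

section Fin
variable {G : Type*} [AddCommGroup G] [Finite G]

lemma ord_pos (g : G) : 0 < addOrderOf g := addOrderOf_pos g

lemma atom_ord (g : G) : Atom (Multiset.replicate (addOrderOf g) g) := by
  refine ⟨?_, ?_, ?_⟩
  · intro h
    have := congrArg Multiset.card h
    rw [Multiset.card_replicate, Multiset.card_zero] at this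
    exact absurd this (ord_pos g).ne'
  · simp [addOrderOf_nsmul_eq_zero]
  · intro T hT hs
    obtain ⟨m, hm, rfl⟩ := Multiset.le_replicate_iff.1 hT
    simp only [Multiset.sum_replicate] at hs
    have := addOrderOf_dvd_of_nsmul_eq_zero hs
    rcases Nat.eq_zero_or_pos m with h0 | h0
    · left; simp [h0]
    · right
      have := Nat.le_of_dvd h0 this
      rw [show m = addOrderOf g by omega]

lemma Atom.count_le {A : Multiset G} (hA : Atom A) (g : G) : A.count g ≤ addOrderOf g := by
  by_contra h
  push Not at h
  have h1 : Multiset.replicate (addOrderOf g) g ≤ A := Multiset.le_count_iff_replicate_le.1 h.le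
  have := (atom_ord g).eq_of_le hA h1
  rw [← this] at h
  simp at h

lemma Atom.eq_of_count {A : Multiset G} (hA : Atom A) {g : G} (h : A.count g = addOrderOf g) :
    A = Multiset.replicate (addOrderOf g) g :=
  ((atom_ord g).eq_of_le hA (Multiset.le_count_iff_replicate_le.1 h.ge)).symm

lemma finite_atoms (G : Type*) [AddCommGroup G] [Finite G] : {A : Multiset G | Atom A}.Finite := by
  have := Fintype.ofFinite G
  refine Set.Finite.subset (s := {A | A ≤ ∑ g : G, Multiset.replicate (addOrderOf g) g}) ?_ ?_
  · exact Set.finite_Iic _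
  · intro A hA
    show A ≤ _
    rw [Multiset.le_iff_count]
    intro g
    rw [Multiset.count_sum']
    simp only [Multiset.count_replicate]
    simp [hA.count_le g]

end Fin

section Conv
variable {G : Type*} [AddCommGroup G]

lemma atom_iff (A : Multiset G) : IsMinZeroSum Set.univ A ↔ Atom A := by
  unfold IsMinZeroSum Atom; simp

lemma hasLen_iff (B : Multiset G) (l : ℕ) : l ∈ lengthSet Set.univ B ↔ HasLen B l := by
  constructor
  · rintro ⟨U, hU, rfl⟩
    refine ⟨Finset.univ.val.map U, ?_, rfl, by simp⟩
    intro A hA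
    obtain ⟨i, -, rfl⟩ := Multiset.mem_map.1 hA
    exact (atom_iff _).1 (hU i)
  · rintro ⟨F, hF, rfl, rfl⟩
    induction F using Quotient.inductionOn with
    | _ L =>
      refine ⟨fun i => L.get (i.cast (by simp)), fun i => (atom_iff _).2 (hF _ (by simp)), ?_⟩
      simp only [Multiset.quot_mk_to_coe, Multiset.sum_coe, Multiset.coe_card]
      exact (Fin.sum_univ_getElem L).symm

end Conv

section Transfer
variable {G G' : Type*} [AddCommGroup G] [Finite G] [AddCommGroup G']

lemma split_high (d : ℕ) : ∃ C0 : ℕ, ∀ F : Multiset (Multiset G), (∀ A ∈ F, Atom A) →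
    (∀ l1 l2, HasLen F.sum l1 → HasLen F.sum l2 → (d : ℤ) ∣ (l1 : ℤ) - l2) →
    ∃ H L : Multiset (Multiset G), F = H + L ∧ Multiset.card L.sum ≤ C0 ∧
      DSet d {g | g ∈ H.sum} := by
  have hfs : Finite (Set G) := inferInstance
  have := Fintype.ofFinite (Set G)
  have hwit : ∀ S : Set G, ∃ m : ℕ, ¬ DSet d S → ∃ B, Over S B ∧ Multiset.card B ≤ m ∧
      ∃ l1 l2, HasLen B l1 ∧ HasLen B l2 ∧ ¬ (d : ℤ) ∣ (l1 : ℤ) - l2 := by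
    intro S
    by_cases hS : DSet d S
    · exact ⟨0, fun h => absurd hS h⟩
    · have h2 := hS
      unfold DSet at h2
      push Not at h2
      obtain ⟨B, hB, l1, l2, h1, h2, h3⟩ := h2
      exact ⟨Multiset.card B, fun _ => ⟨B, hB, le_rfl, l1, l2, h1, h2, h3⟩⟩
  choose m hm using hwit
  set M : ℕ := 1 + ∑ S : Set G, m S with hM
  have hmM : ∀ S, m S ≤ M := fun S => by
    have := Finset.single_le_sum (f := m) (fun i _ => Nat.zero_le _) (Finset.mem_univ S)
    omega
  have hfin := finite_atoms G
  set At : Finset (Multiset G) := hfin.toFinset with hAt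
  refine ⟨∑ A ∈ At, M * Multiset.card A, ?_⟩
  intro F hF hlen
  set H := F.filter (fun A => M ≤ F.count A) with hH
  set L := F.filter (fun A => ¬ M ≤ F.count A) with hL
  have hsplit : F = H + L := (Multiset.filter_add_not _ _).symm
  refine ⟨H, L, hsplit, ?_, ?_⟩
  · have h1 : L ≤ ∑ A ∈ At, M • {A} := by
      rw [Multiset.le_iff_count]
      intro A
      rw [Multiset.count_sum']
      simp only [Multiset.count_nsmul, Multiset.count_singleton]
      by_cases hA : A ∈ L
      · have hA' : A ∈ At := by
          simp only [hAt, Set.Finite.mem_toFinset]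
          exact hF A (Multiset.mem_of_le (Multiset.filter_le _ _) hA)
        simp only [smul_eq_mul, mul_ite, mul_one, mul_zero, Finset.sum_ite_eq, hA', if_true]
        have := (Multiset.mem_filter.1 hA).2
        have h3 : L.count A ≤ F.count A := Multiset.count_le_of_le A (Multiset.filter_le _ F)
        omega
      · rw [Multiset.count_eq_zero_of_notMem hA]; omega
    have h2 : Multiset.card L.sum ≤ Multiset.card (∑ A ∈ At, M • ({A} : Multiset (Multiset G))).sum := by
      obtain ⟨L', hL'⟩ := Multiset.le_iff_exists_add.1 h1
      rw [hL']
      simp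
    refine h2.trans ?_
    rw [card_sum]
    apply le_of_eq
    have h5 : ∀ s : Finset (Multiset G), ((∑ A ∈ s, M • ({A} : Multiset (Multiset G))).map Multiset.card).sum
        = ∑ A ∈ s, M * Multiset.card A := by
      intro s
      induction s using Finset.induction_on with
      | empty => simp
      | insert a s h ih =>
        simp [Finset.sum_insert h, ih, Multiset.map_nsmul, Multiset.sum_nsmul]
    exact h5 At
  · by_contra hD
    obtain ⟨B, hB, hcard, l1, l2, h1, h2, h3⟩ := hm _ hD
    have hcM := hcard.trans (hmM _)
    -- B ≤ sum of M copies of each high atom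
    set K : Multiset (Multiset G) := ∑ A ∈ H.toFinset, M • {A} with hK
    have hKF : K ≤ F := by
      rw [Multiset.le_iff_count]
      intro A
      rw [hK, Multiset.count_sum']
      simp only [Multiset.count_nsmul, Multiset.count_singleton, smul_eq_mul, mul_ite, mul_one, mul_zero, Finset.sum_ite_eq]
      split_ifs with hA
      · exact (Multiset.mem_filter.1 (Multiset.mem_toFinset.1 hA)).2
      · omega
    have hBK : B ≤ K.sum := by
      rw [Multiset.le_iff_count]
      intro g
      by_cases hg : g ∈ B
      · obtain ⟨A, hA, hgA⟩ := mem_sum.1 (hB g hg)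
        have : M • ({A} : Multiset (Multiset G)) ≤ K :=
          Finset.single_le_sum (f := fun A => M • ({A} : Multiset (Multiset G)))
            (fun _ _ => Multiset.zero_le _) (Multiset.mem_toFinset.2 hA)
        obtain ⟨K', hK'⟩ := Multiset.le_iff_exists_add.1 this
        rw [hK', Multiset.sum_add, Multiset.sum_nsmul, Multiset.sum_singleton, Multiset.count_add,
          Multiset.count_nsmul]
        have h4 : 1 ≤ A.count g := Multiset.one_le_count_iff_mem.2 hgA
        have h5 := Multiset.count_le_card g B
        have h6 : M * 1 ≤ M * A.count g := Nat.mul_le_mul_left _ h4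
        omega
      · rw [Multiset.count_eq_zero_of_notMem hg]; omega
    obtain ⟨R, hR⟩ := Multiset.le_iff_exists_add.1 hBK
    obtain ⟨F', hF'⟩ := Multiset.le_iff_exists_add.1 hKF
    have hKatom : ∀ A ∈ K, Atom A := fun A hA => hF A (Multiset.mem_of_le hKF hA)
    have hRs : R.sum = 0 := by
      have h7 := Atom.sum_fac hKatom
      rw [hR, Multiset.sum_add, h1.sum_eq, zero_add] at h7
      exact h7
    obtain ⟨lr, hlr⟩ := exists_len R hRs
    have hF'' : HasLen F'.sum (Multiset.card F') := hasLen_fac fun A hA =>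
      hF A (by rw [hF']; exact Multiset.mem_add.2 (Or.inr hA))
    have e : F.sum = B + R + F'.sum := by rw [hF', Multiset.sum_add, hR]
    have := hlen _ _ (e ▸ (h1.add hlr).add hF'') (e ▸ (h2.add hlr).add hF'')
    apply h3
    push_cast at this
    convert this using 1
    ring

lemma transfer {d : ℕ} {R : ℚ} (hR : 0 ≤ R)
    (hL : systemL (Set.univ : Set G) = systemL (Set.univ : Set G'))
    (hE : Elast G d R) : Elast G' d R := by
  intro S' hS' B' hB' a b ha hb
  obtain ⟨C0, hC0⟩ := split_high (G := G) d
  have key : ∀ k : ℕ, (k : ℚ) * b - C0 ≤ R * (k * a) := by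
    intro k
    have hmem : lengthSet Set.univ (k • B') ∈ systemL (Set.univ : Set G) := by
      rw [hL]
      exact ⟨k • B', ⟨by simp, (ha.nsmul k).sum_eq⟩, rfl⟩
    obtain ⟨B, -, hBB⟩ := hmem
    have hl : ∀ l, HasLen B l ↔ HasLen (k • B') l := by
      intro l
      rw [← hasLen_iff, ← hasLen_iff, hBB]
    obtain ⟨F, hF, rfl, hFc⟩ := (hl _).2 (ha.nsmul k)
    obtain ⟨F2, hF2, hF2s, hF2c⟩ := (hl _).2 (hb.nsmul k)
    obtain ⟨H, L, hHL, hLc, hD⟩ := hC0 F hF (fun l1 l2 h1 h2 =>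
      hS' (k • B') (hB'.nsmul k) l1 l2 ((hl _).1 h1) ((hl _).1 h2))
    have hHa : ∀ A ∈ H, Atom A := fun A hA => hF A (by rw [hHL]; exact Multiset.mem_add.2 (Or.inl hA))
    have hLa : ∀ A ∈ L, Atom A := fun A hA => hF A (by rw [hHL]; exact Multiset.mem_add.2 (Or.inr hA))
    have hle : L.sum ≤ F2.sum := by rw [hF2s, hHL, Multiset.sum_add]; simp
    obtain ⟨I, hI, hI2, hIc⟩ := cover F2 L.sum hle
    obtain ⟨F3, hF3⟩ := Multiset.le_iff_exists_add.1 hI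
    obtain ⟨T, hT⟩ := Multiset.le_iff_exists_add.1 hI2
    have hIa : ∀ A ∈ I, Atom A := fun A hA => hF2 A (Multiset.mem_of_le hI hA)
    have hTs : T.sum = 0 := by
      have := Atom.sum_fac hIa
      rw [hT, Multiset.sum_add, Atom.sum_fac hLa, zero_add] at this
      exact this
    obtain ⟨t, ht⟩ := exists_len T hTs
    have e : H.sum = T + F3.sum := by
      have h1 : F2.sum = H.sum + L.sum := by rw [hF2s, hHL, Multiset.sum_add]
      rw [hF3, Multiset.sum_add, hT] at h1
      have h2 : L.sum + (T + F3.sum) = L.sum + H.sum := by rw [← add_assoc, h1, add_comm]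
      exact (add_left_cancel h2).symm
    have h1 : HasLen H.sum (Multiset.card H) := hasLen_fac hHa
    have h2 : HasLen H.sum (t + Multiset.card F3) := by
      rw [e]; exact ht.add (hasLen_fac fun A hA => hF2 A (by rw [hF3]; exact Multiset.mem_add.2 (Or.inr hA)))
    have h3 := hE _ hD H.sum (fun g hg => hg) _ _ h1 h2
    have h4 : (k * b : ℕ) = Multiset.card I + Multiset.card F3 := by
      rw [← hF2c, hF3, Multiset.card_add]
    have h5 : Multiset.card H ≤ k * a := by
      rw [← hFc, hHL, Multiset.card_add]; omega
    have h6 : (k * b : ℕ) ≤ C0 + (t + Multiset.card F3) := by omega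
    have h7 : ((k * b : ℕ) : ℚ) ≤ C0 + ((t + Multiset.card F3 : ℕ) : ℚ) := by exact_mod_cast h6
    have h8 : ((Multiset.card H : ℕ) : ℚ) ≤ ((k * a : ℕ) : ℚ) := by exact_mod_cast h5
    have h9 := mul_le_mul_of_nonneg_left h8 hR
    push_cast at h7 h9 h3
    linarith
  by_contra hc
  push Not at hc
  obtain ⟨k, hk⟩ := exists_nat_gt ((C0 : ℚ) / (b - R * a))
  have hpos : 0 < (b : ℚ) - R * a := by linarith
  rw [div_lt_iff₀ hpos] at hk
  have := key k
  linarith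

end Transfer
end ZS


namespace ZS

variable {G : Type*} [AddCommGroup G]

/-- cross number -/
noncomputable def kk (g : G) : ℚ := 1 / (addOrderOf g : ℚ)

noncomputable def k (B : Multiset G) : ℚ := wt kk B

@[simp] lemma k_zero : k (0 : Multiset G) = 0 := wt_zero _
@[simp] lemma k_add (A B : Multiset G) : k (A + B) = k A + k B := wt_add _ _ _
@[simp] lemma k_cons (a : G) (B : Multiset G) : k (a ::ₘ B) = kk a + k B := wt_cons _ _ _
@[simp] lemma k_singleton (a : G) : k ({a} : Multiset G) = kk a := wt_singleton _ _
@[simp] lemma k_replicate (m : ℕ) (a : G) : k (Multiset.replicate m a) = m * kk a := wt_replicate _ _ _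
@[simp] lemma k_nsmul (m : ℕ) (A : Multiset G) : k (m • A) = m * k A := wt_nsmul _ _ _
lemma k_sum (F : Multiset (Multiset G)) : k F.sum = (F.map k).sum := wt_sum _ _
lemma k_finsum {ι : Type*} (s : Finset ι) (F : ι → Multiset G) :
    k (∑ i ∈ s, F i) = ∑ i ∈ s, k (F i) := wt_finsum _ _ _
lemma kk_nonneg (g : G) : 0 ≤ kk g := by unfold kk; positivity
lemma k_nonneg (B : Multiset G) : 0 ≤ k B := wt_nonneg fun g _ => kk_nonneg g

lemma over_repr {ι : Type*} [Fintype ι] (e : ι → G) (he : Function.Injective e) {T : Multiset G}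
    (hT : Over (Set.range e) T) : T = ∑ i, Multiset.replicate (T.count (e i)) (e i) := by
  ext g
  rw [Multiset.count_sum']
  simp only [Multiset.count_replicate]
  by_cases hg : g ∈ T
  · obtain ⟨i, rfl⟩ := hT g hg
    rw [Finset.sum_eq_single i]
    · simp
    · intro j _ hj
      rw [if_neg (fun h => hj (he h))]
    · simp
  · rw [Multiset.count_eq_zero_of_notMem hg, Finset.sum_eq_zero]
    intro i _
    split_ifs with h
    · rw [h]; exact Multiset.count_eq_zero_of_notMem hg
    · rfl

lemma over_repr_opt {ι : Type*} [Fintype ι] (e0 : G) (e : ι → G) (he : Function.Injective e)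
    (h0 : ∀ i, e i ≠ e0) {T : Multiset G}
    (hT : ∀ g ∈ T, g = e0 ∨ ∃ i, e i = g) : T = Multiset.replicate (T.count e0) e0 +
      ∑ i, Multiset.replicate (T.count (e i)) (e i) := by
  have := over_repr (fun o : Option ι => o.elim e0 e) (T := T) ?_ ?_
  · rwa [Fintype.sum_option] at this
  · rintro (_ | i) (_ | j) h
    · rfl
    · exact absurd h.symm (h0 j)
    · exact absurd h (h0 i)
    · simp at h; rw [he h]
  · intro g hg
    rcases hT g hg with rfl | ⟨i, rfl⟩
    · exact ⟨none, rfl⟩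
    · exact ⟨some i, rfl⟩

/-- independent elements of order `N` -/
def Ind {ι : Type*} [Fintype ι] (N : ℕ) (e : ι → G) : Prop :=
  (∀ i, N • e i = 0) ∧ ∀ z : ι → ℤ, ∑ i, z i • e i = 0 → ∀ i, (N : ℤ) ∣ z i

lemma Ind.inj {ι : Type*} [Fintype ι] {N : ℕ} {e : ι → G} (h : Ind N e) (hN : 2 ≤ N) :
    Function.Injective e := by
  intro i j hij
  by_contra hne
  have := h.2 (fun l => if l = i then 1 else if l = j then -1 else 0) ?_ i
  · simp at this
    have := Int.eq_one_of_dvd_one (by positivity) this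
    omega
  · rw [Finset.sum_eq_add_of_mem i j (by simp) (by simp) hne]
    · simp [hij, Ne.symm hne]
    · intro c _ hc
      simp [hc.1, hc.2]

lemma Ind.nat {ι : Type*} [Fintype ι] {N : ℕ} {e : ι → G} (h : Ind N e) {v : ι → ℕ}
    (hv : ∑ i, v i • e i = 0) (i : ι) : N ∣ v i := by
  have := h.2 (fun i => (v i : ℤ)) (by simpa using hv) i
  exact_mod_cast this

lemma Ind.single {ι : Type*} [Fintype ι] {N : ℕ} {e : ι → G} (h : Ind N e) {v : ℕ} {i : ι}
    (hv : v • e i = 0) : N ∣ v := by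
  have := h.nat (v := fun j => if j = i then v else 0) (by
    rw [Finset.sum_eq_single i] <;> simp +contextual [hv]) i
  simpa using this

lemma Ind.ord {ι : Type*} [Fintype ι] {N : ℕ} {e : ι → G} (h : Ind N e) (i : ι) :
    addOrderOf (e i) = N :=
  Nat.dvd_antisymm (addOrderOf_dvd_of_nsmul_eq_zero (h.1 i)) (h.single (addOrderOf_nsmul_eq_zero _))

lemma sum_replicate_repr {ι : Type*} [Fintype ι] (e : ι → G) (v : ι → ℕ) :
    (∑ i, Multiset.replicate (v i) (e i)).sum = ∑ i, v i • e i := by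
  rw [← Multiset.coe_sumAddMonoidHom, map_sum]
  simp

section W
variable [Finite G] {ι : Type*} [Fintype ι] {N : ℕ} {e : ι → G}

lemma Ind.ne_sum (h : Ind N e) (hN : 2 ≤ N) (hR : 2 ≤ Fintype.card ι) (i : ι) :
    e i ≠ ∑ j, e j := by
  intro heq
  have : Nontrivial ι := Fintype.one_lt_card_iff_nontrivial.1 hR
  obtain ⟨j, hj⟩ := exists_ne i
  have := h.nat (v := fun l => if l = i then 0 else 1) (by
    have h1 : e i + ∑ l, (if l = i then 0 else 1) • e l = e i + 0 := by
      rw [add_zero, heq, ← Finset.add_sum_erase Finset.univ e (Finset.mem_univ i), 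
        ← Finset.add_sum_erase Finset.univ (fun l => (if l = i then 0 else 1) • e l) (Finset.mem_univ i)]
      simp only [if_true, zero_smul, zero_add]
      rw [← heq.trans (Finset.add_sum_erase Finset.univ e (Finset.mem_univ i)).symm]
      have : ∑ x ∈ Finset.univ.erase i, (if x = i then 0 else 1) • e x = 
        ∑ x ∈ Finset.univ.erase i, e x := by
        apply Finset.sum_congr rfl
        intro x hx
        simp [Finset.ne_of_mem_erase hx]
      rw [this]
      rw [Finset.add_sum_erase Finset.univ e (Finset.mem_univ i), ← heq]
    exact add_left_cancel h1) j
  simp [hj] at this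
  omega

lemma W_dset (h : Ind N e) (hN : 2 ≤ N) (hR : 2 ≤ Fintype.card ι) :
    DSet (Fintype.card ι - 1) (insert (∑ j, e j) (Set.range e)) := by
  set R := Fintype.card ι with hRdef
  set e0 := ∑ j, e j with he0
  have hinj := h.inj hN
  have hne : ∀ i, e i ≠ e0 := h.ne_sum hN hR
  have hNQ : (N : ℚ) ≠ 0 := by positivity
  apply dset_of_wt (w := fun g => if g = e0 then (R : ℚ) / N else 1 / N)
  intro A hA hAo
  have hwi : ∀ m i, wt (fun g => if g = e0 then (R : ℚ) / N else 1 / N) (Multiset.replicate m (e i)) = m * (1 / N) := by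
    intro m i; rw [wt_replicate, if_neg (hne i)]
  have hw0 : ∀ m, wt (fun g => if g = e0 then (R : ℚ) / N else 1 / N) (Multiset.replicate m e0) = m * (R / N) := by
    intro m; rw [wt_replicate, if_pos rfl]
  have hrep := over_repr_opt e0 e hinj hne (T := A) (by
    intro g hg
    rcases hAo g hg with h | ⟨i, h⟩
    exacts [Or.inl h, Or.inr ⟨i, h⟩])
  have hd : ∀ i, N ∣ A.count e0 + A.count (e i) := by
    apply h.nat
    have h0 := hA.2.1
    rw [hrep, Multiset.sum_add, sum_replicate_repr, Multiset.sum_replicate] at h0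
    rw [← h0, he0, ← Finset.sum_nsmul, ← Finset.sum_add_distrib]
    simp [add_smul]
  have hRc : ((R - 1 : ℕ) : ℚ) = R - 1 := by rw [Nat.cast_sub (by omega)]; simp
  have hNe0 : N • e0 = 0 := by
    rw [he0, ← Finset.sum_nsmul]; exact Finset.sum_eq_zero fun i _ => h.1 i
  by_cases hb : A.count e0 = 0
  · -- A = e_i ^ N
    have : ∃ i, 0 < A.count (e i) := by
      by_contra hc
      push Not at hc
      apply hA.1
      rw [hrep, hb]
      simp [Finset.sum_eq_zero_iff, fun i => Nat.le_zero.1 (hc i)]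
    obtain ⟨i, hi⟩ := this
    have hi2 := Nat.le_of_dvd hi (by simpa [hb] using hd i)
    have := Atom.eq_of_le' (A := Multiset.replicate N (e i)) (by
      intro h; have := congrArg Multiset.card h; simp at this; omega) (by simp [h.1]) hA
      (Multiset.le_count_iff_replicate_le.1 hi2)
    refine ⟨0, ?_⟩
    rw [← this, hwi]
    field_simp
    simp
  · have hb' : 0 < A.count e0 := Nat.pos_of_ne_zero hb
    refine ⟨1, ?_⟩
    rw [hRc]
    by_cases hbN : N ≤ A.count e0
    · have := Atom.eq_of_le' (A := Multiset.replicate N e0) (by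
        intro h; have := congrArg Multiset.card h; simp at this; omega) (by simp [hNe0]) hA
        (Multiset.le_count_iff_replicate_le.1 hbN)
      rw [← this, hw0]
      field_simp
      simp
    · push Not at hbN
      set b := A.count e0 with hbdef
      have hge : ∀ i, N - b ≤ A.count (e i) := by
        intro i
        have := Nat.le_of_dvd (by omega) (hd i)
        omega
      have := Atom.eq_of_le' (A := Multiset.replicate b e0 + ∑ i, Multiset.replicate (N - b) (e i))
        (by
          intro h
          have := (add_eq_zero.1 h).1
          have := congrArg Multiset.card this
          simp at this; omega)
        (by
          rw [Multiset.sum_add, sum_replicate_repr, Multiset.sum_replicate, he0, ← Finset.sum_nsmul,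
            ← Finset.sum_add_distrib]
          apply Finset.sum_eq_zero
          intro i _
          rw [← add_smul, show b + (N - b) = N by omega, h.1]) hA
        (by
          rw [hrep]
          apply add_le_add
          · exact le_rfl
          · apply Finset.sum_le_sum
            intro i _
            exact Multiset.replicate_le_replicate _ |>.2 (hge i))
      rw [← this, wt_add, hw0, wt_finsum]
      simp only [hwi]
      rw [Finset.sum_const, Finset.card_univ, ← hRdef, Nat.cast_sub hbN.le]
      simp only [nsmul_eq_mul]
      field_simp
      push_cast
      ring

lemma W_atom (h : Ind N e) (hN : 2 ≤ N) (hR : 2 ≤ Fintype.card ι) :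
    Atom ({∑ j, e j} + ∑ i, Multiset.replicate (N - 1) (e i)) := by
  set e0 := ∑ j, e j with he0
  have hinj := h.inj hN
  have hne : ∀ i, e i ≠ e0 := h.ne_sum hN hR
  have hc0 : Multiset.count e0 ({e0} + ∑ i, Multiset.replicate (N - 1) (e i)) = 1 := by
    rw [Multiset.count_add, Multiset.count_sum']
    simp only [Multiset.count_singleton_self, Multiset.count_replicate, hne, if_false]
    simp
  have hci : ∀ i, Multiset.count (e i) ({e0} + ∑ i, Multiset.replicate (N - 1) (e i)) = N - 1 := by
    intro i
    rw [Multiset.count_add, Multiset.count_sum']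
    simp only [Multiset.count_singleton, hne, if_false, Multiset.count_replicate, hinj.eq_iff]
    simp
  refine ⟨?_, ?_, ?_⟩
  · intro h
    simp at h
  · rw [Multiset.sum_add, sum_replicate_repr, Multiset.sum_singleton, he0, ← Finset.sum_add_distrib]
    apply Finset.sum_eq_zero
    intro i _
    rw [← succ_nsmul', show N - 1 + 1 = N by omega, h.1]
  · intro T hT hs
    have hrep := over_repr_opt e0 e hinj hne (T := T) (by
      intro g hg
      rcases Multiset.mem_add.1 (Multiset.mem_of_le hT hg) with h | h
      · left; simpa using h
      · obtain ⟨i, _, hi⟩ := Multiset.mem_sum.1 h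
        right; exact ⟨i, (Multiset.eq_of_mem_replicate hi).symm⟩)
    have hd : ∀ i, N ∣ T.count e0 + T.count (e i) := by
      apply h.nat
      have h0 := hs
      rw [hrep, Multiset.sum_add, sum_replicate_repr, Multiset.sum_replicate] at h0
      rw [← h0, he0, ← Finset.sum_nsmul, ← Finset.sum_add_distrib]
      simp [add_smul]
    have hle0 := hc0 ▸ Multiset.count_le_of_le e0 hT
    have hlei : ∀ i, T.count (e i) ≤ N - 1 := fun i => hci i ▸ Multiset.count_le_of_le (e i) hT
    have hcase : T.count e0 = 0 ∨ T.count e0 = 1 := by omega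
    rcases hcase with hb | hb
    · left
      rw [hrep, hb]
      have : ∀ i, T.count (e i) = 0 := fun i => by
        have h1 := hd i
        have h2 := hlei i
        rw [hb, zero_add] at h1
        exact Nat.eq_zero_of_dvd_of_lt h1 (by omega)
      simp [this]
    · right
      rw [hrep, hb]
      have : ∀ i, T.count (e i) = N - 1 := fun i => by
        have h1 := Nat.le_of_dvd (by omega) (hd i)
        have h2 := hlei i
        omega
      simp [this]

lemma W_over (e : ι → G) (N : ℕ) : Over (insert (∑ j, e j) (Set.range e))
    ({∑ j, e j} + ∑ i, Multiset.replicate (N - 1) (e i)) := by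
  apply Over.add
  · intro g hg; simp at hg; simp [hg]
  · apply Over.finsum
    intro i _
    apply Over.replicate; simp

lemma elast_W1 {ρ : ℚ} (h : Ind N e) (hN : 2 ≤ N) (hR : 2 ≤ Fintype.card ι)
    (hE : Elast G (Fintype.card ι - 1) ρ) : (Fintype.card ι + 1 : ℚ) ≤ ρ * 2 := by
  set W := ({∑ j, e j} + ∑ i, Multiset.replicate (N - 1) (e i) : Multiset G) with hW
  have h1 : HasLen (2 • W) (2 * 1) := (W_atom h hN hR).hasLen.nsmul 2
  have hsplit : 2 • W = (Multiset.replicate 2 (∑ j, e j) + ∑ i, Multiset.replicate (N - 2) (e i)) +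
      ∑ i, Multiset.replicate N (e i) := by
    rw [hW, smul_add, add_assoc, ← Finset.sum_add_distrib, Multiset.nsmul_singleton, Finset.smul_sum]
    congr 1
    apply Finset.sum_congr rfl
    intro i _
    rw [Multiset.nsmul_replicate, ← Multiset.replicate_add]
    congr 1
    omega
  have hlN : ∀ i ∈ Finset.univ, HasLen (Multiset.replicate N (e i)) 1 := fun i _ => by
    have := atom_ord (e i)
    rw [h.ord] at this
    exact this.hasLen
  have h2 := HasLen.finsum Finset.univ hlN
  have hs := h1.sum_eq
  rw [hsplit, Multiset.sum_add, h2.sum_eq, add_zero] at hs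
  obtain ⟨l, hl, hl2⟩ := exists_len_pos _ hs (by
    intro h
    have := (add_eq_zero.1 h).1
    have := congrArg Multiset.card this
    simp at this)
  have h3 := hl2.add h2
  rw [← hsplit] at h3
  have := hE _ (W_dset h hN hR) (2 • W) ((W_over e N).nsmul 2) _ _ h1 h3
  simp at this
  have hl' : (1 : ℚ) ≤ l := by exact_mod_cast hl
  linarith

lemma elast_WN {ρ : ℚ} (h : Ind N e) (hN : 2 ≤ N) (hR : 2 ≤ Fintype.card ι)
    (hE : Elast G (Fintype.card ι - 1) ρ) : 1 + (Fintype.card ι : ℚ) * (N - 1) ≤ ρ * N := by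
  set W := ({∑ j, e j} + ∑ i, Multiset.replicate (N - 1) (e i) : Multiset G) with hW
  have h1 : HasLen (N • W) (N * 1) := (W_atom h hN hR).hasLen.nsmul N
  have hsplit : N • W = Multiset.replicate N (∑ j, e j) + 
      ∑ i, (N - 1) • Multiset.replicate N (e i) := by
    rw [hW, smul_add, Multiset.nsmul_singleton, Finset.smul_sum]
    congr 1
    apply Finset.sum_congr rfl
    intro i _
    rw [Multiset.nsmul_replicate, Multiset.nsmul_replicate, mul_comm]
  have hlN : ∀ i ∈ Finset.univ, HasLen ((N - 1) • Multiset.replicate N (e i)) ((N - 1) * 1) := fun i _ => by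
    have := atom_ord (e i)
    rw [h.ord] at this
    exact this.hasLen.nsmul _
  have h2 := HasLen.finsum Finset.univ hlN
  have hs := h1.sum_eq
  rw [hsplit, Multiset.sum_add, h2.sum_eq, add_zero] at hs
  obtain ⟨l, hl, hl2⟩ := exists_len_pos _ hs (by
    intro h
    have := congrArg Multiset.card h
    simp at this
    omega)
  have h3 := hl2.add h2
  rw [← hsplit] at h3
  have := hE _ (W_dset h hN hR) (N • W) ((W_over e N).nsmul N) _ _ h1 h3
  simp at this
  have hl' : (1 : ℚ) ≤ l := by exact_mod_cast hl
  rw [Nat.cast_sub (by omega)] at this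
  push_cast at this
  linarith

end W

lemma atom_pair {g : G} (hg : g ≠ 0) : Atom ({g, -g} : Multiset G) := by
  refine ⟨by simp, by simp, ?_⟩
  intro T hT hs
  have hc : Multiset.card T ≤ 2 := by simpa using Multiset.card_le_card hT
  have hmem : ∀ x ∈ T, x = g ∨ x = -g := fun x hx => by
    have := Multiset.mem_of_le hT hx
    simpa using this
  have h3 : Multiset.card T = 0 ∨ Multiset.card T = 1 ∨ Multiset.card T = 2 := by omega
  rcases h3 with h | h | h
  · left; exact Multiset.card_eq_zero.1 h
  · obtain ⟨x, rfl⟩ := Multiset.card_eq_one.1 h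
    simp at hs
    exfalso
    rcases hmem x (by simp) with h | h
    · exact hg (h ▸ hs)
    · rw [h] at hs; exact hg (by simpa using hs)
  · right
    exact Multiset.eq_of_le_of_card_le hT (by simp [h])

lemma pair_dset [Finite G] {g : G} {n : ℕ} (hn : addOrderOf g = n) (h3 : 3 ≤ n) :
    DSet (n - 2) ({g, -g} : Set G) := by
  have hnQ : (n : ℚ) ≠ 0 := by positivity
  have hg0 : g ≠ 0 := by rintro rfl; simp at hn; omega
  have hng : -g ≠ g := by
    intro h
    have : 2 • g = 0 := by rw [two_nsmul]; nth_rewrite 1 [← h]; simp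
    have := Nat.le_of_dvd (by norm_num) (addOrderOf_dvd_of_nsmul_eq_zero this)
    omega
  apply dset_of_wt (w := fun x => if x = g then (1 : ℚ) / n else 1 - 1 / n)
  intro A hA hAo
  have hcast : ((n - 2 : ℕ) : ℚ) = n - 2 := by rw [Nat.cast_sub (by omega)]; simp
  by_cases h1 : g ∈ A
  · by_cases h2 : -g ∈ A
    · have hle : ({g, -g} : Multiset G) ≤ A := by
        have : ({g, -g} : Multiset G) = g ::ₘ {-g} := rfl
        rw [this, Multiset.cons_le_of_notMem (by simpa using hng.symm)]
        exact ⟨h1, Multiset.singleton_le.2 h2⟩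
      have := (atom_pair hg0).eq_of_le hA hle
      refine ⟨0, ?_⟩
      rw [← this]
      simp [wt, hng]
    · have hrep : A = Multiset.replicate (Multiset.card A) g := Multiset.eq_replicate.2 ⟨rfl, fun x hx => by
        rcases hAo x hx with h | h
        · exact h
        · rw [h] at hx; exact absurd hx h2⟩
      have hs := hA.2.1
      rw [hrep, Multiset.sum_replicate] at hs
      have hd := Nat.le_of_dvd (Multiset.card_pos.2 hA.1) (addOrderOf_dvd_of_nsmul_eq_zero hs)
      have hle : Multiset.replicate (addOrderOf g) g ≤ A := by
        rw [hrep]; exact Multiset.replicate_le_replicate _ |>.2 hd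
      have := (atom_ord g).eq_of_le hA hle
      refine ⟨0, ?_⟩
      rw [← this, hn, wt_replicate]
      simp [hnQ]
  · have hrep : A = Multiset.replicate (Multiset.card A) (-g) := Multiset.eq_replicate.2 ⟨rfl, fun x hx => by
        rcases hAo x hx with h | h
        · rw [h] at hx; exact absurd hx h1
        · exact h⟩
    have hs := hA.2.1
    rw [hrep, Multiset.sum_replicate] at hs
    have hd := Nat.le_of_dvd (Multiset.card_pos.2 hA.1) (addOrderOf_dvd_of_nsmul_eq_zero hs)
    have hle : Multiset.replicate (addOrderOf (-g)) (-g) ≤ A := by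
      rw [hrep]; exact Multiset.replicate_le_replicate _ |>.2 hd
    have := (atom_ord (-g)).eq_of_le hA hle
    refine ⟨1, ?_⟩
    rw [← this, addOrderOf_neg, hn, wt_replicate, if_neg hng, hcast]
    field_simp
    push_cast
    ring

lemma pair_nsmul (g : G) (m : ℕ) : m • ({g, -g} : Multiset G) = 
    Multiset.replicate m g + Multiset.replicate m (-g) := by
  rw [show ({g, -g} : Multiset G) = {g} + {-g} from rfl, smul_add, Multiset.nsmul_singleton, Multiset.nsmul_singleton]

lemma elast_pair [Finite G] {g : G} {n : ℕ} {ρ : ℚ} (hn : addOrderOf g = n) (h3 : 3 ≤ n)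
    (hE : Elast G (n - 2) ρ) : (n : ℚ) ≤ ρ * 2 := by
  have hg0 : g ≠ 0 := by rintro rfl; simp at hn; omega
  have h1 : HasLen (n • ({g, -g} : Multiset G)) (n * 1) := (atom_pair hg0).hasLen.nsmul n
  have h2 : HasLen (n • ({g, -g} : Multiset G)) (1 + 1) := by
    rw [pair_nsmul]
    have a1 := atom_ord g
    have a2 := atom_ord (-g)
    rw [addOrderOf_neg] at a2
    rw [hn] at a1 a2
    exact a1.hasLen.add a2.hasLen
  have := hE _ (pair_dset hn h3) _ (Over.nsmul (A := ({g, -g} : Multiset G)) (by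
    intro x hx; simpa using hx) n) _ _ h2 h1
  push_cast at this
  linarith

end ZS


namespace ZS

variable {G : Type*} [AddCommGroup G]

/-- `e` is a positive multiple of the exponent -/
def Expo (G : Type*) [AddCommGroup G] (e : ℕ) : Prop := 0 < e ∧ ∀ g : G, e • g = 0

def LCN (S : Set G) : Prop := ∀ A, Atom A → Over S A → 1 ≤ k A
def HF (S : Set G) : Prop := ∀ A, Atom A → Over S A → k A = 1

lemma LCN.mono {S T : Set G} (h : LCN T) (hST : S ⊆ T) : LCN S :=
  fun A hA hAo => h A hA (hAo.mono_set hST)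
lemma HF.mono {S T : Set G} (h : HF T) (hST : S ⊆ T) : HF S :=
  fun A hA hAo => h A hA (hAo.mono_set hST)

lemma HF.len {S : Set G} (h : HF S) {B : Multiset G} (hB : Over S B) {l : ℕ} (hl : HasLen B l) :
    k B = l := by
  have := wt_bounds (S := S) (w := kk) (R := 1) (fun A hA hAo => by
    have := h A hA hAo
    unfold k at this
    rw [this]; exact ⟨le_rfl, le_rfl⟩) hB hl
  unfold k
  linarith [this.1, this.2]

lemma LCN.len {S : Set G} (h : LCN S) {B : Multiset G} (hB : Over S B) {l : ℕ} (hl : HasLen B l) :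
    (l : ℚ) ≤ k B := by
  obtain ⟨F, hF, rfl, rfl⟩ := hl
  have : ∀ A ∈ F, 1 ≤ k A := fun A hA => h A (hF A hA) (hB.of_sum hA)
  clear hB hF
  induction F using Multiset.induction_on with
  | empty => simp
  | cons a F ih =>
    have h1 := this a (by simp)
    have h2 := ih (fun A hA => this A (by simp [hA]))
    simp only [Multiset.sum_cons, k_add, Multiset.card_cons]
    push_cast
    linarith

variable [Finite G]

lemma ord_mul_kk (g : G) : (addOrderOf g : ℚ) * kk g = 1 := by
  unfold kk
  have : (addOrderOf g : ℚ) ≠ 0 := by exact_mod_cast (ord_pos g).ne'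
  field_simp

lemma kk_pos (g : G) : 0 < kk g := by
  unfold kk
  have : (0 : ℚ) < addOrderOf g := by exact_mod_cast (ord_pos g)
  positivity

lemma k_pos {B : Multiset G} (h : B ≠ 0) : 0 < k B := by
  obtain ⟨a, ha⟩ := Multiset.exists_mem_of_ne_zero h
  obtain ⟨B', rfl⟩ := Multiset.exists_cons_of_mem ha
  rw [k_cons]
  have := kk_pos a
  have := k_nonneg B'
  linarith

lemma k_ord (g : G) : k (Multiset.replicate (addOrderOf g) g) = 1 := by
  rw [k_replicate, ord_mul_kk]

lemma Expo.ord_dvd {e : ℕ} (he : Expo G e) (g : G) : addOrderOf g ∣ e :=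
  addOrderOf_dvd_of_nsmul_eq_zero (he.2 g)

lemma Expo.ord_le {e : ℕ} (he : Expo G e) (g : G) : addOrderOf g ≤ e :=
  Nat.le_of_dvd he.1 (he.ord_dvd g)

lemma hasLen_mul_ord (g : G) (m : ℕ) : HasLen (Multiset.replicate (m * addOrderOf g) g) m := by
  have := (atom_ord g).hasLen.nsmul m
  rwa [Multiset.nsmul_replicate, mul_one] at this

lemma nsmul_len {e : ℕ} (he : Expo G e) (B : Multiset G) :
    ∃ l : ℕ, HasLen (e • B) l ∧ (l : ℚ) = e * k B ∧ Multiset.card B ≤ l := by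
  induction B using Multiset.induction_on with
  | empty => exact ⟨0, by simpa using HasLen.zero, by simp, by simp⟩
  | cons a B ih =>
    obtain ⟨l, h1, h2, h3⟩ := ih
    obtain ⟨m, hm⟩ := he.ord_dvd a
    have hm0 : 0 < m := Nat.pos_of_ne_zero (by rintro rfl; have := he.1; omega)
    refine ⟨m + l, ?_, ?_, ?_⟩
    · rw [← Multiset.singleton_add, smul_add, Multiset.nsmul_singleton]
      refine HasLen.add ?_ h1
      conv => arg 1; arg 1; rw [hm, mul_comm]
      exact hasLen_mul_ord a m
    · rw [k_cons]
      push_cast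
      rw [h2, mul_add]
      congr 1
      rw [hm]
      push_cast
      have := ord_mul_kk a
      rw [mul_comm (addOrderOf a : ℚ), mul_assoc, this, mul_one]
    · simp; omega

lemma card_le_expo_mul_k {e : ℕ} (he : Expo G e) (B : Multiset G) :
    (Multiset.card B : ℚ) ≤ e * k B := by
  obtain ⟨l, _, h2, h3⟩ := nsmul_len he B
  rw [← h2]; exact_mod_cast h3

lemma ord_gt_two_ne_neg {g : G} (h : 3 ≤ addOrderOf g) : -g ≠ g := by
  intro h'
  have : 2 • g = 0 := by rw [two_nsmul]; nth_rewrite 1 [← h']; simp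
  have := Nat.le_of_dvd (by norm_num) (addOrderOf_dvd_of_nsmul_eq_zero this)
  omega

lemma non_LCN {d e : ℕ} {S : Set G} (hS : DSet d S) (he : Expo G e) (hed : e ≤ d + 2)
    {U : Multiset G} (hU : Atom U) (hUo : Over S U) (hk : k U < 1) :
    ∃ g, U = {g, -g} ∧ addOrderOf g = d + 2 ∧ e = d + 2 := by
  obtain ⟨l, h1, h2, h3⟩ := nsmul_len he U
  have h4 := hU.hasLen.nsmul e
  have hdv := hS _ (hUo.nsmul e) _ _ h4 h1
  have heQ : (0 : ℚ) < e := by exact_mod_cast he.1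
  have hlt : l < e := by
    have : (l : ℚ) < e := by rw [h2]; nlinarith
    exact_mod_cast this
  rw [mul_one] at hdv
  have hge := Int.le_of_dvd (by omega) hdv
  have hc1 : 0 < Multiset.card U := Multiset.card_pos.2 hU.1
  have hc : Multiset.card U = 1 ∨ Multiset.card U = 2 := by omega
  rcases hc with hc | hc
  · exfalso
    obtain ⟨x, rfl⟩ := Multiset.card_eq_one.1 hc
    have : x = 0 := by simpa using hU.2.1
    subst this
    simp [kk] at hk
  · obtain ⟨x, y, rfl⟩ := Multiset.card_eq_two.1 hc
    have hs : x + y = 0 := by simpa using hU.2.1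
    have hy : y = -x := (neg_eq_of_add_eq_zero_right hs).symm
    subst hy
    have hl2 : l = 2 := by omega
    have hee : e = d + 2 := by omega
    refine ⟨x, rfl, ?_, hee⟩
    rw [hl2] at h2
    have hk2 : k ({x, -x} : Multiset G) = 2 * kk x := by
      show k (x ::ₘ {-x}) = _
      rw [k_cons, k_singleton]
      simp [kk]; ring
    rw [hk2] at h2
    have h5 := ord_mul_kk x
    have h6 : (e : ℚ) * kk x = 1 := by push_cast at h2; linarith
    have h7 : (addOrderOf x : ℚ) = e := by
      have hp := kk_pos x
      exact mul_right_cancel₀ hp.ne' (h5.trans h6.symm)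
    rw [← hee]
    exact_mod_cast h7

/-- support as a set -/
def supp (A : Multiset G) : Set G := {g | g ∈ A}

lemma over_supp (A : Multiset G) : Over (supp A) A := fun _ hg => hg

lemma pair_le {A : Multiset G} {g : G} (h1 : g ∈ A) (h2 : -g ∈ A) (hne : -g ≠ g) :
    ({g, -g} : Multiset G) ≤ A := by
  have : ({g, -g} : Multiset G) = g ::ₘ {-g} := rfl
  rw [this, Multiset.cons_le_of_notMem (by simpa using hne.symm)]
  exact ⟨h1, Multiset.singleton_le.2 h2⟩

lemma nonpair_LCN {d e : ℕ} (hd : 1 ≤ d) {S : Set G} (hS : DSet d S) (he : Expo G e) (hed : e ≤ d + 2)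
    {A : Multiset G} (hA : Atom A) (hAo : Over S A)
    (hnp : ∀ g, A = {g, -g} → addOrderOf g ≠ d + 2) : LCN (supp A) := by
  intro U hU hUo
  by_contra hk
  push Not at hk
  have hUS : Over S U := fun g hg => hAo g (hUo g hg)
  obtain ⟨g, rfl, hg, _⟩ := non_LCN hS he hed hU hUS hk
  have hne : -g ≠ g := ord_gt_two_ne_neg (by omega)
  have := hU.eq_of_le hA (pair_le (hUo g (by simp)) (hUo (-g) (by simp)) hne)
  exact hnp g this.symm hg

lemma LCN_of_expo {d e : ℕ} {S : Set G} (hS : DSet d S) (he : Expo G e) (hed : e ≤ d + 1) : LCN S := by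
  intro U hU hUo
  by_contra hk
  push Not at hk
  obtain ⟨g, _, _, h⟩ := non_LCN hS he (by omega) hU hUo hk
  omega

lemma HF_small_atom {d : ℕ} {S : Set G} (hS : DSet d S) (hL : LCN S) {U : Multiset G}
    (hU : Atom U) (hUo : Over S U) (hk : 1 < k U) : d + 2 ≤ U.toFinset.card := by
  set X : Multiset G := ∑ h ∈ U.toFinset, Multiset.replicate (addOrderOf h - U.count h) h with hX
  have hUX : U + X = ∑ h ∈ U.toFinset, Multiset.replicate (addOrderOf h) h := by
    conv_lhs => rw [← Multiset.toFinset_sum_count_nsmul_eq U]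
    rw [hX, ← Finset.sum_add_distrib]
    apply Finset.sum_congr rfl
    intro h _
    rw [Multiset.nsmul_singleton, ← Multiset.replicate_add]
    congr 1
    have := hU.count_le h
    omega
  have hXo : Over S X := Over.finsum _ fun h hh => Over.replicate (hUo h (Multiset.mem_toFinset.1 hh)) _
  have h1 : HasLen (U + X) U.toFinset.card := by
    rw [hUX, Finset.card_eq_sum_ones]
    exact HasLen.finsum _ fun h _ => (atom_ord h).hasLen
  have hXs : X.sum = 0 := by
    have := h1.sum_eq
    rwa [Multiset.sum_add, hU.2.1, zero_add] at this
  have hX0 : X ≠ 0 := by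
    intro h0
    obtain ⟨g, hg⟩ := Multiset.exists_mem_of_ne_zero hU.1
    rw [h0, add_zero] at hUX
    have hle : Multiset.replicate (addOrderOf g) g ≤ U := by
      conv_rhs => rw [hUX]
      exact Finset.single_le_sum (f := fun h => Multiset.replicate (addOrderOf h) h)
        (fun _ _ => Multiset.zero_le _) (Multiset.mem_toFinset.2 hg)
    have := (atom_ord g).eq_of_le hU hle
    rw [← this, k_ord] at hk
    exact lt_irrefl _ hk
  obtain ⟨q, hq0, hq⟩ := exists_len_pos X hXs hX0
  have hqk := hL.len hXo hq
  have hkX : k U + k X = U.toFinset.card := by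
    rw [← k_add, hUX, k_finsum]
    simp [k_ord, -k_replicate]
  have hdv := hS _ (hUo.add hXo) _ _ h1 (hU.hasLen.add hq)
  have hlt : 1 + q < U.toFinset.card := by
    have : (1 + q : ℚ) < U.toFinset.card := by linarith
    exact_mod_cast this
  have := Int.le_of_dvd (by push_cast; omega) hdv
  push_cast at this
  omega

lemma toFinset_card_le {S : Set G} {U : Multiset G} (hUo : Over S U) : U.toFinset.card ≤ S.ncard := by
  rw [← Set.ncard_coe_finset]
  apply Set.ncard_le_ncard _ (Set.toFinite S)
  intro x hx
  exact hUo x (by simpa using hx)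

lemma HF_small {d : ℕ} {S : Set G} (hS : DSet d S) (hL : LCN S) (hc : S.ncard ≤ d + 1) : HF S := by
  intro A hA hAo
  apply le_antisymm _ (hL A hA hAo)
  by_contra h
  push Not at h
  have := HF_small_atom hS hL hA hAo h
  have := toFinset_card_le hAo
  omega

end ZS


namespace ZS

noncomputable def tors (G : Type*) [AddCommGroup G] (m : ℕ) : ℕ := Nat.card {h : G // m • h = 0}

lemma tors_le {G : Type*} [AddCommGroup G] {r : ℕ} (n : Fin r → ℕ) (hn : ∀ i, 1 < n i)
    (φ : G ≃+ (∀ i : Fin r, ZMod (n i))) {m : ℕ} (hm : 0 < m) : tors G m ≤ ∏ i, Nat.gcd m (n i) := by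
  have : ∀ i, NeZero (n i) := fun i => ⟨by have := hn i; omega⟩
  unfold tors
  have h1 : ∀ i, (Finset.univ.filter (fun x : ZMod (n i) => (Nat.gcd m (n i)) • x = 0)).card ≤ Nat.gcd m (n i) :=
    fun i => IsAddCyclic.card_nsmul_eq_zero_le (Nat.gcd_pos_of_pos_left _ hm)
  refine le_trans ?_ (Finset.prod_le_prod' fun i _ => h1 i)
  rw [← Fintype.card_piFinset, ← Fintype.card_coe, ← Nat.card_eq_fintype_card]
  refine Nat.card_le_card_of_injective (fun x => ⟨φ x.1, ?_⟩) ?_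
  · simp only [Fintype.mem_piFinset, Finset.mem_filter, Finset.mem_univ, true_and]
    intro i
    have h2 : m • φ x.1 i = 0 := by
      have : φ (m • x.1) i = 0 := by rw [x.2]; simp
      rwa [map_nsmul] at this
    apply addOrderOf_dvd_iff_nsmul_eq_zero.1
    apply Nat.dvd_gcd (addOrderOf_dvd_of_nsmul_eq_zero h2)
    apply addOrderOf_dvd_of_nsmul_eq_zero
    simp
  · intro x y hxy
    simp at hxy
    exact Subtype.ext hxy

lemma lemma_L {G : Type*} [AddCommGroup G] [Finite G] {ι : Type*} [Fintype ι] (v : ι → G) {m : ℕ} (hm : 0 < m)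
    (h : ∀ z : ι → ℤ, ∑ i, z i • v i = 0 → ∀ i, (m : ℤ) ∣ z i) :
    m ^ Fintype.card ι ≤ tors G m := by
  have : NeZero m := ⟨hm.ne'⟩
  let φ : (ι → ℤ) →+ G :=
    { toFun := fun z => ∑ i, z i • v i
      map_zero' := by simp
      map_add' := fun x y => by simp [add_smul, Finset.sum_add_distrib] }
  let c : (ι → ℤ) →+ (ι → ZMod m) :=
    { toFun := fun z i => (z i : ZMod m)
      map_zero' := by ext; simp
      map_add' := fun x y => by ext; simp }
  have hc : φ.ker ≤ c.ker := by
    intro z hz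
    have := h z hz
    rw [AddMonoidHom.mem_ker]
    ext i
    exact (ZMod.intCast_zmod_eq_zero_iff_dvd _ _).2 (this i)
  let θ : (ι → ℤ) ⧸ φ.ker →+ (ι → ZMod m) := QuotientAddGroup.lift φ.ker c hc
  let ψ : (ι → ℤ) ⧸ φ.ker →+ G := QuotientAddGroup.kerLift φ
  have hψ : Function.Injective ψ := QuotientAddGroup.kerLift_injective φ
  have hfin : Finite ((ι → ℤ) ⧸ φ.ker) := Finite.of_injective ψ hψ
  have hθ : Function.Surjective θ := by
    intro y
    refine ⟨QuotientAddGroup.mk (fun i => ((y i).val : ℤ)), ?_⟩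
    ext i
    show (((y i).val : ℤ) : ZMod m) = y i
    simp
  let μ : (ι → ℤ) ⧸ φ.ker →+ (ι → ℤ) ⧸ φ.ker := nsmulAddMonoidHom m
  have h1 := AddSubgroup.card_mul_index μ.ker
  have h2 := AddSubgroup.card_mul_index θ.ker
  rw [AddSubgroup.index_ker] at h1 h2
  have hr : Nat.card θ.range = m ^ Fintype.card ι := by
    rw [AddMonoidHom.range_eq_top.2 hθ]
    simp [Nat.card_eq_fintype_card]
  have hle : μ.range ≤ θ.ker := by
    rintro _ ⟨x, rfl⟩
    rw [AddMonoidHom.mem_ker]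
    show θ (m • x) = 0
    rw [map_nsmul]
    ext i
    simp
  have h3 : Nat.card μ.range ≤ Nat.card θ.ker := AddSubgroup.card_le_of_le hle
  have h4 : Nat.card μ.ker ≤ tors G m := by
    unfold tors
    refine Nat.card_le_card_of_injective (fun x : μ.ker => ⟨ψ x.1, ?_⟩) ?_
    · have hx : m • x.1 = 0 := x.2
      rw [← map_nsmul, hx, map_zero]
    · intro x y hxy
      simp at hxy
      exact Subtype.ext (hψ hxy)
  have hpos : 0 < Nat.card θ.ker := Nat.card_pos
  rw [hr] at h2
  rw [← h2] at h1
  have h5 : Nat.card θ.ker * m ^ Fintype.card ι ≤ Nat.card θ.ker * tors G m := by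
    rw [← h1, mul_comm]
    exact Nat.mul_le_mul h3 h4
  exact Nat.le_of_mul_le_mul_left h5 hpos

variable {G : Type*} [AddCommGroup G] [Finite G]

lemma closure_repr {e : ℕ} (he : Expo G e) (E : Set G) (c : ℕ) {x : G}
    (hx : x ∈ AddSubgroup.closure ((fun g => c • g) '' E)) : ∃ Y, Over E Y ∧ c • Y.sum = x := by
  induction hx using AddSubgroup.closure_induction with
  | mem x hx =>
    obtain ⟨g, hg, rfl⟩ := hx
    exact ⟨{g}, by intro y hy; simp at hy; rwa [hy], by simp⟩
  | zero => exact ⟨0, by intro y hy; simp at hy, by simp⟩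
  | add x y _ _ hx hy =>
    obtain ⟨Y, h1, h2⟩ := hx
    obtain ⟨Y', h1', h2'⟩ := hy
    exact ⟨Y + Y', h1.add h1', by simp [h2, h2']⟩
  | neg x _ hx =>
    obtain ⟨Y, h1, h2⟩ := hx
    refine ⟨(e - 1) • Y, h1.nsmul _, ?_⟩
    rw [Multiset.sum_nsmul, smul_comm, h2]
    have h3 : (e - 1 + 1) • x = 0 := by
      rw [Nat.sub_add_cancel he.1]; exact he.2 x
    rw [succ_nsmul] at h3
    exact eq_neg_of_add_eq_zero_left h3

lemma exists_E {q b c e : ℕ} (hq : q.Prime) (he : Expo G e) (hb : e = q ^ b * c) (S : Set G) :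
    ∃ E : Finset G, (E : Set G) ⊆ S ∧
      (∀ z : E → ℤ, ∑ x, z x • (c • (x : G)) = 0 → ∀ x, (q : ℤ) ∣ z x) ∧
      ∀ g ∈ S, ∃ Y, Over (E : Set G) Y ∧ c • (g + Y.sum) = 0 := by
  have : Fintype G := Fintype.ofFinite G
  let K : Set G → AddSubgroup G := fun E => AddSubgroup.closure ((fun g => c • g) '' E)
  have hex : ∃ m, ∃ E : Finset G, (E : Set G) ⊆ S ∧ K E = K S ∧ E.card = m :=
    ⟨_, S.toFinset, by simp, by simp, rfl⟩
  obtain ⟨E, hES, hK, hcard⟩ := Nat.find_spec hex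
  have hmin := fun m => Nat.find_min hex (m := m)
  refine ⟨E, hES, ?_, ?_⟩
  · intro z hz x0
    by_contra hnd
    have hcop : IsCoprime (z x0) ((q : ℤ) ^ b) := by
      apply IsCoprime.pow_right
      rw [isCoprime_comm]
      exact (Nat.prime_iff_prime_int.1 hq).coprime_iff_not_dvd.2 hnd
    obtain ⟨u, w, huw⟩ := hcop
    have hmem : c • (x0 : G) ∈ K ((E.erase x0 : Finset G) : Set G) := by
      have h1 : z x0 • c • (x0 : G) ∈ K ((E.erase x0 : Finset G) : Set G) := by
        rw [← Finset.add_sum_erase _ _ (Finset.mem_univ x0)] at hz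
        rw [eq_neg_of_add_eq_zero_left hz]
        apply AddSubgroup.neg_mem
        apply AddSubgroup.sum_mem
        intro y hy
        apply AddSubgroup.zsmul_mem
        apply AddSubgroup.subset_closure
        refine ⟨y, ?_, rfl⟩
        have := Finset.ne_of_mem_erase hy
        simp only [Finset.coe_erase, Set.mem_diff, Finset.mem_coe, Finset.coe_mem, true_and, Set.mem_singleton_iff]
        intro h
        exact this (Subtype.ext h)
      have h2 : c • (x0 : G) = u • (z x0 • c • (x0 : G)) := by
        have h3 : ((q : ℤ) ^ b) • c • (x0 : G) = 0 := by
          have h4 : (q ^ b) • c • (x0 : G) = 0 := by rw [smul_smul, ← hb]; exact he.2 _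
          rw [← h4, ← natCast_zsmul (c • (x0 : G)) (q ^ b)]
          push_cast
          rfl
        calc c • (x0 : G) = (1 : ℤ) • c • (x0 : G) := by simp
          _ = (u * z x0 + w * (q : ℤ) ^ b) • c • (x0 : G) := by rw [huw]
          _ = _ := by rw [add_smul, mul_smul, mul_smul, h3, smul_zero, add_zero]
      rw [h2]
      exact AddSubgroup.zsmul_mem _ h1 _
    have hKE : K ((E.erase x0 : Finset G) : Set G) = K S := by
      rw [← hK]
      apply le_antisymm
      · apply AddSubgroup.closure_mono
        apply Set.image_mono
        simp
      · rw [AddSubgroup.closure_le]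
        rintro _ ⟨g, hg, rfl⟩
        by_cases hgx : g = x0
        · rw [hgx]; exact hmem
        · apply AddSubgroup.subset_closure
          exact ⟨g, by simp [hgx]; exact hg, rfl⟩
    refine hmin (E.erase x0).card ?_ ⟨E.erase x0, ?_, hKE, rfl⟩
    · have := Finset.card_erase_lt_of_mem x0.2
      omega
    · refine subset_trans ?_ hES
      simp
  · intro g hg
    have h1 : -(c • g) ∈ K E := by
      rw [hK]
      apply AddSubgroup.neg_mem
      exact AddSubgroup.subset_closure ⟨g, hg, rfl⟩
    obtain ⟨Y, hY, hs⟩ := closure_repr he _ _ h1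
    exact ⟨Y, hY, by rw [smul_add, hs]; simp⟩

lemma E_card_le {q c d : ℕ} (hq : q.Prime) (ht : tors G q ≤ q ^ d) {E : Finset G}
    (hE : ∀ z : E → ℤ, ∑ x, z x • (c • (x : G)) = 0 → ∀ x, (q : ℤ) ∣ z x) : E.card ≤ d := by
  have := lemma_L (fun x : E => c • (x : G)) hq.pos hE
  rw [Fintype.card_coe] at this
  exact (Nat.pow_le_pow_iff_right hq.one_lt).1 (this.trans ht)

end ZS


namespace ZS
variable {G : Type*} [AddCommGroup G] [Finite G]

lemma card_one_of (P : Multiset (Multiset G × Multiset G)) (h : ∀ p ∈ P, p.1 ≠ 0)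
    (hc : Multiset.card (P.map Prod.fst).sum ≤ Multiset.card P) :
    ∀ p ∈ P, Multiset.card p.1 = 1 := by
  intro p hp
  obtain ⟨P', rfl⟩ := Multiset.exists_cons_of_mem hp
  have h1 : 0 < Multiset.card p.1 := Multiset.card_pos.2 (h p (by simp))
  have h2 := card_le_of_ne P' (fun q hq => h q (by simp [hq]))
  simp only [Multiset.card_cons, Multiset.map_cons, Multiset.sum_cons, Multiset.card_add] at hc
  omega

lemma k_eq_card {F : Multiset (Multiset G)} (h : ∀ A ∈ F, k A = 1) : k F.sum = Multiset.card F := by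
  rw [k_sum, Multiset.map_congr rfl h]
  simp

lemma k_gt_card {F : Multiset (Multiset G)} (h : ∀ A ∈ F, 1 ≤ k A) {A : Multiset G} (hA : A ∈ F)
    (hA1 : 1 < k A) : (Multiset.card F : ℚ) < k F.sum := by
  obtain ⟨F', rfl⟩ := Multiset.exists_cons_of_mem hA
  have : (Multiset.card F' : ℚ) ≤ k F'.sum := by
    rw [k_sum]
    have := Multiset.card_nsmul_le_sum (s := F'.map k) (a := (1 : ℚ)) (by
      intro x hx
      obtain ⟨A, hA, rfl⟩ := Multiset.mem_map.1 hx
      exact h A (by simp [hA]))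
    simpa using this
  simp only [Multiset.card_cons, Multiset.sum_cons, k_add]
  push_cast
  linarith

/-- the exchange step of T1 -/
lemma T1_exchange {d e : ℕ} {S : Set G} (hd : 1 ≤ d) (hS : DSet d S) (hL : LCN S) (he : Expo G e) (hed : e ≤ d + 2)
    (hfull : ∀ U, Atom U → Over S U → 1 < k U → ∀ g ∈ S, g ∈ U)
    (j : ℕ) : ∀ (U : Multiset G) (F1 F2 : Multiset (Multiset G)), Atom U → Over S U → 1 < k U → (∀ A ∈ F1, Atom A ∧ Over S A ∧ k A = 1) →
      (∀ A ∈ F2, Atom A ∧ Over S A ∧ k A = 1) → Multiset.card F1 = j → U + F1.sum = F2.sum → False := by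
  induction j with
  | zero =>
    intro U F1 F2 hU hUo hk hF1 hF2 hc heq
    have : F1 = 0 := Multiset.card_eq_zero.1 hc
    subst this
    simp at heq
    obtain ⟨g, hg⟩ := Multiset.exists_mem_of_ne_zero hU.1
    rw [heq] at hg
    obtain ⟨V, hV, _⟩ := mem_sum.1 hg
    have := (hF2 V hV).1.eq_of_le hU (heq ▸ le_sum hV)
    rw [← this, (hF2 V hV).2.2] at hk
    exact lt_irrefl _ hk
  | succ j ih =>
    intro U F1 F2 hU hUo hk hF1 hF2 hc heq
    obtain ⟨A, hA⟩ := Multiset.exists_mem_of_ne_zero (s := F1) (by rintro rfl; simp at hc)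
    obtain ⟨F1', rfl⟩ := Multiset.exists_cons_of_mem hA
    have hAs := hF1 A hA
    simp at hc
    have hle : A ≤ F2.sum := by
      rw [← heq, Multiset.sum_cons, ← add_assoc, add_comm U A, add_assoc]; simp
    obtain ⟨P, hP1, hP2, hP3⟩ := cover_pairs' F2 A hle
    set I := P.map (fun p => p.1 + p.2) with hI
    set R := (P.map Prod.snd).sum with hR
    obtain ⟨F2', rfl⟩ := Multiset.le_iff_exists_add.1 hP1
    have hIsum : I.sum = A + R := by rw [hI, Multiset.sum_map_add, hP2]
    have hIat : ∀ V ∈ I, Atom V ∧ Over S V ∧ k V = 1 := fun V hV => hF2 V (Multiset.mem_add.2 (Or.inl hV))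
    have hRs : R.sum = 0 := by
      have := Atom.sum_fac (fun V hV => (hIat V hV).1)
      rwa [hIsum, Multiset.sum_add, hAs.1.2.1, zero_add] at this
    have hIo : Over S I.sum := Over.sum fun V hV => (hIat V hV).2.1
    have hRo : Over S R := hIo.mono (by rw [hIsum]; simp)
    obtain ⟨F, hF, hFs⟩ := exists_fac R hRs
    have hFo : ∀ V ∈ F, Over S V := fun V hV => Over.of_sum (hFs ▸ hRo) hV
    have heq2 : U + F1'.sum = R + F2'.sum := by
      rw [Multiset.sum_cons, Multiset.sum_add, hIsum] at heq
      have : A + (U + F1'.sum) = A + (R + F2'.sum) := by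
        rw [← add_assoc, add_comm A U, add_assoc, heq, add_assoc]
      exact add_left_cancel this
    by_cases hsmall : ∀ V ∈ F, k V = 1
    · apply ih U F1' (F + F2') hU hUo hk (fun V hV => hF1 V (by simp [hV])) _ hc (by
        rw [heq2, Multiset.sum_add, hFs])
      intro V hV
      rcases Multiset.mem_add.1 hV with h | h
      · exact ⟨hF V h, hFo V h, hsmall V h⟩
      · exact hF2 V (Multiset.mem_add.2 (Or.inr h))
    · push Not at hsmall
      obtain ⟨V, hV, hVk⟩ := hsmall
      have hV1 : 1 < k V := lt_of_le_of_ne (hL V (hF V hV) (hFo V hV)) (Ne.symm hVk)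
      have hkF := k_gt_card (fun V hV => hL V (hF V hV) (hFo V hV)) hV hV1
      rw [hFs] at hkF
      have hkI := k_eq_card (fun V hV => (hIat V hV).2.2)
      rw [hIsum, k_add, hAs.2.2] at hkI
      have hlt : 1 + Multiset.card F < Multiset.card I := by
        have : (1 + Multiset.card F : ℚ) < Multiset.card I := by linarith
        exact_mod_cast this
      have hl1 : HasLen (A + R) (Multiset.card I) := hIsum ▸ hasLen_fac (fun V hV => (hIat V hV).1)
      have hl2 : HasLen (A + R) (1 + Multiset.card F) := hAs.1.hasLen.add ⟨F, hF, hFs, rfl⟩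
      have hdv := Int.le_of_dvd (by push_cast; omega) (hS _ (hIsum ▸ hIo) _ _ hl1 hl2)
      push_cast at hdv
      have hFpos : 0 < Multiset.card F := Multiset.card_pos.2 (by rintro rfl; simp at hV)
      have hcA : Multiset.card A ≤ d + 2 := by
        have h1 := card_le_expo_mul_k he A
        rw [hAs.2.2, mul_one] at h1
        have : Multiset.card A ≤ e := by exact_mod_cast h1
        omega
      have hIP : Multiset.card I = Multiset.card P := by rw [hI, Multiset.card_map]
      have hPA := card_le_of_ne P hP3
      rw [hP2] at hPA
      have hone := card_one_of P hP3 (by rw [hP2]; omega)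
      -- F is the singleton V, R = V
      have hRV : R = V := by
        obtain ⟨V', hV'⟩ := Multiset.card_eq_one.1 (show Multiset.card F = 1 by omega)
        rw [hV'] at hV hFs
        simp at hV hFs
        rw [← hFs, hV]
      have hRat : Atom R := hRV ▸ hF V hV
      have hRk : 1 < k R := hRV ▸ hV1
      have hRfull := hfull R hRat hRo hRk
      have hAR : A ≤ R := by
        rw [← hP2, hR]
        refine Multiset.sum_map_le_sum_map _ _ ?_
        intro p hp
        obtain ⟨a, ha⟩ := Multiset.card_eq_one.1 (hone p hp)
        have haS : a ∈ S := by
          apply hAs.2.1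
          rw [← hP2]
          exact mem_sum.2 ⟨p.1, Multiset.mem_map_of_mem _ hp, by simp [ha]⟩
        have haR := hRfull a haS
        obtain ⟨P', rfl⟩ := Multiset.exists_cons_of_mem hp
        rw [hR, Multiset.map_cons, Multiset.sum_cons] at haR
        rw [ha, Multiset.singleton_le]
        rcases Multiset.mem_add.1 haR with h | h
        · exact h
        · exfalso
          have hle : p.1 + p.2 ≤ R := by
            rw [hR, Multiset.map_cons, Multiset.sum_cons, add_comm p.1 p.2, ha]
            exact add_le_add_right (Multiset.singleton_le.2 h) _
          have hpI := hIat (p.1 + p.2) (by rw [hI]; exact Multiset.mem_map_of_mem _ hp)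
          have := hpI.1.eq_of_le hRat hle
          rw [← this, hpI.2.2] at hRk
          exact lt_irrefl _ hRk
      have := hAs.1.eq_of_le hRat hAR
      rw [← this, hAs.2.2] at hRk
      exact lt_irrefl _ hRk

lemma fac_small {S : Set G} (hHF : HF S) {B : Multiset G} (hB : Over S B) (hs : B.sum = 0) :
    ∃ F : Multiset (Multiset G), (∀ A ∈ F, Atom A ∧ Over S A ∧ k A = 1) ∧ F.sum = B := by
  obtain ⟨F, hF, rfl⟩ := exists_fac B hs
  exact ⟨F, fun A hA => ⟨hF A hA, hB.of_sum hA, hHF A (hF A hA) (hB.of_sum hA)⟩, rfl⟩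

theorem T1 {d e : ℕ} (hd : 1 ≤ d) (he : Expo G e) (hed : e ≤ d + 2)
    (ht : ∀ q : ℕ, q.Prime → tors G q ≤ q ^ d) {S : Set G} (hS : DSet d S) (hL : LCN S) : HF S := by
  induction hm : S.ncard using Nat.strong_induction_on generalizing S with
  | _ m ih =>
    subst hm
    intro U hU hUo
    apply le_antisymm _ (hL U hU hUo)
    by_contra hk
    push Not at hk
    have hproper : ∀ g ∈ S, HF (S \ {g}) := fun g hg =>
      ih _ (Set.ncard_diff_singleton_lt_of_mem hg) (hS.mono Set.diff_subset)
        (hL.mono Set.diff_subset) rfl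
    have hfull : ∀ U, Atom U → Over S U → 1 < k U → ∀ g ∈ S, g ∈ U := by
      intro U hU hUo hk g hg
      by_contra hgU
      have := hproper g hg U hU (fun x hx => ⟨hUo x hx, fun h => hgU (by simp at h; rwa [← h])⟩)
      rw [this] at hk
      exact lt_irrefl _ hk
    obtain ⟨g, hgU⟩ := Multiset.exists_mem_of_ne_zero hU.1
    have hg := hUo g hgU
    set v := U.count g with hv
    let SM : Multiset G → Prop := fun B => ∃ F : Multiset (Multiset G), 
      (∀ A ∈ F, Atom A ∧ Over S A ∧ k A = 1) ∧ F.sum = B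
    have hSMadd : ∀ B C, SM B → SM C → SM (B + C) := by
      rintro B C ⟨F, h1, h2⟩ ⟨F', h1', h2'⟩
      refine ⟨F + F', ?_, by simp [h2, h2']⟩
      intro A hA
      rcases Multiset.mem_add.1 hA with h | h
      exacts [h1 A h, h1' A h]
    have hSMns : ∀ (m : ℕ) B, SM B → SM (m • B) := by
      intro m B hB
      induction m with
      | zero => exact ⟨0, by simp, by simp⟩
      | succ m ihm => rw [succ_nsmul]; exact hSMadd _ _ ihm hB
    have hSMmono : ∀ T : Set G, T ⊆ S → HF T → ∀ B, Over T B → B.sum = 0 → SM B := by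
      intro T hT hHF B hB hs
      obtain ⟨F, h1, h2⟩ := fac_small hHF hB hs
      exact ⟨F, fun A hA => ⟨(h1 A hA).1, (h1 A hA).2.1.mono_set hT, (h1 A hA).2.2⟩, h2⟩
    let I : AddSubgroup ℤ :=
      { carrier := {j | ∃ B, SM B ∧ (e : ℤ) ∣ (B.count g : ℤ) - j * v}
        zero_mem' := ⟨0, ⟨0, by simp, by simp⟩, by simp⟩
        add_mem' := by
          rintro a b ⟨B, h1, h2⟩ ⟨C, h1', h2'⟩
          refine ⟨B + C, hSMadd _ _ h1 h1', ?_⟩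
          rw [Multiset.count_add]
          push_cast
          obtain ⟨w, hw⟩ := h2
          obtain ⟨w', hw'⟩ := h2'
          exact ⟨w + w', by linear_combination hw + hw'⟩
        neg_mem' := by
          rintro a ⟨B, h1, h2⟩
          refine ⟨(e - 1) • B, hSMns _ _ h1, ?_⟩
          rw [Multiset.count_nsmul]
          push_cast
          rw [Nat.cast_sub he.1]
          obtain ⟨w, hw⟩ := h2
          refine ⟨B.count g - w, ?_⟩
          push_cast
          linear_combination -hw }
    have hI : ∀ q : ℕ, q.Prime → ((e / q ^ e.factorization q : ℕ) : ℤ) ∈ I := by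
      intro q hq
      set c := e / q ^ e.factorization q with hc
      have hec : e = q ^ e.factorization q * c := (Nat.ordProj_mul_ordCompl_eq_self e q).symm
      obtain ⟨E, hES, hrel, hgen⟩ := exists_E (G := G) hq he hec (S \ {g})
      have hEc := E_card_le hq (ht q hq) hrel
      choose! Y hYo hYs using hgen
      -- U without g
      set U' := U.filter (fun x => x ≠ g) with hU'
      have hUdec : U = Multiset.replicate v g + U' := by
        rw [hU', hv, ← Multiset.filter_eq']
        exact (Multiset.filter_add_not (fun x => x = g) U).symm
      have hU'o : ∀ x ∈ U', x ∈ S \ {g} := fun x hx => by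
        have := Multiset.mem_filter.1 hx
        exact ⟨hUo x this.1, this.2⟩
      set Z := (U'.map Y).sum with hZ
      have hZo : Over (E : Set G) Z := Over.sum fun A hA => by
        obtain ⟨x, hx, rfl⟩ := Multiset.mem_map.1 hA
        exact hYo x (hU'o x hx)
      have hZs : c • (U'.sum + Z.sum) = 0 := by
        rw [hZ]
        have : ∀ U'' : Multiset G, (∀ x ∈ U'', x ∈ S \ {g}) → c • (U''.sum + (U''.map Y).sum.sum) = 0 := by
          intro U''
          induction U'' using Multiset.induction_on with
          | empty => simp
          | cons a U'' ih2 =>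
            intro h
            have h1 := ih2 (fun x hx => h x (by simp [hx]))
            have h2 := hYs a (h a (by simp))
            simp only [Multiset.sum_cons, Multiset.map_cons, Multiset.sum_add]
            rw [add_add_add_comm, smul_add, h1, h2, add_zero]
        exact this U' hU'o
      set B := c • (Multiset.replicate v g + (e - 1) • Z) with hB
      have hgE : g ∉ Z := fun h => (hES (hZo g h)).2 rfl
      refine ⟨B, ?_, ?_⟩
      · apply hSMmono (insert g (E : Set G))
        · intro x hx
          rcases hx with rfl | hx
          · exact hg
          · exact (hES hx).1
        · have hsub : insert g (E : Set G) ⊆ S := by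
            intro x hx
            rcases hx with rfl | hx
            · exact hg
            · exact (hES hx).1
          apply HF_small (hS.mono hsub) (hL.mono hsub)
          refine (Set.ncard_insert_le _ _).trans ?_
          rw [Set.ncard_coe_finset]; omega
        · apply Over.nsmul
          apply Over.add
          · apply Over.replicate; simp
          · exact (hZo.mono_set (by simp)).nsmul _
        · have h0 := hU.2.1
          rw [hUdec, Multiset.sum_add, Multiset.sum_replicate] at h0
          rw [hB, Multiset.sum_nsmul, Multiset.sum_add, Multiset.sum_replicate, Multiset.sum_nsmul]
          have h1 : v • g = - U'.sum := eq_neg_of_add_eq_zero_left h0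
          have h2 : (e - 1) • Z.sum = - Z.sum := by
            have : (e - 1 + 1) • Z.sum = 0 := by rw [Nat.sub_add_cancel he.1]; exact he.2 _
            rw [succ_nsmul] at this
            exact eq_neg_of_add_eq_zero_left this
          rw [h1, h2, ← neg_add, smul_neg, hZs, neg_zero]
      · rw [hB, Multiset.count_nsmul, Multiset.count_add, Multiset.count_replicate_self,
          Multiset.count_nsmul, Multiset.count_eq_zero_of_notMem hgE]
        simp
    have hItop : (-1 : ℤ) ∈ I := by
      obtain ⟨a, ha⟩ := Int.subgroup_cyclic I
      rw [← AddSubgroup.zmultiples_eq_closure] at ha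
      have hunit : a.natAbs = 1 := by
        by_contra hne
        have hq := Nat.minFac_prime hne
        have h1 := hI _ hq
        rw [ha, Int.mem_zmultiples_iff] at h1
        have h2 : a.natAbs ∣ e / a.natAbs.minFac ^ e.factorization a.natAbs.minFac :=
          Int.natAbs_dvd_natAbs.2 h1
        exact Nat.not_dvd_ordCompl hq he.1.ne' ((Nat.minFac_dvd _).trans h2)
      rw [ha, Int.mem_zmultiples_iff]
      rw [← Int.natAbs_dvd, hunit]
      simp
    obtain ⟨B, ⟨F1, hF1, hF1s⟩, hBc⟩ := hItop
    have hBo : Over S B := hF1s ▸ Over.sum fun A hA => (hF1 A hA).2.1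
    have hcount : addOrderOf g ∣ (U + B).count g := by
      have h1 : e ∣ (U + B).count g := by
        rw [← Int.natCast_dvd_natCast, Multiset.count_add]
        push_cast
        convert hBc using 1
        rw [hv]
        ring
      exact (he.ord_dvd g).trans h1
    obtain ⟨t, htc⟩ := hcount
    set S' := (U + B).filter (fun x => x ≠ g) with hS'
    have hdec : U + B = Multiset.replicate (t * addOrderOf g) g + S' := by
      rw [mul_comm, ← htc, hS', ← Multiset.filter_eq']
      exact (Multiset.filter_add_not (fun x => x = g) (U + B)).symm
    have hS'o : Over (S \ {g}) S' := fun x hx => by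
      have := Multiset.mem_filter.1 hx
      exact ⟨(hUo.add hBo) x this.1, this.2⟩
    have hBs : B.sum = 0 := hF1s ▸ Atom.sum_fac fun A hA => (hF1 A hA).1
    have hS's : S'.sum = 0 := by
      have h0 : (U + B).sum = 0 := by rw [Multiset.sum_add, hU.2.1, hBs, add_zero]
      rwa [hdec, Multiset.sum_add, (hasLen_mul_ord g t).sum_eq, zero_add] at h0
    obtain ⟨F2, hF2, hF2s⟩ := hSMadd _ _ (hSMns t (Multiset.replicate (addOrderOf g) g)
      ⟨{Multiset.replicate (addOrderOf g) g}, by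
        intro A hA
        simp only [Multiset.mem_singleton] at hA
        rw [hA]
        exact ⟨atom_ord g, Over.replicate hg _, k_ord g⟩, by simp⟩)
      (hSMmono _ Set.diff_subset (hproper g hg) S' hS'o hS's)
    rw [Multiset.nsmul_replicate, ← hdec, ← hF1s] at hF2s
    exact T1_exchange hd hS hL he hed hfull _ U F1 F2 hU hUo hk hF1 hF2 rfl hF2s.symm

end ZS


namespace ZS
variable {G : Type*} [AddCommGroup G] [Finite G]

theorem P0 {d e : ℕ} (hd : 1 ≤ d) (he : Expo G e) (hed : e ≤ d + 1)
    (ht : ∀ q : ℕ, q.Prime → tors G q ≤ q ^ d) : Elast G d 1 := by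
  apply elast_of_wt
  intro S hS
  refine ⟨kk, fun A hA hAo => ?_⟩
  have := T1 hd he (by omega) ht hS (LCN_of_expo hS he hed) A hA hAo
  have h : wt kk A = 1 := this
  rw [h]; norm_num

/-- half weights -/
noncomputable def hw (P : Set G) (g : G) : ℚ := if g ∈ P then 1 / 2 else kk g

lemma kk_le_half {g : G} (h : g ≠ 0) : kk g ≤ 1 / 2 := by
  have : 2 ≤ addOrderOf g := by
    have : addOrderOf g ≠ 1 := by simpa using h
    have := ord_pos g
    omega
  unfold kk
  apply one_div_le_one_div_of_le (by norm_num)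
  exact_mod_cast this

/-- general upper bound, used for all sets: if `A` has k(A)=1 and ... -/
lemma P1 {d e : ℕ} (hd : 1 ≤ d) (he : Expo G e) (hed : e ≤ d + 2)
    (ht : ∀ q : ℕ, q.Prime → tors G q ≤ q ^ d) : Elast G d (1 + d / 2) := by
  apply elast_of_wt
  intro S hS
  refine ⟨hw {g | addOrderOf g = d + 2}, fun A hA hAo => ?_⟩
  have hd0 : (0 : ℚ) ≤ d := by positivity
  by_cases hp : ∃ g, A = {g, -g} ∧ addOrderOf g = d + 2
  · obtain ⟨g, rfl, hg⟩ := hp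
    have : wt (hw {g | addOrderOf g = d + 2}) ({g, -g} : Multiset G) = 1 := by
      have : ({g, -g} : Multiset G) = g ::ₘ {-g} := rfl
      rw [this, wt_cons, wt_singleton]
      simp [hw, hg]
      norm_num
    rw [this]
    constructor
    · exact le_refl _
    · linarith
  · push Not at hp
    have hL := nonpair_LCN hd hS he hed hA hAo hp
    have hsub : supp A ⊆ S := fun x hx => hAo x hx
    have hk : wt kk A = 1 := T1 hd he hed ht (hS.mono hsub) hL A hA (over_supp A)
    have hge : ∀ g ∈ A, kk g ≤ hw {g | addOrderOf g = d + 2} g := by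
      intro g hg
      unfold hw
      split_ifs with h
      · apply kk_le_half
        rintro rfl
        simp at h
      · exact le_refl _
    constructor
    · rw [← hk]; exact wt_mono hge
    · have : wt (hw {g | addOrderOf g = d + 2}) A ≤ wt (fun g => (1 + d / 2) * kk g) A := by
        apply wt_mono
        intro g hg
        unfold hw
        split_ifs with h
        · have h' : addOrderOf g = d + 2 := h
          have h1 := ord_mul_kk g
          rw [h'] at h1
          push_cast at h1
          linarith
        · have := kk_nonneg g
          nlinarith
      refine this.trans ?_
      have h2 : wt (fun g => (1 + d / 2) * kk g) A = (1 + d / 2) * wt kk A := by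
        unfold wt
        rw [Multiset.sum_map_mul_left]
      rw [h2, hk, mul_one]

/-! chi -/
noncomputable def chi (d : ℕ) (B : Multiset G) : AddCircle (d : ℚ) :=
  if h : ∃ l, HasLen B l then ((k B - (h.choose : ℚ) : ℚ) : AddCircle (d : ℚ)) else 0

lemma circ_zero {d : ℕ} {x : ℚ} : (x : AddCircle (d : ℚ)) = 0 ↔ ∃ z : ℤ, x = d * z := by
  rw [AddCircle.coe_eq_zero_iff]
  constructor
  · rintro ⟨z, h⟩; exact ⟨z, by rw [← h]; simp [mul_comm]⟩
  · rintro ⟨z, h⟩; exact ⟨z, by rw [h]; simp [mul_comm]⟩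

lemma chi_eq {d : ℕ} {S : Set G} (hS : DSet d S) {B : Multiset G} (hB : Over S B) {l : ℕ}
    (hl : HasLen B l) : chi d B = ((k B - l : ℚ) : AddCircle (d : ℚ)) := by
  have h : ∃ l, HasLen B l := ⟨l, hl⟩
  unfold chi
  rw [dif_pos h]
  rw [← sub_eq_zero, ← AddCircle.coe_sub, circ_zero]
  obtain ⟨z, hz⟩ := hS B hB _ _ hl h.choose_spec
  refine ⟨z, ?_⟩
  have : ((l : ℤ) : ℚ) - ((h.choose : ℤ) : ℚ) = ((d : ℤ) : ℚ) * z := by exact_mod_cast hz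
  push_cast at this
  linarith

lemma chi_add {d : ℕ} {S : Set G} (hS : DSet d S) {A B : Multiset G} (hA : Over S A) (hB : Over S B)
    (hAs : A.sum = 0) (hBs : B.sum = 0) : chi d (A + B) = chi d A + chi d B := by
  obtain ⟨l, hl⟩ := exists_len A hAs
  obtain ⟨m, hm⟩ := exists_len B hBs
  rw [chi_eq hS hA hl, chi_eq hS hB hm, chi_eq hS (hA.add hB) (hl.add hm), ← AddCircle.coe_add]
  congr 1
  rw [k_add]; push_cast; ring

lemma chi_zero {d : ℕ} {S : Set G} (hS : DSet d S) : chi d (0 : Multiset G) = 0 := by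
  rw [chi_eq hS (fun g hg => by simp at hg) HasLen.zero]; simp

lemma chi_nsmul {d : ℕ} {S : Set G} (hS : DSet d S) {A : Multiset G} (hA : Over S A)
    (hAs : A.sum = 0) (m : ℕ) : chi d (m • A) = m • chi d A := by
  induction m with
  | zero => simp [chi_zero hS]
  | succ m ih =>
    rw [succ_nsmul, chi_add hS (hA.nsmul m) hA (by rw [Multiset.sum_nsmul, hAs, smul_zero]) hAs, ih,
      succ_nsmul]

lemma chi_msum {d : ℕ} {S : Set G} (hS : DSet d S) {ι : Type*} (F : Multiset ι) (f : ι → Multiset G)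
    (h : ∀ i ∈ F, Over S (f i) ∧ (f i).sum = 0) :
    chi d (F.map f).sum = (F.map fun i => chi d (f i)).sum ∧ Over S (F.map f).sum ∧
      (F.map f).sum.sum = 0 := by
  induction F using Multiset.induction_on with
  | empty =>
    refine ⟨by simp [chi_zero hS], ?_, by simp⟩
    intro g hg
    simp at hg
  | cons a F ih =>
    obtain ⟨h1, h2, h3⟩ := ih (fun i hi => h i (by simp [hi]))
    obtain ⟨h4, h5⟩ := h a (by simp)
    refine ⟨?_, ?_, ?_⟩
    · simp only [Multiset.map_cons, Multiset.sum_cons]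
      rw [chi_add hS h4 h2 h5 h3, h1]
    · simp only [Multiset.map_cons, Multiset.sum_cons]
      exact h4.add h2
    · simp only [Multiset.map_cons, Multiset.sum_cons, Multiset.sum_add, h5, h3, add_zero]

lemma chi_HF {d : ℕ} {S : Set G} (hS : DSet d S) (hH : HF S) {B : Multiset G} (hB : Over S B)
    (hs : B.sum = 0) : chi d B = 0 := by
  obtain ⟨l, hl⟩ := exists_len B hs
  rw [chi_eq hS hB hl, hH.len hB hl]; simp

lemma chi_expo {d e : ℕ} (he : Expo G e) {S : Set G} (hS : DSet d S) {B : Multiset G} (hB : Over S B) :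
    chi d (e • B) = 0 := by
  obtain ⟨l, hl, hk, _⟩ := nsmul_len he B
  rw [chi_eq hS (hB.nsmul e) hl, k_nsmul, ← hk]; simp

lemma chi_atom {d : ℕ} {S : Set G} (hS : DSet d S) {A : Multiset G} (hA : Atom A) (hAo : Over S A) :
    chi d A = ((k A - 1 : ℚ) : AddCircle (d : ℚ)) := by
  rw [chi_eq hS hAo hA.hasLen]; simp

/-- Core lemma -/
lemma core {d e q b c a : ℕ} (hq : q.Prime) (he : Expo G e) (hec : e = q ^ b * c) {S : Set G}
    (hS : DSet d S) (hL : LCN S) {E : Finset G} (hES : (E : Set G) ⊆ S) (hEc : E.card ≤ d + 1)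
    {g : G} (hg : g ∈ S) {Y : Multiset G} (hY : Over (E : Set G) Y) (hYs : c • (g + Y.sum) = 0)
    (hne : q ^ a • chi d (c • (g ::ₘ Y)) ≠ 0) :
    (∀ z : E → ℤ, ∑ x, z x • (c • (x : G)) = 0 → ∀ x, ((q ^ (a + 1) : ℕ) : ℤ) ∣ z x) ∧ E.card = d + 1 := by
  have hsub : insert g (E : Set G) ⊆ S := by
    intro x hx
    rcases hx with rfl | hx
    exacts [hg, hES hx]
  set μ := g ::ₘ Y with hμ
  have hμo : Over (insert g (E : Set G)) μ := by
    intro x hx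
    rcases Multiset.mem_cons.1 hx with rfl | hx
    · simp
    · exact Or.inr (hY x hx)
  have hμS := hμo.mono_set hsub
  have hμs : (c • μ).sum = 0 := by rw [Multiset.sum_nsmul, hμ, Multiset.sum_cons, hYs]
  have hsmall : ∀ T : Set G, T ⊆ S → T.ncard ≤ d + 1 → ∀ B, Over T B → B.sum = 0 → chi d B = 0 :=
    fun T hT hc B hB hs => chi_HF (hS.mono hT) (HF_small (hS.mono hT) (hL.mono hT) hc) hB hs
  have hnz : chi d (c • μ) ≠ 0 := fun h => hne (by rw [h, smul_zero])
  have hbig : d + 1 < (insert g (E : Set G)).ncard := by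
    by_contra hc
    push Not at hc
    exact hnz (hsmall _ hsub hc _ (hμo.nsmul c) hμs)
  have hgE : g ∉ E := by
    intro h
    rw [Set.insert_eq_of_mem (by exact_mod_cast h), Set.ncard_coe_finset] at hbig
    omega
  have hcard : E.card = d + 1 := by
    rw [Set.ncard_insert_of_notMem (by exact_mod_cast hgE), Set.ncard_coe_finset] at hbig
    omega
  refine ⟨?_, hcard⟩
  -- order of chi
  have hord : addOrderOf (chi d (c • μ)) ∣ q ^ b := by
    apply addOrderOf_dvd_of_nsmul_eq_zero
    rw [← chi_nsmul hS (hμS.nsmul c) hμs, ← mul_smul, ← hec]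
    exact chi_expo he hS hμS
  obtain ⟨s, hsb, hs⟩ := (Nat.dvd_prime_pow hq).1 hord
  have has : a + 1 ≤ s := by
    by_contra hlt
    apply hne
    apply addOrderOf_dvd_iff_nsmul_eq_zero.1
    rw [hs]
    exact pow_dvd_pow _ (by omega)
  intro z hz e0
  -- natural representatives
  have he0 : (e : ℤ) ≠ 0 := by exact_mod_cast he.1.ne'
  have hepos : (0 : ℤ) < e := by exact_mod_cast he.1
  let lam : E → ℕ := fun x => (z x % e).toNat
  have hlam : ∀ x, (lam x : ℤ) = z x % e := fun x => Int.toNat_of_nonneg (Int.emod_nonneg _ he0)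
  have hlam_le : ∀ x, lam x ≤ e := by
    intro x
    have := hlam x
    have h2 := Int.emod_lt_of_pos (z x) hepos
    omega
  have hlsm : ∀ (x : E) (y : G), lam x • y = z x • y := by
    intro x y
    have h1 : z x = lam x + e * (z x / e) := by rw [hlam]; exact (Int.emod_add_mul_ediv _ _).symm
    conv_rhs => rw [h1, add_smul, mul_comm, mul_smul, natCast_zsmul, natCast_zsmul, he.2 y, smul_zero, add_zero]
  set Λ : Multiset G := ∑ x : E, Multiset.replicate (lam x) (x : G) with hΛ
  have hΛo : Over (E : Set G) Λ := Over.finsum _ fun x _ => Over.replicate x.2 _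
  have hΛs : (c • Λ).sum = 0 := by
    rw [Multiset.sum_nsmul, hΛ, sum_replicate_repr, Finset.smul_sum, ← hz]
    apply Finset.sum_congr rfl
    intro x _
    rw [hlsm, smul_comm]
  have hΛc : Λ.count (e0 : G) = lam e0 := by
    rw [hΛ, Multiset.count_sum', Finset.sum_eq_single e0]
    · simp
    · intro x _ hx
      rw [Multiset.count_replicate, if_neg]
      intro h
      exact hx (Subtype.ext h)
    · simp
  set x := μ.count (e0 : G) with hx
  set M := x • Λ + (e - lam e0) • μ with hM
  have hMo : Over (insert g (E : Set G)) M :=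
    ((hΛo.mono_set (Set.subset_insert _ _)).nsmul _).add (hμo.nsmul _)
  have hMc : M.count (e0 : G) = e * x := by
    rw [hM, Multiset.count_add, Multiset.count_nsmul, Multiset.count_nsmul, hΛc, ← hx]
    have := hlam_le e0
    zify [this]
    ring
  set B' := M.filter (fun y => y ≠ (e0 : G)) with hB'
  have hdec : M = Multiset.replicate (e * x) (e0 : G) + B' := by
    rw [← hMc, hB', ← Multiset.filter_eq']
    exact (Multiset.filter_add_not (fun y => y = (e0 : G)) M).symm
  have hB'o : Over ((insert g (E : Set G)) \ {(e0 : G)}) B' := fun y hy => by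
    have := Multiset.mem_filter.1 hy
    exact ⟨hMo y this.1, this.2⟩
  have hrs : (Multiset.replicate (e * x) (e0 : G)).sum = 0 := by
    rw [Multiset.sum_replicate, mul_smul]; exact he.2 _
  have hMs : (c • M).sum = 0 := by
    rw [hM, smul_add, smul_comm c x, smul_comm c, Multiset.sum_add, Multiset.sum_nsmul, hΛs,
      Multiset.sum_nsmul, hμs]; simp
  have hB's : (c • B').sum = 0 := by
    rw [hdec, smul_add, Multiset.sum_add, Multiset.sum_nsmul, hrs, smul_zero, zero_add] at hMs
    exact hMs
  have h1 : chi d (c • B') = 0 := by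
    apply hsmall _ (Set.diff_subset.trans hsub) _ _ (hB'o.nsmul c) hB's
    have hm : (e0 : G) ∈ insert g (E : Set G) := Or.inr e0.2
    have := Set.ncard_diff_singleton_of_mem hm
    have h2 := Set.ncard_insert_le g (E : Set G)
    rw [Set.ncard_coe_finset] at h2
    omega
  have he0S : (e0 : G) ∈ S := hES e0.2
  have h2 : chi d (c • M) = 0 := by
    rw [hdec, smul_add, chi_add hS ((Over.replicate he0S _).nsmul c)
      ((hB'o.nsmul c).mono_set (Set.diff_subset.trans hsub)) (by rw [Multiset.sum_nsmul, hrs, smul_zero]) hB's, h1,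
      add_zero]
    have : c • Multiset.replicate (e * x) (e0 : G) = e • Multiset.replicate (c * x) (e0 : G) := by
      rw [Multiset.nsmul_replicate, Multiset.nsmul_replicate]; congr 1; ring
    rw [this]
    exact chi_expo he hS (Over.replicate he0S _)
  have hΛ0 : chi d (c • Λ) = 0 :=
    hsmall _ hES (by rw [Set.ncard_coe_finset]; exact hEc) _ (hΛo.nsmul c) hΛs
  have h3 : (e - lam e0) • chi d (c • μ) = 0 := by
    rw [hM, smul_add, smul_comm c x, smul_comm c, chi_add hS
      (((hΛo.mono_set hES).nsmul c).nsmul x) ((hμS.nsmul c).nsmul _)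
      (by rw [Multiset.sum_nsmul, hΛs, smul_zero]) (by rw [Multiset.sum_nsmul, hμs, smul_zero]),
      chi_nsmul hS ((hΛo.mono_set hES).nsmul c) hΛs, hΛ0, smul_zero, zero_add,
      chi_nsmul hS (hμS.nsmul c) hμs] at h2
    exact h2
  have h4 := addOrderOf_dvd_of_nsmul_eq_zero h3
  rw [hs] at h4
  have h5 : q ^ s ∣ e := hec ▸ (pow_dvd_pow q hsb).trans (dvd_mul_right _ _)
  have h6 : q ^ s ∣ lam e0 := (Nat.dvd_sub_iff_right (hlam_le e0) h5).1 h4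
  have h7 : ((q ^ s : ℕ) : ℤ) ∣ z e0 := by
    have h1 : z e0 = lam e0 + e * (z e0 / e) := by rw [hlam]; exact (Int.emod_add_mul_ediv _ _).symm
    rw [h1]
    exact dvd_add (by exact_mod_cast h6) ((by exact_mod_cast h5 : ((q ^ s : ℕ) : ℤ) ∣ e).trans (dvd_mul_right _ _))
  refine (by exact_mod_cast pow_dvd_pow q has : ((q ^ (a + 1) : ℕ) : ℤ) ∣ ((q ^ s : ℕ) : ℤ)).trans h7

theorem P3a {d e q a : ℕ} (hq : q.Prime) (he : Expo G e) (ht : tors G q ≤ q ^ (d + 1)) {S : Set G}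
    (hS : DSet d S) (hL : LCN S) {A : Multiset G} (hA : Over S A) (hAs : A.sum = 0)
    (hdv : q ^ (a + 1) ∣ addOrderOf (chi d A)) : (q ^ (a + 1)) ^ (d + 1) ≤ tors G (q ^ (a + 1)) := by
  set c := e / q ^ e.factorization q with hc
  have hec : e = q ^ e.factorization q * c := (Nat.ordProj_mul_ordCompl_eq_self e q).symm
  obtain ⟨E, hES, hrel, hgen⟩ := exists_E (G := G) hq he hec S
  have hEc := E_card_le hq ht hrel
  choose! Y hYo hYs using hgen
  have hex : ∃ g ∈ A, q ^ a • chi d (c • (g ::ₘ Y g)) ≠ 0 := by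
    by_contra hcon
    push Not at hcon
    have hYS : ∀ g ∈ S, Over S (Y g) := fun g hg => (hYo g hg).mono_set hES
    obtain ⟨h1, h2, h3⟩ := chi_msum hS A (fun g => c • (g ::ₘ Y g)) (by
      intro g hg
      refine ⟨Over.nsmul (fun x hx => ?_) c, ?_⟩
      · rcases Multiset.mem_cons.1 hx with rfl | hx
        exacts [hA _ hg, hYS g (hA g hg) x hx]
      · rw [Multiset.sum_nsmul, Multiset.sum_cons, hYs g (hA g hg)])
    set Z := (A.map Y).sum with hZ
    have hZo : Over (E : Set G) Z := Over.sum fun B hB => by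
      obtain ⟨x, hx, rfl⟩ := Multiset.mem_map.1 hB
      exact hYo x (hA x hx)
    have hsplit : (A.map (fun g => c • (g ::ₘ Y g))).sum = c • A + c • Z := by
      rw [hZ]
      clear_value c
      clear h1 h2 h3 hcon hdv hAs hA hZo hZ
      induction A using Multiset.induction_on with
      | empty => simp
      | cons a A ih =>
        simp only [Multiset.map_cons, Multiset.sum_cons, ih]
        rw [← Multiset.singleton_add, ← Multiset.singleton_add a A]
        simp only [smul_add]
        abel
    have hcA : (c • A).sum = 0 := by rw [Multiset.sum_nsmul, hAs, smul_zero]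
    have hcZ : (c • Z).sum = 0 := by
      rw [hsplit, Multiset.sum_add, hcA, zero_add] at h3
      exact h3
    have hZ0 : chi d (c • Z) = 0 :=
      chi_HF (hS.mono hES) (HF_small (hS.mono hES) (hL.mono hES) (by rw [Set.ncard_coe_finset]; exact hEc))
        (hZo.nsmul c) hcZ
    rw [hsplit, chi_add hS (hA.nsmul c) ((hZo.mono_set hES).nsmul c) hcA hcZ, hZ0, add_zero,
      chi_nsmul hS hA hAs] at h1
    have h4 : q ^ a • c • chi d A = 0 := by
      rw [h1, ← Multiset.sum_map_nsmul]
      apply Multiset.sum_eq_zero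
      intro x hx
      obtain ⟨g, hg, rfl⟩ := Multiset.mem_map.1 hx
      exact hcon g hg
    rw [← mul_smul] at h4
    have h5 := hdv.trans (addOrderOf_dvd_of_nsmul_eq_zero h4)
    rw [pow_succ] at h5
    have h6 := Nat.dvd_of_mul_dvd_mul_left (pow_pos hq.pos a) h5
    exact Nat.not_dvd_ordCompl hq he.1.ne' h6
  obtain ⟨g, hg, hne⟩ := hex
  obtain ⟨h1, h2⟩ := core hq he hec hS hL hES hEc (hA g hg) (hYo g (hA g hg)) (hYs g (hA g hg)) hne
  have := lemma_L (fun x : E => c • (x : G)) (pow_pos hq.pos (a + 1)) h1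
  rwa [Fintype.card_coe, h2] at this

/-- `m` is divisible by every prime power whose torsion has full rank `d+1` -/
def RK (G : Type*) [AddCommGroup G] (d m : ℕ) : Prop :=
  (∀ q : ℕ, q.Prime → tors G q ≤ q ^ (d + 1)) ∧
  (∀ q a : ℕ, q.Prime → (q ^ (a + 1)) ^ (d + 1) ≤ tors G (q ^ (a + 1)) → q ^ (a + 1) ∣ m)

theorem P3 {d e m : ℕ} (he : Expo G e) (hm : RK G d m) {S : Set G} (hS : DSet d S) (hL : LCN S)
    {A : Multiset G} (hA : Over S A) (hAs : A.sum = 0) : m • chi d A = 0 := by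
  apply addOrderOf_dvd_iff_nsmul_eq_zero.1
  rw [Nat.dvd_iff_prime_pow_dvd_dvd]
  intro q a hq hdv
  cases a with
  | zero => simp
  | succ a => exact hm.2 q a hq (P3a hq he (hm.1 q hq) hS hL hA hAs hdv)

theorem P3k {d e m : ℕ} (he : Expo G e) (hm : RK G d m) {S : Set G} (hS : DSet d S) (hL : LCN S)
    {A : Multiset G} (hA : Atom A) (hAo : Over S A) : ∃ z : ℤ, m * (k A - 1) = d * z := by
  have := P3 he hm hS hL hAo hA.2.1
  rw [chi_atom hS hA hAo, ← AddCircle.coe_nsmul, circ_zero] at this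
  simpa using this

lemma RK_of {r : ℕ} (n : Fin (r + 1) → ℕ) (hn : ∀ i, 1 < n i)
    (φ : G ≃+ (∀ i : Fin (r + 1), ZMod (n i))) : RK G r (n 0) := by
  constructor
  · intro q hq
    refine (tors_le n hn φ hq.pos).trans ?_
    refine (Finset.prod_le_pow_card _ _ q ?_).trans (by simp)
    intro i _
    exact Nat.gcd_le_left _ hq.pos
  · intro q a hq h
    have h1 := h.trans (tors_le n hn φ (pow_pos hq.pos _))
    by_contra hnd
    have hlt : Nat.gcd (q ^ (a + 1)) (n 0) < q ^ (a + 1) := by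
      refine lt_of_le_of_ne (Nat.gcd_le_left _ (pow_pos hq.pos _)) ?_
      intro h
      exact hnd (h ▸ Nat.gcd_dvd_right _ _)
    have h2 : ∏ i, Nat.gcd (q ^ (a + 1)) (n i) < ∏ i : Fin (r + 1), q ^ (a + 1) := by
      apply Finset.prod_lt_prod
      · intro i _; exact Nat.gcd_pos_of_pos_left _ (pow_pos hq.pos _)
      · intro i _; exact Nat.gcd_le_left _ (pow_pos hq.pos _)
      · exact ⟨0, by simp, hlt⟩
    simp at h2
    omega

end ZS


namespace ZS

section GA
variable {H : Type*} [AddCommGroup H] (p : ℕ)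

noncomputable def XX (h : H) : AddMonoidAlgebra (ZMod p) H := AddMonoidAlgebra.single h 1

lemma XX_zero : XX p (0 : H) = 1 := rfl
lemma XX_add (a b : H) : XX p (a + b) = XX p a * XX p b := by
  unfold XX; rw [AddMonoidAlgebra.single_mul_single, one_mul]
lemma XX_nsmul (m : ℕ) (a : H) : XX p (m • a) = XX p a ^ m := by
  unfold XX; rw [AddMonoidAlgebra.single_pow, one_pow]

lemma GA_ne [Fact p.Prime] {G : Type*} [AddCommGroup G] (f : G →+ H) (T : Multiset G) :
    ∀ h, ((T.map fun g => XX p (f g) - 1).prod - (-1) ^ (Multiset.card T)).coeff h ≠ 0 →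
      ∃ T' ≤ T, T' ≠ 0 ∧ f T'.sum = h := by
  induction T using Multiset.induction_on with
  | empty => intro h hh; simp at hh
  | cons a T ih =>
    intro h hh
    set Q := (T.map fun g => XX p (f g) - 1).prod with hQ
    have e1 : ((a ::ₘ T).map fun g => XX p (f g) - 1).prod - (-1) ^ (Multiset.card (a ::ₘ T)) =
      XX p (f a) * (Q - (-1) ^ Multiset.card T) - (Q - (-1) ^ Multiset.card T) +
        (-1) ^ Multiset.card T * XX p (f a) := by
      rw [Multiset.map_cons, Multiset.prod_cons, Multiset.card_cons, ← hQ]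
      ring
    rw [e1] at hh
    by_cases h1 : (Q - (-1) ^ Multiset.card T).coeff h ≠ 0
    · obtain ⟨T', h2, h3, h4⟩ := ih h h1
      exact ⟨T', h2.trans (Multiset.le_cons_self _ _), h3, h4⟩
    · push Not at h1
      by_cases h5 : (Q - (-1) ^ Multiset.card T).coeff (h - f a) ≠ 0
      · obtain ⟨T', h2, h3, h4⟩ := ih _ h5
        refine ⟨a ::ₘ T', (Multiset.cons_le_cons_iff a).2 h2, by simp, ?_⟩
        rw [Multiset.sum_cons, map_add, h4]; abel
      · push Not at h5
        have h6 : f a = h := by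
          by_contra hne
          apply hh
          rw [AddMonoidAlgebra.coeff_add, AddMonoidAlgebra.coeff_sub, Finsupp.add_apply, Finsupp.sub_apply, h1]
          rw [XX, AddMonoidAlgebra.coeff_single_mul_apply]
          have : -f a + h = h - f a := by abel
          rw [this, h5]
          rcases neg_one_pow_eq_or (AddMonoidAlgebra (ZMod p) H) (Multiset.card T) with h7 | h7
          · rw [h7]; simp [hne]
          · rw [h7]; simp [hne]
        exact ⟨{a}, by simp, by simp, by simpa using h6⟩

lemma GA_prod_ne [Fact p.Prime] {G : Type*} [AddCommGroup G] (f : G →+ H) (hf : Function.Injective f)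
    (T : Multiset G) (hT : ∀ T' ≤ T, T'.sum = 0 → T' = 0) :
    (T.map fun g => XX p (f g) - 1).prod ≠ 0 := by
  intro h0
  obtain ⟨T', h1, h2, h3⟩ := GA_ne p f T 0 (by
    rw [h0, zero_sub]
    rcases neg_one_pow_eq_or (AddMonoidAlgebra (ZMod p) H) (Multiset.card T) with h7 | h7
    · rw [h7]; simp [AddMonoidAlgebra.one_def]
    · rw [h7]; simp [AddMonoidAlgebra.one_def])
  exact h2 (hT T' h1 (hf (by rw [h3, map_zero])))

end GA

lemma ideal_pow_zero {R : Type*} [CommRing R] {ι : Type*} (s : Finset ι) (y : ι → R) {N : ℕ} (hN : 1 ≤ N)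
    (hy : ∀ i, y i ^ N = 0) : (∑ i ∈ s, Ideal.span {y i}) ^ (s.card * (N - 1) + 1) = 0 := by
  induction s using Finset.induction_on with
  | empty => simp
  | insert a s ha ih =>
    rw [Finset.sum_insert ha, Finset.card_insert_of_notMem ha, add_pow]
    apply Finset.sum_eq_zero
    intro m hm
    have hm' := Finset.mem_range.1 hm
    by_cases h : N ≤ m
    · have : Ideal.span {y a} ^ m = 0 := by
        rw [Ideal.span_singleton_pow, pow_eq_zero_of_le h (hy a)]; simp
      rw [this]; simp
    · have hs : (s.card + 1) * (N - 1) = s.card * (N - 1) + (N - 1) := by ring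
      rw [pow_eq_zero_of_le (m := s.card * (N - 1) + 1) (by omega) ih]; simp

theorem cross_bound {G : Type*} [AddCommGroup G] [Finite G] {p s r N : ℕ} [Fact p.Prime] (hN : N = p ^ s)
    (f : G →+ (Fin r → ZMod N)) (hf : Function.Injective f) (T : Multiset G)
    (hT : ∀ T' ≤ T, T'.sum = 0 → T' = 0) : (N : ℚ) * k T ≤ r * ((N : ℚ) - 1) := by
  have hp : p.Prime := Fact.out
  have hNpos : 0 < N := hN ▸ pow_pos hp.pos s
  haveI : NeZero N := ⟨hNpos.ne'⟩
  let H := Fin r → ZMod N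
  let R := AddMonoidAlgebra (ZMod p) H
  haveI : CharP R p := charP_of_injective_algebraMap (algebraMap (ZMod p) R).injective p
  let y : Fin r → R := fun i => XX p (Pi.single i 1 : H) - 1
  have hfrob : ∀ (h : H) (t : ℕ), (XX p h - 1 : R) ^ p ^ t = XX p ((p ^ t) • h) - 1 := by
    intro h t
    rw [sub_pow_char_pow, one_pow, XX_nsmul]
  have hy : ∀ i, y i ^ N = 0 := by
    intro i
    show (XX p (Pi.single i 1 : H) - 1 : R) ^ N = 0
    have hfs : (XX p (Pi.single i 1 : H) - 1 : R) ^ N = XX p (N • (Pi.single i 1 : H)) - 1 := by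
      have h := hfrob (Pi.single i 1) s
      rwa [← hN] at h
    rw [hfs]
    have : N • (Pi.single i 1 : H) = 0 := by
      funext j
      show N • (Pi.single i 1 : H) j = 0
      rw [nsmul_eq_mul, ZMod.natCast_self, zero_mul]
    rw [this, XX_zero, sub_self]
  set I : Ideal R := ∑ i, Ideal.span {y i} with hI
  have hyI : ∀ i, y i ∈ I := by
    intro i
    have : Ideal.span {y i} ≤ I := by
      rw [hI, ← Finset.add_sum_erase _ _ (Finset.mem_univ i)]
      exact le_sup_left
    exact this (Ideal.mem_span_singleton_self _)
  have hIpow : I ^ (r * (N - 1) + 1) = 0 := by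
    have := ideal_pow_zero Finset.univ y hNpos hy
    rwa [Finset.card_univ, Fintype.card_fin] at this
  have hcl : ∀ a b : H, (XX p a - 1 : R) ∈ I → (XX p b - 1 : R) ∈ I → (XX p (a + b) - 1 : R) ∈ I := by
    intro a b ha hb
    have : (XX p (a + b) - 1 : R) = XX p a * (XX p b - 1) + (XX p a - 1) := by rw [XX_add]; ring
    rw [this]
    exact I.add_mem (I.mul_mem_left _ hb) ha
  have hns : ∀ (m : ℕ) (a : H), (XX p a - 1 : R) ∈ I → (XX p (m • a) - 1 : R) ∈ I := by
    intro m a ha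
    induction m with
    | zero => simp [XX_zero]
    | succ m ih => rw [succ_nsmul]; exact hcl _ _ ih ha
  have hall : ∀ h : H, (XX p h - 1 : R) ∈ I := by
    intro h
    have hh : h = ∑ i, (h i).val • (Pi.single i 1 : H) := by
      funext j
      rw [Finset.sum_apply, Finset.sum_eq_single j]
      · simp
      · intro b _ hb
        simp [hb]
      · simp
    rw [hh]
    have : ∀ t : Finset (Fin r), (XX p (∑ i ∈ t, (h i).val • (Pi.single i 1 : H)) - 1 : R) ∈ I := by
      intro t
      induction t using Finset.induction_on with
      | empty => simp [XX_zero]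
      | insert a t ha ih =>
        rw [Finset.sum_insert ha]
        exact hcl _ _ (hns _ _ (hyI a)) ih
    exact this _
  have hord : ∀ g : G, addOrderOf g ∣ N := by
    intro g
    apply addOrderOf_dvd_of_nsmul_eq_zero
    apply hf
    rw [map_nsmul, map_zero]
    funext j
    show N • (f g) j = 0
    rw [nsmul_eq_mul, ZMod.natCast_self, zero_mul]
  have hmem : ∀ g : G, (XX p (f g) - 1 : R) ∈ I ^ (N / addOrderOf g) := by
    intro g
    obtain ⟨t, hts, ht⟩ := (Nat.dvd_prime_pow hp).1 (show addOrderOf g ∣ p ^ s from hN ▸ hord g)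
    have hdiv : N / addOrderOf g = p ^ (s - t) := by
      rw [ht, hN, Nat.pow_div hts hp.pos]
    rw [hdiv]
    have hx : ∃ h : H, f g = (p ^ (s - t)) • h := by
      have : ∀ j, ∃ v : ℕ, (f g j) = (p ^ (s - t)) • (v : ZMod N) := by
        intro j
        have h0 : (p ^ t) • f g j = 0 := by
          have : (p ^ t) • f g = 0 := by rw [← ht, ← map_nsmul, addOrderOf_nsmul_eq_zero, map_zero]
          exact congrFun this j
        have h1 : ((p ^ t * (f g j).val : ℕ) : ZMod N) = 0 := by
          push_cast
          rw [ZMod.natCast_zmod_val]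
          simpa [nsmul_eq_mul] using h0
        rw [ZMod.natCast_eq_zero_iff] at h1
        have h2 : p ^ (s - t) ∣ (f g j).val := by
          have : N = p ^ t * p ^ (s - t) := by rw [← pow_add, hN]; congr 1; omega
          exact Nat.dvd_of_mul_dvd_mul_left (pow_pos hp.pos t) (this ▸ h1)
        obtain ⟨v, hv⟩ := h2
        refine ⟨v, ?_⟩
        rw [← ZMod.natCast_zmod_val (f g j), hv]
        simp [nsmul_eq_mul]
      choose v hv using this
      exact ⟨fun j => (v j : ZMod N), funext hv⟩
    obtain ⟨h, hh⟩ := hx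
    rw [hh, ← hfrob]
    exact Ideal.pow_mem_pow (hall h) _
  have hprod : ∃ w : ℕ, (w : ℚ) = N * k T ∧ (T.map fun g => (XX p (f g) - 1 : R)).prod ∈ I ^ w := by
    clear hT
    induction T using Multiset.induction_on with
    | empty => exact ⟨0, by simp, by simp⟩
    | cons a T ih =>
      obtain ⟨w, h1, h2⟩ := ih
      refine ⟨N / addOrderOf a + w, ?_, ?_⟩
      · rw [Nat.cast_add, h1, k_cons, Nat.cast_div (hord a) (by exact_mod_cast (ord_pos a).ne'), kk]
        ring
      · rw [Multiset.map_cons, Multiset.prod_cons, pow_add]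
        exact Ideal.mul_mem_mul (hmem a) h2
  obtain ⟨w, h1, h2⟩ := hprod
  have hle : w ≤ r * (N - 1) := by
    by_contra hlt
    push Not at hlt
    have : I ^ w = 0 := pow_eq_zero_of_le (by omega) hIpow
    rw [this] at h2
    exact GA_prod_ne p f hf T hT h2
  rw [← h1]
  have : (w : ℚ) ≤ ((r * (N - 1) : ℕ) : ℚ) := by exact_mod_cast hle
  rw [Nat.cast_mul, Nat.cast_sub hNpos] at this
  simpa using this

theorem P4 {G : Type*} [AddCommGroup G] [Finite G] {p s r N : ℕ} [Fact p.Prime] (hN : N = p ^ s)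
    (f : G →+ (Fin r → ZMod N)) (hf : Function.Injective f) (hr : 2 ≤ r) (hpr : N ≤ r + 1)
    {U : Multiset G} (hU : Atom U) : k U < r := by
  by_cases h0 : (0 : G) ∈ U
  · have : ({0} : Multiset G) = U :=
      Atom.eq_of_le' (by simp) (by simp) hU (by simpa using h0)
    rw [← this]
    have : (2 : ℚ) ≤ r := by exact_mod_cast hr
    simp [kk]
    linarith
  · obtain ⟨g, hg⟩ := Multiset.exists_mem_of_ne_zero hU.1
    obtain ⟨T, rfl⟩ := Multiset.exists_cons_of_mem hg
    have hb := cross_bound hN f hf T (by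
      intro T' hT' hs
      rcases hU.2.2 T' (hT'.trans (Multiset.le_cons_self _ _)) hs with h | h
      · exact h
      · have := Multiset.card_le_card hT'
        rw [h] at this
        simp at this)
    have hg0 : g ≠ 0 := by rintro rfl; exact h0 hg
    have hk := kk_le_half hg0
    have hp : p.Prime := Fact.out
    have hN0 : (0 : ℚ) < N := by rw [hN]; exact_mod_cast pow_pos hp.pos s
    have h2 : (N : ℚ) ≤ r + 1 := by exact_mod_cast hpr
    have h3 : (2 : ℚ) ≤ r := by exact_mod_cast hr
    rw [k_cons]
    have h4 : (N : ℚ) * kk g ≤ (N : ℚ) * (1 / 2) := by gcongr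
    have : (N : ℚ) * (kk g + k T) < (N : ℚ) * r := by
      rw [mul_add]
      linarith
    exact lt_of_mul_lt_mul_left this hN0.le

lemma embed {G : Type*} [AddCommGroup G] {r N : ℕ} (hN : 0 < N) (n : Fin r → ℕ) (hdv : ∀ i, n i ∣ N)
    (φ : G ≃+ (∀ i : Fin r, ZMod (n i))) : ∃ f : G →+ (Fin r → ZMod N), Function.Injective f := by
  have hex : ∀ i, ∃ f : ZMod (n i) →+ ZMod N, Function.Injective f := by
    intro i
    obtain ⟨m, hm⟩ := hdv i
    have hm0 : 0 < m := Nat.pos_of_ne_zero (by rintro rfl; simp at hm; omega)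
    let f0 : ℤ →+ ZMod N := zmultiplesHom (ZMod N) (m : ZMod N)
    have hf0 : ∀ z : ℤ, f0 z = ((z * m : ℤ) : ZMod N) := by
      intro z; simp [f0]
    refine ⟨ZMod.lift (n i) ⟨f0, ?_⟩, ?_⟩
    · rw [hf0, ZMod.intCast_zmod_eq_zero_iff_dvd, hm]
      push_cast; exact dvd_refl _
    · rw [ZMod.lift_injective]
      intro z hz
      have hz' : f0 z = 0 := hz
      rw [hf0, ZMod.intCast_zmod_eq_zero_iff_dvd, hm] at hz'
      push_cast at hz'
      rw [ZMod.intCast_zmod_eq_zero_iff_dvd]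
      exact Int.dvd_of_mul_dvd_mul_right (by exact_mod_cast hm0.ne') hz'
  choose f hf using hex
  refine ⟨(Pi.addMonoidHom fun i => (f i).comp (Pi.evalAddMonoidHom _ i)).comp φ.toAddMonoidHom, ?_⟩
  intro a b hab
  apply φ.injective
  funext i
  apply hf i
  exact congrFun hab i

end ZS


namespace ZS
variable {G : Type*} [AddCommGroup G] [Finite G]

/-- not a pair of full order -/
def NP (d : ℕ) (A : Multiset G) : Prop := ∀ g, A = {g, -g} → addOrderOf g ≠ d + 2

lemma NP.chi {d e m : ℕ} (hd : 1 ≤ d) (he : Expo G e) (hed : e ≤ d + 2) (hm : RK G d m) {S : Set G}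
    (hS : DSet d S) {A : Multiset G} (hA : Atom A) (hAo : Over S A) (hnp : NP d A) :
    m • chi d A = 0 :=
  P3 he hm (hS.mono (fun x hx => hAo x hx)) (nonpair_LCN hd hS he hed hA hAo hnp) (over_supp A) hA.2.1

lemma NP.notMem {d : ℕ} (hd : 1 ≤ d) {A : Multiset G} (hA : Atom A) (hnp : NP d A) {g : G} (hg : g ∈ A)
    (ho : addOrderOf g = d + 2) : -g ∉ A := by
  intro h
  have hle := pair_le hg h (ord_gt_two_ne_neg (by omega))
  have hg0 : g ≠ 0 := by rintro rfl; simp at ho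
  exact hnp g ((atom_pair hg0).eq_of_le hA hle).symm ho

lemma chi_pair {d : ℕ} {S : Set G} (hS : DSet d S) {g : G} (hg : g ∈ S) (hg' : -g ∈ S)
    (ho : addOrderOf g = d + 2) : chi d ({g, -g} : Multiset G) = ((-(d : ℚ) / (d + 2) : ℚ) : AddCircle (d : ℚ)) := by
  have hg0 : g ≠ 0 := by rintro rfl; simp at ho
  rw [chi_atom hS (atom_pair hg0)]
  · congr 1
    have : ({g, -g} : Multiset G) = g ::ₘ {-g} := rfl
    rw [this, k_cons, k_singleton, kk, kk, addOrderOf_neg, ho]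
    push_cast
    field_simp
    ring
  · intro x hx
    simp at hx
    rcases hx with rfl | rfl
    exacts [hg, hg']

lemma over_pair {S : Set G} {g : G} (hg : g ∈ S) (hg' : -g ∈ S) : Over S ({g, -g} : Multiset G) := by
  intro x hx
  simp at hx
  rcases hx with rfl | rfl
  exacts [hg, hg']

lemma decomp {d : ℕ} (hd : 1 ≤ d) {S : Set G}
    {A : Multiset G} (hA : Atom A) (hAo : Over S A) (hnp : NP d A) {g : G} (hg : g ∈ A)
    (hg' : -g ∈ S) (ho : addOrderOf g = d + 2) (hv : A.count g < d + 2) :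
    ∃ F : Multiset (Multiset G), (∀ V ∈ F, Atom V ∧ Over S V ∧ NP d V ∧ -g ∈ V ∧ g ∉ V ∧ 
        ∀ x ∈ V, x = -g ∨ x ∈ A) ∧
      A + Multiset.replicate (d + 2) (-g) = A.count g • ({g, -g} : Multiset G) + F.sum ∧
      F.sum.count (-g) = d + 2 - A.count g := by
  set v := A.count g with hvdef
  set T := A.filter (fun x => x ≠ g) with hT
  have hdec : A = Multiset.replicate v g + T := by
    rw [hT, hvdef, ← Multiset.filter_eq']
    exact (Multiset.filter_add_not (fun x => x = g) A).symm
  have hna := hnp.notMem hd hA hg ho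
  have hne : -g ≠ g := ord_gt_two_ne_neg (by omega)
  have hg0 : g ≠ 0 := by rintro rfl; simp at ho
  have hTA : T ≤ A := Multiset.filter_le _ _
  have hgT : g ∉ T := by rw [hT]; simp
  have haT : -g ∉ T := fun h => hna (Multiset.mem_of_le hTA h)
  set A' := T + Multiset.replicate (d + 2 - v) (-g) with hA'
  have hid : A + Multiset.replicate (d + 2) (-g) = v • ({g, -g} : Multiset G) + A' := by
    rw [pair_nsmul, hA']
    conv_lhs => rw [hdec]
    have : Multiset.replicate (d + 2) (-g) = Multiset.replicate v (-g) + Multiset.replicate (d + 2 - v) (-g) := by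
      rw [← Multiset.replicate_add]; congr 1; omega
    rw [this]; abel
  have ho' : addOrderOf (-g) = d + 2 := by rw [addOrderOf_neg, ho]
  have hA's : A'.sum = 0 := by
    have h1 := congrArg Multiset.sum hid
    rw [Multiset.sum_add, Multiset.sum_add, hA.2.1, Multiset.sum_nsmul, (atom_pair hg0).2.1,
      Multiset.sum_replicate, ← ho', addOrderOf_nsmul_eq_zero] at h1
    simpa using h1.symm
  obtain ⟨F, hF, hFs⟩ := exists_fac A' hA's
  have hA'o : Over S A' := (hAo.mono hTA).add (Over.replicate hg' _)
  have hgA' : g ∉ A' := by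
    intro h
    rcases Multiset.mem_add.1 h with h | h
    · exact hgT h
    · exact hne (Multiset.eq_of_mem_replicate h).symm
  refine ⟨F, ?_, by rw [hFs]; exact hid, ?_⟩
  · intro V hV
    have hVle : V ≤ A' := hFs ▸ le_sum hV
    have hgV : g ∉ V := fun h => hgA' (Multiset.mem_of_le hVle h)
    have haV : -g ∈ V := by
      by_contra haV
      have hVT : V ≤ T := by
        rw [Multiset.le_iff_count]
        intro x
        by_cases hx : x = -g
        · rw [hx, Multiset.count_eq_zero_of_notMem haV]; omega
        · have := Multiset.le_iff_count.1 hVle x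
          rw [hA', Multiset.count_add, Multiset.count_replicate, if_neg (Ne.symm hx)] at this
          simpa using this
      have := (hF V hV).eq_of_le hA (hVT.trans hTA)
      rw [this] at hgV
      exact hgV hg
    refine ⟨hF V hV, hA'o.mono hVle, ?_, haV, hgV, ?_⟩
    · intro h hVh hoh
      rw [hVh] at haV hgV
      simp at haV hgV
      rcases haV with h1 | h1
      · exact hgV.2 (by rw [← h1, neg_neg])
      · exact hgV.1 h1
    · intro x hx
      rcases Multiset.mem_add.1 (Multiset.mem_of_le hVle hx) with h | h
      · exact Or.inr (Multiset.mem_of_le hTA h)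
      · exact Or.inl (Multiset.eq_of_mem_replicate h)
  · rw [hFs, hA', Multiset.count_add, Multiset.count_eq_zero_of_notMem haT, Multiset.count_replicate_self, zero_add]

lemma circ_dvd {d m v : ℕ} (hd : 1 ≤ d) 
    (h : (m * v) • ((-(d : ℚ) / (d + 2) : ℚ) : AddCircle (d : ℚ)) = 0) : d + 2 ∣ m * v := by
  rw [← AddCircle.coe_nsmul, circ_zero] at h
  obtain ⟨z, hz⟩ := h
  have hd0 : (d : ℚ) ≠ 0 := by positivity
  have hd2 : (d : ℚ) + 2 ≠ 0 := by positivity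
  have h1 : ((m * v : ℕ) : ℚ) = (d + 2) * (-z) := by
    rw [nsmul_eq_mul] at hz
    field_simp at hz
    linarith
  have h2 : ((m * v : ℕ) : ℤ) = ((d + 2 : ℕ) : ℤ) * (-z) := by exact_mod_cast h1
  exact Int.natCast_dvd_natCast.1 ⟨-z, h2⟩

lemma chi_ord {d : ℕ} {S : Set G} (hS : DSet d S) {g : G} (hg : g ∈ S) :
    chi d (Multiset.replicate (addOrderOf g) g) = 0 := by
  rw [chi_atom hS (atom_ord g) (Over.replicate hg _), k_ord]; simp

lemma pv {d e m : ℕ} (hd : 1 ≤ d) (he : Expo G e) (hed : e ≤ d + 2) (hm : RK G d m) {S : Set G}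
    (hS : DSet d S) {A : Multiset G} (hA : Atom A) (hAo : Over S A) (hnp : NP d A) {g : G} (hg : g ∈ A)
    (hg' : -g ∈ S) (ho : addOrderOf g = d + 2) : d + 2 ∣ m * A.count g := by
  by_cases hv : A.count g < d + 2
  · obtain ⟨F, hF, hid, hc⟩ := decomp hd hA hAo hnp hg hg' ho hv
    have hgS := hAo g hg
    have hg0 : g ≠ 0 := by rintro rfl; simp at ho
    have ho' : addOrderOf (-g) = d + 2 := by rw [addOrderOf_neg, ho]
    obtain ⟨h1, h2, h3⟩ := chi_msum hS F id (fun V hV => ⟨(hF V hV).2.1, (hF V hV).1.2.1⟩)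
    simp only [id, Multiset.map_id'] at h1 h2 h3
    have h4 := congrArg (chi d) hid
    rw [← ho'] at h4
    rw [chi_add hS hAo (Over.replicate hg' _) hA.2.1 (atom_ord (-g)).2.1, chi_ord hS hg', add_zero,
      chi_add hS ((over_pair hgS hg').nsmul _) h2
        (by rw [Multiset.sum_nsmul, (atom_pair hg0).2.1, smul_zero]) h3,
      chi_nsmul hS (over_pair hgS hg') (atom_pair hg0).2.1, chi_pair hS hgS hg' ho] at h4
    have h5 : m • chi d F.sum = 0 := by
      rw [h1, ← Multiset.sum_map_nsmul]
      apply Multiset.sum_eq_zero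
      intro x hx
      obtain ⟨V, hV, rfl⟩ := Multiset.mem_map.1 hx
      exact NP.chi hd he hed hm hS (hF V hV).1 (hF V hV).2.1 (hF V hV).2.2.1
    have h6 := NP.chi hd he hed hm hS hA hAo hnp
    rw [h4, smul_add, h5, add_zero, ← mul_smul] at h6
    exact circ_dvd hd h6
  · have := hA.count_le g
    have h : A.count g = d + 2 := by omega
    rw [h]; exact dvd_mul_left _ _

lemma decomp2 {d : ℕ} (hd : 1 ≤ d) {S : Set G} (hS : DSet d S)
    {A : Multiset G} (hA : Atom A) (hAo : Over S A) (hnp : NP d A) {g : G} (hg : g ∈ A)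
    (hg' : -g ∈ S) (ho : addOrderOf g = d + 2) (hv : A.count g < d + 2) (hv2 : 2 ≤ A.count g) :
    ∃ V : Multiset G, Atom V ∧ Over S V ∧ NP d V ∧ V.count (-g) = 1 ∧ g ∉ V ∧ 
        ∀ x ∈ V, x = -g ∨ x ∈ A := by
  obtain ⟨F, hF, hid, hc⟩ := decomp hd hA hAo hnp hg hg' ho hv
  have hg0 : g ≠ 0 := by rintro rfl; simp at ho
  have ho' : addOrderOf (-g) = d + 2 := by rw [addOrderOf_neg, ho]
  have hF0 : F ≠ 0 := by
    rintro rfl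
    simp at hc
    omega
  have hFpos := Multiset.card_pos.2 hF0
  have hFle : ∀ F : Multiset (Multiset G), (∀ V ∈ F, -g ∈ V) → Multiset.card F ≤ F.sum.count (-g) := by
    intro F
    induction F using Multiset.induction_on with
    | empty => simp
    | cons V F ih =>
      intro h
      have h1 := ih (fun W hW => h W (by simp [hW]))
      have h2 := Multiset.count_pos.2 (h V (by simp))
      rw [Multiset.card_cons, Multiset.sum_cons, Multiset.count_add]; omega
  have hl1 : HasLen (A + Multiset.replicate (d + 2) (-g)) (1 + 1) := by
    have := hA.hasLen.add (atom_ord (-g)).hasLen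
    rwa [ho'] at this
  have hl2 : HasLen (A + Multiset.replicate (d + 2) (-g)) (A.count g * 1 + Multiset.card F) := by
    rw [hid]
    exact ((atom_pair hg0).hasLen.nsmul _).add (hasLen_fac fun V hV => (hF V hV).1)
  have hdv := Int.le_of_dvd (by push_cast; omega)
    (hS _ (hAo.add (Over.replicate hg' _)) _ _ hl2 hl1)
  push_cast at hdv
  obtain ⟨V, hV⟩ := Multiset.exists_mem_of_ne_zero hF0
  obtain ⟨h1, h2, h3, h4, h5, h6⟩ := hF V hV
  refine ⟨V, h1, h2, h3, ?_, h5, h6⟩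
  obtain ⟨F', rfl⟩ := Multiset.exists_cons_of_mem hV
  have h7 := hFle F' (fun W hW => (hF W (by simp [hW])).2.2.2.1)
  have h8 := Multiset.count_pos.2 h4
  rw [Multiset.sum_cons, Multiset.count_add] at hc
  rw [Multiset.card_cons] at hdv
  omega

lemma P2key {d e m : ℕ} (hd : 1 ≤ d) (he : Expo G e) (hed : e ≤ d + 2) (hm : RK G d m)
    (hm0 : 0 < m) (hmd : m < d + 2) {S : Set G}
    (hS : DSet d S) {A : Multiset G} (hA : Atom A) (hAo : Over S A) (hnp : NP d A) {g : G} (hg : g ∈ A)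
    (hg' : -g ∈ S) (ho : addOrderOf g = d + 2) : A = Multiset.replicate (d + 2) g := by
  have hle := hA.count_le g
  by_cases hv : A.count g < d + 2
  · exfalso
    have h1 := pv hd he hed hm hS hA hAo hnp hg hg' ho
    have hpos := Multiset.count_pos.2 hg
    have hv2 : 2 ≤ A.count g := by
      by_contra hlt
      have : A.count g = 1 := by omega
      rw [this, mul_one] at h1
      exact absurd (Nat.le_of_dvd hm0 h1) (by omega)
    obtain ⟨V, h2, h3, h4, h5, h6, h7⟩ := decomp2 hd hS hA hAo hnp hg hg' ho hv hv2
    have h8 := pv hd he hed hm hS h2 h3 h4 (Multiset.count_pos.1 (show 0 < V.count (-g) by omega)) (by rw [neg_neg]; exact hAo g hg)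
      (by rw [addOrderOf_neg, ho])
    rw [h5, mul_one] at h8
    exact absurd (Nat.le_of_dvd hm0 h8) (by omega)
  · have : A.count g = addOrderOf g := by omega
    rw [← ho]; exact hA.eq_of_count this

theorem P2 {d e m : ℕ} (hd : 1 ≤ d) (he : Expo G e) (hed : e ≤ d + 2) (hm : RK G d m)
    (hm0 : 0 < m) (hmd : m < d + 2) {R : ℚ} (hR : 1 + (d : ℚ) / 2 ≤ R)
    (hk : ∀ S : Set G, DSet d S → ∀ A, Atom A → Over S A → NP d A → k A ≤ R) : Elast G d R := by
  apply elast_of_wt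
  intro S hS
  set P : Set G := {g | g ∈ S ∧ -g ∈ S ∧ addOrderOf g = d + 2} with hP
  refine ⟨hw P, fun A hA hAo => ?_⟩
  have hd0 : (0 : ℚ) ≤ d := by positivity
  by_cases hp : NP d A
  · by_cases hg : ∃ g ∈ A, g ∈ P
    · obtain ⟨g, hgA, hgP⟩ := hg
      have := P2key hd he hed hm hm0 hmd hS hA hAo hp hgA hgP.2.1 hgP.2.2
      rw [this, wt_replicate, hw, if_pos hgP]
      push_cast
      constructor <;> linarith
    · push Not at hg
      have h1 : wt (hw P) A = k A := wt_congr (fun g hgA => by rw [hw, if_neg (hg g hgA)])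
      rw [h1]
      exact ⟨nonpair_LCN hd hS he hed hA hAo hp A hA (over_supp A), hk S hS A hA hAo hp⟩
  · unfold NP at hp
    push Not at hp
    obtain ⟨g, rfl, ho⟩ := hp
    have h1 : g ∈ P := ⟨hAo g (by simp), hAo (-g) (by simp), ho⟩
    have h2 : -g ∈ P := ⟨hAo (-g) (by simp), by rw [neg_neg]; exact hAo g (by simp), by rw [addOrderOf_neg, ho]⟩
    have : ({g, -g} : Multiset G) = g ::ₘ {-g} := rfl
    rw [this, wt_cons, wt_singleton, hw, hw, if_pos h1, if_pos h2]
    constructor <;> linarith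

/-- a cross number bound from the divisibility of P3 -/
lemma k_bound {d e m : ℕ} (hd : 1 ≤ d) (he : Expo G e) (hed : e ≤ d + 2) (hm : RK G d m)
    (hm0 : 0 < m) {S : Set G} (hS : DSet d S) {A : Multiset G} (hA : Atom A) (hAo : Over S A) (hnp : NP d A)
    (hlt : k A < d + 1) : m * (k A - 1) ≤ d * (m - 1) := by
  obtain ⟨z, hz⟩ := P3k he hm (hS.mono (fun x hx => hAo x hx)) (nonpair_LCN hd hS he hed hA hAo hnp) hA
    (over_supp A)
  have hd0 : (0 : ℚ) < d := by positivity
  have hm1 : (0 : ℚ) < m := by exact_mod_cast hm0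
  have h1 : (d : ℚ) * z < d * m := by
    rw [← hz]
    have : k A - 1 < d := by linarith
    nlinarith
  have h2 : (z : ℚ) < m := lt_of_mul_lt_mul_left h1 hd0.le
  have h3 : z < m := by exact_mod_cast h2
  have h4 : z ≤ m - 1 := by omega
  have h5 : (z : ℚ) ≤ m - 1 := by exact_mod_cast h4
  rw [hz]
  gcongr

end ZS


namespace ZS
variable {G : Type*} [AddCommGroup G] [Finite G]

noncomputable def EM {κ : Type*} [Fintype κ] (f : κ → G) (x : κ → ℕ) : Multiset G :=
  ∑ i, Multiset.replicate (x i) (f i)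

section
variable {κ : Type*} [Fintype κ] {f : κ → G}

lemma EM_sum (x : κ → ℕ) : (EM f x).sum = ∑ i, x i • f i := sum_replicate_repr f x
lemma EM_add (x y : κ → ℕ) : EM f (fun i => x i + y i) = EM f x + EM f y := by
  unfold EM; rw [← Finset.sum_add_distrib]
  exact Finset.sum_congr rfl fun i _ => Multiset.replicate_add _ _ _
lemma EM_nsmul (m : ℕ) (x : κ → ℕ) : EM f (fun i => m * x i) = m • EM f x := by
  unfold EM; rw [Finset.smul_sum]
  exact Finset.sum_congr rfl fun i _ => (Multiset.nsmul_replicate _ _).symm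
lemma EM_over {S : Set G} (h : ∀ i, f i ∈ S) (x : κ → ℕ) : Over S (EM f x) :=
  Over.finsum _ fun i _ => Over.replicate (h i) _
lemma EM_over' {S : Set G} {x : κ → ℕ} (h : ∀ i, x i ≠ 0 → f i ∈ S) : Over S (EM f x) :=
  Over.finsum _ fun i _ => by
    intro g hg
    have h1 := Multiset.mem_replicate.1 hg
    rw [h1.2]
    exact h i h1.1
lemma EM_count (hf : Function.Injective f) (x : κ → ℕ) (i : κ) : (EM f x).count (f i) = x i := by
  unfold EM
  rw [Multiset.count_sum', Finset.sum_eq_single i]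
  · simp
  · intro j _ hj
    rw [Multiset.count_replicate, if_neg]
    exact fun h => hj (hf h)
  · simp
lemma EM_len {n : ℕ} (h : ∀ i, addOrderOf (f i) = n) (w : κ → ℕ) : HasLen (EM f (fun i => n * w i)) (∑ i, w i) := by
  unfold EM
  apply HasLen.finsum
  intro i _
  show HasLen (Multiset.replicate (n * w i) (f i)) (w i)
  rw [mul_comm, ← h i]
  exact hasLen_mul_ord (f i) (w i)
lemma EM_k {n : ℕ} (h : ∀ i, addOrderOf (f i) = n) (x : κ → ℕ) : k (EM f x) = (∑ i, x i : ℕ) / (n : ℚ) := by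
  unfold EM
  rw [k_finsum]
  push_cast
  rw [Finset.sum_div]
  apply Finset.sum_congr rfl
  intro i _
  rw [k_replicate, kk, h i]; ring
lemma EM_le (hf : Function.Injective f) {x : κ → ℕ} {T : Multiset G} (hT : T ≤ EM f x) :
    ∃ y : κ → ℕ, (∀ i, y i ≤ x i) ∧ T = EM f y := by
  refine ⟨fun i => T.count (f i), fun i => ?_, ?_⟩
  · have := Multiset.le_iff_count.1 hT (f i)
    rwa [EM_count hf] at this
  · apply over_repr f hf
    intro g hg
    exact EM_over (S := Set.range f) (fun i => ⟨i, rfl⟩) x g (Multiset.mem_of_le hT hg)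

lemma atom_EM (hf : Function.Injective f) {x : κ → ℕ} {i0 : κ} (hx : x i0 ≠ 0) (hs : ∑ i, x i • f i = 0)
    (hmin : ∀ y : κ → ℕ, (∀ i, y i ≤ x i) → ∑ i, y i • f i = 0 → (∀ i, y i = 0) ∨ (∀ i, y i = x i)) :
    Atom (EM f x) := by
  refine ⟨?_, by rw [EM_sum, hs], ?_⟩
  · intro h
    have := EM_count hf x i0
    rw [h] at this
    simp at this
    exact hx this.symm
  · intro T hT hTs
    obtain ⟨y, hy, rfl⟩ := EM_le hf hT
    rw [EM_sum] at hTs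
    rcases hmin y hy hTs with h | h
    · left
      have : y = fun _ => 0 := funext h
      rw [this]; simp [EM]
    · right
      rw [show y = x from funext h]
end

def ext {ι : Type*} {α : Type*} (u : α) (e : ι → α) : Option ι → α := fun o => o.elim u e

lemma ext_inj {ι α : Type*} {u : α} {e : ι → α} (he : Function.Injective e) (hu : u ∉ Set.range e) :
    Function.Injective (ext u e) := by
  intro a b h
  cases a <;> cases b
  · rfl
  · exact absurd ⟨_, h.symm⟩ hu
  · exact absurd ⟨_, h⟩ hu
  · exact congrArg some (he h)

section
variable {ι : Type*} [Fintype ι] {e : ι → G} {n : ℕ}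

lemma EM_ext (u : G) (t : ℕ) (x : ι → ℕ) : EM (ext u e) (ext t x) = Multiset.replicate t u + EM e x := by
  unfold EM
  rw [Fintype.sum_option]; rfl

lemma ext_sum (u : G) (t : ℕ) (x : ι → ℕ) : ∑ o, (ext t x) o • (ext u e) o = t • u + ∑ i, x i • e i := by
  rw [Fintype.sum_option]; rfl

lemma ext_eta {α : Type*} (y : Option ι → α) : y = ext (y none) (fun i => y (some i)) := by
  funext o; cases o <;> rfl

lemma ind_zero (h : Ind n e) {y : ι → ℕ} (hy : ∀ i, y i < n) (hs : ∑ i, y i • e i = 0) (i : ι) : y i = 0 :=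
  Nat.eq_zero_of_dvd_of_lt (h.nat hs i) (hy i)

lemma atom1 (h : Ind n e) (hn : 2 ≤ n) {u : G} (hu : u ∉ Set.range e) {t : ℕ} (ht : 0 < t) {x : ι → ℕ}
    (hx : ∀ i, x i < n) (hs : t • u + ∑ i, x i • e i = 0)
    (hmin : ∀ s ≤ t, ∀ y : ι → ℕ, (∀ i, y i ≤ x i) → s • u + ∑ i, y i • e i = 0 → s = 0 ∨ s = t) :
    Atom (Multiset.replicate t u + EM e x) := by
  rw [← EM_ext]
  apply atom_EM (ext_inj (h.inj hn) hu) (i0 := none)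
  · exact ht.ne'
  · rw [ext_sum, hs]
  · intro y hy hys
    have hy0 : y none ≤ t := hy none
    have hyi : ∀ i, y (some i) ≤ x i := fun i => hy (some i)
    rw [ext_eta y, ext_sum] at hys
    rcases hmin _ hy0 _ hyi hys with h1 | h1
    · left
      rw [h1, zero_smul, zero_add] at hys
      have := ind_zero h (fun i => lt_of_le_of_lt (hyi i) (hx i)) hys
      intro o
      cases o
      exacts [h1, this _]
    · right
      rw [h1] at hys
      have h2 : ∑ i, (x i - y (some i)) • e i = 0 := by
        have h3 : ∑ i, (x i - y (some i)) • e i + ∑ i, y (some i) • e i = ∑ i, x i • e i := by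
          rw [← Finset.sum_add_distrib]
          apply Finset.sum_congr rfl
          intro i _
          rw [← add_smul, Nat.sub_add_cancel (hyi i)]
        have h4 : ∑ i, x i • e i = ∑ i, y (some i) • e i := add_left_cancel (hs.trans hys.symm)
        rw [h4] at h3
        simpa using h3
      have := ind_zero h (fun i => lt_of_le_of_lt (Nat.sub_le _ _) (hx i)) h2
      intro o
      cases o with
      | none => exact h1
      | some i =>
        have h3 := this i
        have h4 := hyi i
        show y (some i) = x i
        omega

lemma atom2 (h : Ind n e) (hn : 2 ≤ n) {u v : G} (hu : u ∉ Set.range e) (hv : v ∉ Set.range e) (huv : v ≠ u)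
    {t : ℕ} {x : ι → ℕ}
    (hx : ∀ i, x i < n) (hs : v + (t • u + ∑ i, x i • e i) = 0)
    (hmin : ∀ s ≤ t, ∀ y : ι → ℕ, (∀ i, y i ≤ x i) → s • u + ∑ i, y i • e i = 0 → s = 0) :
    Atom ({v} + (Multiset.replicate t u + EM e x)) := by
  have hrew : ({v} + (Multiset.replicate t u + EM e x)) = EM (ext v (ext u e)) (ext 1 (ext t x)) := by
    rw [EM_ext, EM_ext, Multiset.replicate_one]
  rw [hrew]
  have hinj := ext_inj (ext_inj (h.inj hn) hu) (u := v) (by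
    rintro ⟨o, ho⟩
    cases o
    · exact huv ho.symm
    · exact hv ⟨_, ho⟩)
  have hz : ∀ s ≤ t, ∀ y : ι → ℕ, (∀ i, y i ≤ x i) → s • u + ∑ i, y i • e i = 0 → s = 0 ∧ ∀ i, y i = 0 := by
    intro s hst y hy hsum
    have h0 := hmin s hst y hy hsum
    rw [h0, zero_smul, zero_add] at hsum
    exact ⟨h0, ind_zero h (fun i => lt_of_le_of_lt (hy i) (hx i)) hsum⟩
  apply atom_EM hinj (i0 := none)
  · exact one_ne_zero
  · rw [ext_sum, ext_sum, one_smul, hs]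
  · intro y hy hys
    have hy1 : y none ≤ 1 := hy none
    have hy0 : y (some none) ≤ t := hy (some none)
    have hyi : ∀ i, y (some (some i)) ≤ x i := fun i => hy (some (some i))
    rw [Fintype.sum_option, Fintype.sum_option] at hys
    change y none • v + (y (some none) • u + ∑ i, y (some (some i)) • e i) = 0 at hys
    rcases Nat.le_one_iff_eq_zero_or_eq_one.1 hy1 with h1 | h1
    · left
      rw [h1, zero_smul, zero_add] at hys
      obtain ⟨h2, h3⟩ := hz _ hy0 _ hyi hys
      intro o
      cases o with
      | none => exact h1
      | some o =>
        cases o with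
        | none => exact h2
        | some i => exact h3 i
    · right
      rw [h1, one_smul] at hys
      have h2 : (t - y (some none)) • u + ∑ i, (x i - y (some (some i))) • e i = 0 := by
        have h3 : (t - y (some none)) • u + ∑ i, (x i - y (some (some i))) • e i + 
            (y (some none) • u + ∑ i, y (some (some i)) • e i) = t • u + ∑ i, x i • e i := by
          rw [add_add_add_comm, ← add_smul, Nat.sub_add_cancel hy0, ← Finset.sum_add_distrib]
          congr 1
          apply Finset.sum_congr rfl
          intro i _
          rw [← add_smul, Nat.sub_add_cancel (hyi i)]
        have h4 := add_left_cancel (hs.trans hys.symm)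
        rw [h4] at h3
        simpa using h3
      obtain ⟨h5, h6⟩ := hz _ (Nat.sub_le _ _) _ (fun i => Nat.sub_le _ _) h2
      intro o
      cases o with
      | none => exact h1
      | some o =>
        cases o with
        | none => show y (some none) = t; omega
        | some i => have := h6 i; have := hyi i; show y (some (some i)) = x i; omega

/-- the integral form of independence -/
lemma Ind.int (h : Ind n e) {z : ι → ℤ} (hz : ∑ i, z i • e i = 0) (i : ι) : (n : ℤ) ∣ z i := h.2 z hz i

end
end ZS


namespace ZS
variable {G : Type*} [AddCommGroup G] [Finite G]
section
variable {ι : Type*} [Fintype ι] {e : ι → G} {n : ℕ}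

lemma rel_dvd (h : Ind n e) {u : G} {x y : ι → ℕ} {s : ℕ} (hx : u + ∑ i, x i • e i = 0)
    (hy : s • u + ∑ i, y i • e i = 0) (i : ι) : (n : ℤ) ∣ (y i : ℤ) - s * x i := by
  apply h.int (z := fun i => (y i : ℤ) - s * x i)
  have h1 : ∑ i, ((y i : ℤ) - s * x i) • e i = ∑ i, y i • e i - s • ∑ i, x i • e i := by
    rw [Finset.smul_sum, ← Finset.sum_sub_distrib]
    apply Finset.sum_congr rfl
    intro i _
    rw [sub_smul, mul_smul]; simp
  rw [h1]
  have h2 : ∑ i, x i • e i = -u := by rw [eq_neg_iff_add_eq_zero, add_comm]; exact hx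
  rw [h2, smul_neg, sub_neg_eq_add, add_comm]; exact hy

lemma atomY1 (h : Ind n e) (hn : 2 ≤ n) {u : G} (hu : u ∉ Set.range e) {x : ι → ℕ}
    (hx : ∀ i, x i < n) (hs : u + ∑ i, x i • e i = 0) : Atom (Multiset.replicate 1 u + EM e x) := by
  apply atom1 h hn hu one_pos hx
  · rw [one_smul]; exact hs
  · intro s hs _ _ _
    omega

lemma neg_rel (h : Ind n e) {u : G} {x : ι → ℕ} (hx : ∀ i, x i ≤ n) (hs : u + ∑ i, x i • e i = 0) :
    -u + ∑ i, (n - x i) • e i = 0 := by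
  have h1 : ∑ i, (n - x i) • e i + ∑ i, x i • e i = 0 := by
    rw [← Finset.sum_add_distrib]
    apply Finset.sum_eq_zero
    intro i _
    rw [← add_smul, Nat.sub_add_cancel (hx i)]; exact h.1 i
  have h2 : ∑ i, x i • e i = -u := by rw [eq_neg_iff_add_eq_zero, add_comm]; exact hs
  rw [h2, add_comm] at h1
  exact h1

lemma stepA {d : ℕ} {S : Set G} (hS : DSet d S) (h : Ind n e) (hn : 2 ≤ n) (heS : ∀ i, e i ∈ S) {u : G}
    (huS : u ∈ S) (hu : u ∉ Set.range e) {x : ι → ℕ} (hx : ∀ i, x i < n) (hs : u + ∑ i, x i • e i = 0)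
    {j : ℕ} (hj : 1 ≤ j) {y w : ι → ℕ} (hyw : ∀ i, j * x i = y i + n * w i) (hy : ∀ i, y i < n)
    (i0 : ι) (hmin : ∀ s z : ℕ, 0 < s → s < j → z ≤ y i0 → ¬ (n : ℤ) ∣ (z : ℤ) - s * x i0) :
    Atom (Multiset.replicate j u + EM e y) ∧ (d : ℤ) ∣ (j : ℤ) - (1 + ∑ i, w i : ℕ) := by
  have hA1 := atomY1 h hn hu hx hs
  have heq : j • (Multiset.replicate 1 u + EM e x) =
      (Multiset.replicate j u + EM e y) + EM e (fun i => n * w i) := by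
    rw [smul_add, Multiset.nsmul_replicate, mul_one, ← EM_nsmul, add_assoc, ← EM_add]
    congr 2
    funext i; exact hyw i
  have hAj : Atom (Multiset.replicate j u + EM e y) := by
    apply atom1 h hn hu hj hy
    · have h1 := congrArg Multiset.sum heq
      rw [Multiset.sum_nsmul, hA1.2.1, smul_zero, Multiset.sum_add, Multiset.sum_add, EM_sum, EM_sum,
        Multiset.sum_replicate] at h1
      have h2 : ∑ i, (n * w i) • e i = 0 := by
        apply Finset.sum_eq_zero
        intro i _
        rw [mul_comm, mul_smul, h.1 i, smul_zero]
      rw [h2, add_zero] at h1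
      exact h1.symm
    · intro s hsj z hz hsum
      by_contra hcon
      push Not at hcon
      exact hmin s (z i0) (Nat.pos_of_ne_zero hcon.1) (lt_of_le_of_ne hsj hcon.2) (hz i0)
        (rel_dvd h hs hsum i0)
  refine ⟨hAj, ?_⟩
  apply hS (j • (Multiset.replicate 1 u + EM e x))
  · exact Over.nsmul ((Over.replicate huS _).add (EM_over heS _)) _
  · have := HasLen.nsmul hA1.hasLen j
    simpa using this
  · rw [heq]
    exact hAj.hasLen.add (EM_len h.ord w)

lemma not_dvd_of_neg {n : ℕ} {a : ℤ} (h1 : a < 0) (h2 : -(n : ℤ) < a) : ¬ (n : ℤ) ∣ a := by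
  intro h
  have := Int.le_of_dvd (by omega : 0 < -a) (by simpa using h)
  omega
lemma not_dvd_of_pos {n : ℕ} {a : ℤ} (h1 : 0 < a) (h2 : a < n) : ¬ (n : ℤ) ∣ a := by
  intro h
  have := Int.le_of_dvd h1 h
  omega

lemma lemX {d : ℕ} (hd : 2 ≤ d) (hn : n = d + 2) {S : Set G} (hS : DSet d S) (h : Ind n e)
    (hc : Fintype.card ι = d + 1) (heS : ∀ i, e i ∈ S) {u : G}
    (huS : u ∈ S) (huS' : -u ∈ S) (hu : u ∉ Set.range e) (hu' : -u ∉ Set.range e)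
    (ho : addOrderOf u = n) (hL : LCN (insert u (Set.range e)))
    {x : ι → ℕ} (hx1 : ∀ i, 1 ≤ x i) (hx : ∀ i, x i < n) (hs : u + ∑ i, x i • e i = 0) :
    (∀ i, x i = 1) ∨ ((∀ i, n ≤ 2 * x i) ∧ ∀ i i', 2 * x i = n → 2 * x i' = n → i = i') := by
  have hn2 : 2 ≤ n := by omega
  haveI : Nonempty ι := Fintype.card_pos_iff.1 (by omega)
  obtain ⟨i0, hi0⟩ := Finite.exists_max x
  by_cases hM1 : x i0 = 1
  · left
    intro i
    have := hi0 i; have := hx1 i; omega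
  right
  have hM : 2 ≤ x i0 := by have := hx1 i0; omega
  have hex : ∃ j, n ≤ j * x i0 := ⟨n, by nlinarith⟩
  obtain ⟨j, hj1, hj2⟩ : ∃ j, n ≤ j * x i0 ∧ (j - 1) * x i0 < n := by
    refine ⟨Nat.find hex, Nat.find_spec hex, ?_⟩
    by_contra hcon
    push Not at hcon
    have h1 := Nat.find_min' hex hcon
    have h0 : Nat.find hex ≠ 0 := by
      intro h0
      have := Nat.find_spec hex
      rw [h0] at this; omega
    omega
  have hj : 2 ≤ j := by
    by_contra hcon
    have : j ≤ 1 := by omega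
    have := hx i0
    have : j * x i0 ≤ 1 * x i0 := Nat.mul_le_mul_right _ (by omega)
    omega
  obtain ⟨a, rfl⟩ : ∃ a, j = a + 1 := ⟨j - 1, by omega⟩
  rw [Nat.add_sub_cancel] at hj2
  have ha2 : 2 * a ≤ d + 1 := by
    have : a * 2 ≤ a * x i0 := Nat.mul_le_mul_left _ hM
    omega
  have hax : ∀ i, a * x i < n := fun i => lt_of_le_of_lt (Nat.mul_le_mul_left _ (hi0 i)) hj2
  have hexp : ∀ i, (a + 1) * x i = a * x i + x i := fun i => by ring
  -- the first family
  have hst1 := stepA hS h hn2 heS huS hu hx hs (j := a + 1) (by omega)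
    (y := fun i => if n ≤ (a + 1) * x i then (a + 1) * x i - n else (a + 1) * x i)
    (w := fun i => if n ≤ (a + 1) * x i then 1 else 0)
    (by intro i; (try dsimp only); split_ifs <;> omega)
    (by
      intro i; (try dsimp only)
      have := hax i; have := hx i; have := hexp i
      split_ifs <;> omega) i0
    (by
      intro s z hs0 hsj hz
      rw [if_pos hj1] at hz
      have h1 : s * x i0 ≤ a * x i0 := Nat.mul_le_mul_right _ (by omega)
      have h2 : 1 * x i0 ≤ s * x i0 := Nat.mul_le_mul_right _ (by omega)
      have h3 := hexp i0
      have h4 : z < s * x i0 := by omega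
      have h5 : s * x i0 < n + z := by omega
      have h6 : (z : ℤ) < s * x i0 := by exact_mod_cast h4
      have h7 : (s * x i0 : ℤ) < n + z := by exact_mod_cast h5
      apply not_dvd_of_neg
      · linarith
      · linarith)
  obtain ⟨hA, hdv⟩ := hst1
  rw [Finset.sum_boole] at hdv
  set b := (Finset.univ.filter (fun i => n ≤ (a + 1) * x i)).card with hb
  have hbc : b ≤ d + 1 := by rw [← hc]; exact Finset.card_le_univ _
  have hb1 : 1 ≤ b := Finset.card_pos.2 ⟨i0, by simp [hj1]⟩
  push_cast at hdv
  -- b = d+1 implies j = 2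
  have hfull : b = d + 1 → a = 1 := by
    intro hbd
    rw [hbd] at hdv
    have h1 : (d : ℤ) ∣ (a : ℤ) - 1 := by
      have := dvd_add hdv (dvd_refl (d : ℤ))
      have h2 : ((a : ℤ) + 1 - (1 + ((d + 1 : ℕ) : ℤ)) + d) = a - 1 := by push_cast; ring
      rwa [h2] at this
    by_contra hne
    have := Int.le_of_dvd (by omega) h1
    omega
  have hball : b = d + 1 → ∀ i, n ≤ 2 * x i := by
    intro hbd i
    have ha := hfull hbd
    have h1 : (Finset.univ.filter (fun i => n ≤ (a + 1) * x i)) = Finset.univ := by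
      apply Finset.eq_univ_of_card; rw [hc, ← hbd]
    have h2 : i ∈ (Finset.univ.filter (fun i => n ≤ (a + 1) * x i)) := by rw [h1]; simp
    have h3 := (Finset.mem_filter.1 h2).2
    rw [ha] at h3; exact h3
  by_cases hall : ∀ i, n < (a + 1) * x i
  · have hbd : b = d + 1 := by
      rw [hb, Finset.filter_true_of_mem (fun i _ => (hall i).le), Finset.card_univ, hc]
    refine ⟨hball hbd, ?_⟩
    intro i i' hi
    have := hall i
    rw [hfull hbd] at this
    omega
  push Not at hall
  obtain ⟨i1, hi1⟩ := hall
  -- the second family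
  have hst2 := stepA hS h hn2 heS huS' hu' (x := fun i => n - x i)
    (by intro i; have := hx i; have := hx1 i; (try dsimp only); omega) (neg_rel h (fun i => (hx i).le) hs)
    (j := a + 1) (by omega)
    (y := fun i => if n < (a + 1) * x i then 2 * n - (a + 1) * x i else n - (a + 1) * x i)
    (w := fun i => if n < (a + 1) * x i then a - 1 else a)
    (by
      intro i
      have h1 := hax i; have h2 := hx i; have h3 := hexp i
      (try dsimp only)
      split_ifs with hif
      · obtain ⟨a', rfl⟩ : ∃ a', a = a' + 1 := ⟨a - 1, by omega⟩
        rw [Nat.add_sub_cancel]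
        zify [h2.le, (by omega : (a' + 1 + 1) * x i ≤ 2 * n)]
        ring
      · zify [h2.le, (by omega : (a + 1) * x i ≤ n)]
        ring)
    (by
      intro i; (try dsimp only)
      have := hax i; have := hx i; have := hexp i; have := hx1 i
      split_ifs <;> omega) i1
    (by
      intro s z hs0 hsj hz hdvd
      rw [if_neg (by omega)] at hz
      have h1 : s * x i1 ≤ a * x i1 := Nat.mul_le_mul_right _ (by omega)
      have h2 : 1 * x i1 ≤ s * x i1 := Nat.mul_le_mul_right _ (by omega)
      have h3 := hexp i1
      have h4 := hx1 i1
      have h5 : (n : ℤ) ∣ (z : ℤ) + s * x i1 := by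
        change (n : ℤ) ∣ (z : ℤ) - s * ((n - x i1 : ℕ) : ℤ) at hdvd
        rw [Nat.cast_sub (hx i1).le] at hdvd
        have := dvd_add hdvd (dvd_mul_left (n : ℤ) s)
        have h6 : (z : ℤ) - s * ((n : ℤ) - x i1) + s * n = z + s * x i1 := by ring
        rwa [h6] at this
      refine not_dvd_of_pos ?_ ?_ h5
      · have : 0 < z + s * x i1 := by omega
        exact_mod_cast this
      · have : z + s * x i1 < n := by omega
        exact_mod_cast this)
  obtain ⟨_, hdv'⟩ := hst2
  set F := Finset.univ.filter (fun i => n < (a + 1) * x i) with hF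
  set b' := F.card with hb'
  have hbb : b' ≤ b := Finset.card_le_card (fun i hi => by
    simp only [hF, Finset.mem_filter] at hi ⊢; exact ⟨hi.1, hi.2.le⟩)
  have hb'd : b' ≤ d := by
    have : F ⊆ Finset.univ.erase i1 := fun i hi => by
      simp only [hF, Finset.mem_filter] at hi
      simp only [Finset.mem_erase, Finset.mem_univ, and_true]
      rintro rfl; omega
    have := Finset.card_le_card this
    rw [Finset.card_erase_of_mem (Finset.mem_univ _), Finset.card_univ, hc] at this
    omega
  have hsumw : (∑ i, if n < (a + 1) * x i then a - 1 else a) + b' = (d + 1) * a := by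
    have h1 : b' = ∑ i, if n < (a + 1) * x i then 1 else 0 := by rw [Finset.sum_boole]; simp [hb', hF]
    rw [h1, ← Finset.sum_add_distrib]
    rw [Finset.sum_congr rfl (g := fun _ => a)]
    · simp [hc]
    · intro i _
      split_ifs <;> omega
  have hdb : (d : ℤ) ∣ b' := by
    obtain ⟨Wn, hWn⟩ : ∃ Wn, Wn = ∑ i, if n < (a + 1) * x i then a - 1 else a := ⟨_, rfl⟩
    rw [← hWn] at hsumw hdv'
    have h1 : ((a + 1 : ℕ) : ℤ) - ((1 + Wn : ℕ) : ℤ) = b' - d * a := by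
      zify at hsumw
      push_cast
      linarith
    rw [h1] at hdv'
    have := dvd_add hdv' (dvd_mul_right (d : ℤ) a)
    simpa using this
  have hb'cases : b' = 0 ∨ b' = d := by
    have h1 : d ∣ b' := by exact_mod_cast hdb
    rcases Nat.eq_zero_or_pos b' with h0 | h0
    · left; exact h0
    · right; exact le_antisymm hb'd (Nat.le_of_dvd h0 h1)
  rcases hb'cases with hz | hz
  · exfalso
    have hle : ∀ i, (a + 1) * x i ≤ n := by
      intro i
      by_contra hcon
      have : i ∈ F := by simp [hF]; omega
      rw [hb', Finset.card_eq_zero] at hz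
      rw [hz] at this; simp at this
    by_cases hab : b = a
    · -- support misses e i0
      set y : ι → ℕ := fun i => if n ≤ (a + 1) * x i then (a + 1) * x i - n else (a + 1) * x i with hy
      have hover : Over (insert u (e '' {i | i ≠ i0})) (Multiset.replicate (a + 1) u + EM e y) := by
        apply (Over.replicate (Set.mem_insert _ _) _).add
        apply EM_over'
        intro i hi
        right
        refine ⟨i, ?_, rfl⟩
        rintro rfl
        apply hi
        simp only [hy]
        rw [if_pos hj1]
        have := hle i; omega
      have hsub : insert u (e '' {i | i ≠ i0}) ⊆ insert u (Set.range e) :=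
        Set.insert_subset_insert (Set.image_subset_range _ _)
      have hsubS : insert u (e '' {i | i ≠ i0}) ⊆ S := by
        rintro g (rfl | ⟨i, _, rfl⟩)
        exacts [huS, heS i]
      have hnc : (insert u (e '' {i | i ≠ i0})).ncard ≤ d + 1 := by
        have h1 := Set.ncard_insert_le u (e '' {i | i ≠ i0})
        have h2 : (e '' {i | i ≠ i0}).ncard ≤ ({i | i ≠ i0} : Set ι).ncard := Set.ncard_image_le (Set.toFinite _)
        have h3 : ({i | i ≠ i0} : Set ι).ncard = d := by
          have : ({i | i ≠ i0} : Set ι) = ((Finset.univ.erase i0 : Finset ι) : Set ι) := by ext; simp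
          rw [this, Set.ncard_coe_finset, Finset.card_erase_of_mem (Finset.mem_univ _), Finset.card_univ, hc]
          omega
        omega
      have hk := HF_small (hS.mono hsubS) (hL.mono hsub) hnc _ hA hover
      rw [k_add, k_replicate, EM_k h.ord, kk, ho] at hk
      have hn0 : (n : ℚ) ≠ 0 := by positivity
      field_simp at hk
      have hk' : a + 1 + ∑ i, y i = n := by exact_mod_cast hk
      have hsy : (a + 1) * (d + 1 - b) ≤ ∑ i, y i := by
        have h1 : (Finset.univ.filter (fun i => ¬ n ≤ (a + 1) * x i)).card = d + 1 - b := by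
          have := Finset.card_filter_add_card_filter_not (s := (Finset.univ : Finset ι)) (fun i => n ≤ (a + 1) * x i)
          rw [Finset.card_univ, hc] at this
          omega
        calc (a + 1) * (d + 1 - b) = ∑ i ∈ Finset.univ.filter (fun i => ¬ n ≤ (a + 1) * x i), (a + 1) := by
              rw [Finset.sum_const, h1, smul_eq_mul, mul_comm]
          _ ≤ ∑ i ∈ Finset.univ.filter (fun i => ¬ n ≤ (a + 1) * x i), y i := by
              apply Finset.sum_le_sum
              intro i hi
              have := (Finset.mem_filter.1 hi).2
              simp only [hy]
              rw [if_neg this]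
              exact Nat.le_mul_of_pos_right _ (hx1 i)
          _ ≤ ∑ i, y i := Finset.sum_le_sum_of_subset (Finset.filter_subset _ _)
      rw [hab] at hsy
      obtain ⟨c, hcc⟩ : ∃ c, d + 1 = a + 1 + c := ⟨d - a, by omega⟩
      have : d + 1 - a = c + 1 := by omega
      rw [this] at hsy
      have hc1 : 1 ≤ c := by omega
      have ha1 : 1 ≤ a := by omega
      have := Nat.mul_le_mul ha1 hc1
      nlinarith
    · have h1 : ((a : ℤ) + 1 - (1 + b)) = a - b := by ring
      rw [h1] at hdv
      have hbd : b = d + 1 ∧ a = 1 := by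
        rcases lt_or_gt_of_ne hab with h2 | h2
        · have := Int.le_of_dvd (by omega) hdv
          omega
        · have h3 : (d : ℤ) ∣ (b : ℤ) - a := by rw [← neg_sub]; exact (dvd_neg).2 hdv
          have := Int.le_of_dvd (by omega) h3
          omega
      have h2 := hball hbd.1
      have h3 : (2 : ℕ) • u = 0 := by
        have h4 : (2 : ℕ) • (u + ∑ i, x i • e i) = 0 := by rw [hs, smul_zero]
        rw [smul_add, Finset.smul_sum] at h4
        rw [Finset.sum_eq_zero, add_zero] at h4
        · exact h4
        · intro i _
          have h5 := hle i
          rw [hbd.2] at h5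
          have h6 := h2 i
          have : 2 * x i = n := by omega
          rw [← mul_smul, this, h.1 i]
      have := addOrderOf_dvd_of_nsmul_eq_zero h3
      rw [ho] at this
      have := Nat.le_of_dvd (by omega) this
      omega
  · have hbd : b = d + 1 := by
      by_contra hcon
      have hbd : b = d := by omega
      rw [hbd] at hdv
      have h1 : (d : ℤ) ∣ (a : ℤ) := by
        have := dvd_add hdv (dvd_refl (d : ℤ))
        have h2 : ((a : ℤ) + 1 - (1 + (d : ℤ)) + d) = a := by ring
        rwa [h2] at this
      have := Int.le_of_dvd (by omega) h1
      omega
    refine ⟨hball hbd, ?_⟩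
    have ha := hfull hbd
    have hFc : Fᶜ.card = 1 := by
      rw [Finset.card_compl, hc, ← hb', hz]; omega
    intro i i' hi hi'
    apply Finset.card_le_one.1 hFc.le
    · simp [hF, ha]; omega
    · simp [hF, ha]; omega
end
end ZS


namespace ZS
variable {G : Type*} [AddCommGroup G] [Finite G]

lemma LCN_neg {d n : ℕ} (hd : 1 ≤ d) (he : Expo G n) (hn : n = d + 2) {S : Set G} (hS : DSet d S) {E : Set G}
    (hES : E ⊆ S) (hL : LCN E) {g : G} (hgS : -g ∈ S) (hgE : g ∉ E) (ho : addOrderOf g = d + 2) :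
    LCN (insert (-g) E) := by
  intro U hU hUo
  by_contra hk
  push Not at hk
  have hsub : insert (-g) E ⊆ S := Set.insert_subset hgS hES
  obtain ⟨h, rfl, hoh, _⟩ := non_LCN (hS.mono hsub) he hn.le hU hUo hk
  have hne : -g ≠ g := ord_gt_two_ne_neg (by omega)
  have h1 : h ∈ insert (-g) E := hUo h (by simp)
  have h2 : -h ∈ insert (-g) E := hUo (-h) (by simp)
  rcases h1 with h1 | h1
  · rw [h1, neg_neg] at h2
    rcases h2 with h2 | h2
    · exact hne h2.symm
    · exact hgE h2
  · rcases h2 with h2 | h2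
    · rw [neg_inj] at h2
      exact hgE (h2 ▸ h1)
    · have := hL _ hU (over_pair h1 h2)
      linarith

lemma gen_all {E Q : Set G} (h : ∀ g ∈ Q, ∃ Y, Over E Y ∧ g + Y.sum = 0) (T : Multiset G) (hT : Over Q T) :
    ∃ Y, Over E Y ∧ Y.sum = - T.sum := by
  induction T using Multiset.induction_on with
  | empty => exact ⟨0, fun g hg => by simp at hg, by simp⟩
  | cons a T ih =>
    obtain ⟨Y1, h1, h2⟩ := ih (fun g hg => hT g (Multiset.mem_cons_of_mem hg))
    obtain ⟨Y2, h3, h4⟩ := h a (hT a (Multiset.mem_cons_self _ _))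
    refine ⟨Y2 + Y1, h3.add h1, ?_⟩
    rw [Multiset.sum_add, Multiset.sum_cons, h2, eq_neg_of_add_eq_zero_right h4]; abel

lemma caseB1 {d n p s : ℕ} (hd : 1 ≤ d) (hp : p.Prime) (hs : 1 ≤ s) (hn : n = d + 2) (hps : n = p ^ s)
    (he : Expo G n) (ht : tors G p ≤ p ^ (d + 1)) {S : Set G} (hS : DSet d S)
    {A : Multiset G} (hA : Atom A) (hAo : Over S A) (hnp : NP d A) {g : G} (hg : g ∈ A)
    (hg' : -g ∈ S) (ho : addOrderOf g = d + 2) (hv : A.count g < d + 2) :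
    ∃ E : Finset G, (E : Set G) ⊆ supp A \ {g} ∧ E.card = d + 1 ∧ Ind n (Subtype.val : E → G) := by
  have hL : LCN (supp A) := nonpair_LCN hd hS he hn.le hA hAo hnp
  have hAS : supp A ⊆ S := fun x hx => hAo x hx
  have hgA : -g ∉ A := hnp.notMem hd hA hg ho
  obtain ⟨T, hT, hTg⟩ : ∃ T, Over (supp A \ {g}) T ∧ (T.sum = -g ∨ T.sum = g) := by
    have hc1 : 1 ≤ A.count g := Multiset.one_le_count_iff_mem.2 hg
    by_cases hc : A.count g = 1
    · refine ⟨A.erase g, ?_, ?_⟩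
      · intro x hx
        refine ⟨Multiset.mem_of_mem_erase hx, ?_⟩
        rintro rfl
        rw [← Multiset.one_le_count_iff_mem, Multiset.count_erase_self, hc] at hx
        omega
      · left
        have h1 := congrArg Multiset.sum (Multiset.cons_erase hg)
        rw [Multiset.sum_cons, hA.2.1] at h1
        exact eq_neg_of_add_eq_zero_right h1
    · obtain ⟨V, hV, hVo, hVnp, hVc, hVg, hVx⟩ := decomp2 hd hS hA hAo hnp hg hg' ho hv (by omega)
      have hgV : -g ∈ V := by rw [← Multiset.one_le_count_iff_mem, hVc]
      refine ⟨V.erase (-g), ?_, ?_⟩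
      · intro x hx
        have hxV := Multiset.mem_of_mem_erase hx
        rcases hVx x hxV with rfl | h
        · rw [← Multiset.one_le_count_iff_mem, Multiset.count_erase_self, hVc] at hx
          omega
        · refine ⟨h, ?_⟩
          rintro rfl
          exact hVg hxV
      · right
        have h1 := congrArg Multiset.sum (Multiset.cons_erase hgV)
        rw [Multiset.sum_cons, hV.2.1] at h1
        rw [eq_neg_of_add_eq_zero_right h1, neg_neg]
  obtain ⟨E, hEQ, hrel, hgen⟩ := exists_E (G := G) hp he (b := s) (c := 1) (by rw [mul_one, hps]) (supp A \ {g})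
  have hEA : (E : Set G) ⊆ supp A := fun x hx => (hEQ hx).1
  have hgE : g ∉ (E : Set G) := fun h => (hEQ h).2 rfl
  have hEc : E.card ≤ d + 1 := E_card_le hp ht hrel
  have hEHF : HF (E : Set G) := HF_small (hS.mono (hEA.trans hAS)) (hL.mono hEA) (by rw [Set.ncard_coe_finset]; exact hEc)
  obtain ⟨Z, hZ, hZs⟩ := gen_all (fun g hg => by simpa using hgen g hg) T hT
  have hn1 : ∀ x : G, (n - 1) • x = -x := by
    intro x
    rw [eq_neg_iff_add_eq_zero, ← succ_nsmul, Nat.sub_add_cancel (by omega)]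
    exact he.2 x
  obtain ⟨Y, Y', hY, hY', hYs, hYs'⟩ : ∃ Y Y', Over (E : Set G) Y ∧ Over (E : Set G) Y' ∧ g + Y.sum = 0 ∧ -g + Y'.sum = 0 := by
    rcases hTg with h | h
    · refine ⟨(n - 1) • Z, Z, hZ.nsmul _, hZ, ?_, ?_⟩
      · rw [Multiset.sum_nsmul, hZs, h, hn1]; simp
      · rw [hZs, h]; simp
    · refine ⟨Z, (n - 1) • Z, hZ, hZ.nsmul _, ?_, ?_⟩
      · rw [hZs, h]; simp
      · rw [Multiset.sum_nsmul, hZs, h, hn1]; simp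
  have hES : (E : Set G) ⊆ S := hEA.trans hAS
  have hgS := hAo g hg
  have hcons : ∀ {x : G} {Y : Multiset G}, x ∈ S → Over (E : Set G) Y → Over S (x ::ₘ Y) := by
    intro x Y hx hY z hz
    rcases Multiset.mem_cons.1 hz with rfl | hz
    exacts [hx, hES (hY z hz)]
  have hchi : chi d (g ::ₘ Y) + chi d (-g ::ₘ Y') = ((-(d : ℚ) / (d + 2) : ℚ) : AddCircle (d : ℚ)) := by
    rw [← chi_add hS (hcons hgS hY) (hcons hg' hY') (by simpa using hYs) (by simpa using hYs')]
    have h1 : g ::ₘ Y + -g ::ₘ Y' = {g, -g} + (Y + Y') := by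
      rw [← Multiset.singleton_add, ← Multiset.singleton_add]
      have : ({g, -g} : Multiset G) = {g} + {-g} := rfl
      rw [this]; abel
    have hYY : (Y + Y').sum = 0 := by
      rw [Multiset.sum_add, eq_neg_of_add_eq_zero_right hYs, eq_neg_of_add_eq_zero_right hYs']; simp
    rw [h1, chi_add hS (over_pair hgS hg') ((hY.add hY').mono_set hES) (by simp) hYY,
      chi_pair hS hgS hg' ho, chi_HF (hS.mono hES) hEHF (hY.add hY') hYY, add_zero]
  have hor : p ^ (s - 1) • chi d (g ::ₘ Y) ≠ 0 ∨ p ^ (s - 1) • chi d (-g ::ₘ Y') ≠ 0 := by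
    by_contra hcon
    push Not at hcon
    have h1 : (p ^ (s - 1) * 1) • ((-(d : ℚ) / (d + 2) : ℚ) : AddCircle (d : ℚ)) = 0 := by
      rw [mul_one, ← hchi, smul_add, hcon.1, hcon.2, add_zero]
    have h2 := circ_dvd hd h1
    rw [mul_one, ← hn, hps] at h2
    have := (Nat.pow_dvd_pow_iff_le_right hp.one_lt).1 h2
    omega
  have key : (∀ z : E → ℤ, ∑ x, z x • ((1 : ℕ) • (x : G)) = 0 → ∀ x, ((p ^ (s - 1 + 1) : ℕ) : ℤ) ∣ z x) ∧ E.card = d + 1 := by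
    rcases hor with hne | hne
    · exact core hp he (b := s) (c := 1) (by rw [mul_one, hps]) (hS.mono hAS) hL hEA hEc hg hY (by simpa using hYs)
        (by simpa using hne)
    · exact core hp he (b := s) (c := 1) (by rw [mul_one, hps]) (hS.mono (Set.insert_subset hg' hES))
        (LCN_neg hd he hn hS hES (hL.mono hEA) hg' hgE ho) (Set.subset_insert _ _) hEc (Set.mem_insert _ _) hY' (by simpa using hYs')
        (by simpa using hne)
  refine ⟨E, hEQ, key.2, ?_, ?_⟩
  · intro i; exact he.2 _
  · intro z hz i
    have := key.1 z (by simpa using hz) i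
    rwa [Nat.sub_add_cancel hs, ← hps] at this

lemma spanning {ι : Type*} [Fintype ι] {e : ι → G} {n : ℕ} (hn : 2 ≤ n) (h : Ind n e) {m : ℕ} (hc : Fintype.card ι = m)
    (f : G →+ (Fin m → ZMod n)) (hf : Function.Injective f) (u : G) :
    ∃ x : ι → ℕ, (∀ i, x i < n) ∧ u + ∑ i, x i • e i = 0 := by
  haveI : Fintype G := Fintype.ofFinite G
  haveI : NeZero n := ⟨by omega⟩
  let F : (ι → Fin n) → G := fun x => ∑ i, (x i : ℕ) • e i
  have hF : Function.Injective F := by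
    intro x y hxy
    funext i
    have h1 := h.int (z := fun i => ((x i : ℕ) : ℤ) - (y i : ℕ)) (by
      simp only [sub_smul, Finset.sum_sub_distrib, natCast_zsmul]
      exact sub_eq_zero.2 hxy) i
    have h2 := (x i).2
    have h3 := (y i).2
    have h4 := Int.eq_zero_of_abs_lt_dvd h1 (by rw [abs_lt]; omega)
    ext; omega
  have hcard : Fintype.card G ≤ Fintype.card (ι → Fin n) := by
    have := Fintype.card_le_of_injective f hf
    simpa [hc, ZMod.card] using this
  have hb : Function.Bijective F := by
    rw [Fintype.bijective_iff_injective_and_card]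
    exact ⟨hF, le_antisymm (Fintype.card_le_of_injective F hF) hcard⟩
  obtain ⟨x, hx⟩ := hb.2 (-u)
  refine ⟨fun i => x i, fun i => (x i).2, ?_⟩
  have : ∑ i, (x i : ℕ) • e i = -u := hx
  rw [this]; simp

lemma caseB2 {d n : ℕ} (hd : 2 ≤ d) (hn : n = d + 2) (he : Expo G n) {ι : Type*} [Fintype ι] {e : ι → G}
    (h : Ind n e) (hc : Fintype.card ι = d + 1) {S : Set G} (hS : DSet d S)
    {A : Multiset G} (hA : Atom A) (hAo : Over S A) (hnp : NP d A) (hk : 1 < k A) {g : G} (hg : g ∈ A)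
    (hg' : -g ∈ S) (ho : addOrderOf g = d + 2) (heA : ∀ i, e i ∈ A) (heg : ∀ i, e i ≠ g)
    {x : ι → ℕ} (hx : ∀ i, x i < n) (hs : g + ∑ i, x i • e i = 0) :
    g = ∑ i, e i := by
  have hn2 : 2 ≤ n := by omega
  have hL : LCN (supp A) := nonpair_LCN (by omega) hS he hn.le hA hAo hnp
  have hAS : supp A ⊆ S := fun x hx => hAo x hx
  have hgA : -g ∉ A := hnp.notMem (by omega) hA hg ho
  have hgS := hAo g hg
  have hEA : Set.range e ⊆ supp A := by rintro _ ⟨i, rfl⟩; exact heA i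
  have heS : ∀ i, e i ∈ S := fun i => hAo _ (heA i)
  have hu : g ∉ Set.range e := by rintro ⟨i, hi⟩; exact heg i hi
  have hu' : -g ∉ Set.range e := by rintro ⟨i, hi⟩; exact hgA (hi ▸ heA i)
  have hL1 : LCN (insert g (Set.range e)) := hL.mono (Set.insert_subset hg hEA)
  have hL2 : LCN (insert (-g) (Set.range e)) := LCN_neg (by omega) he hn hS (hEA.trans hAS) (hL.mono hEA) hg' hu ho
  have ho' : addOrderOf (-g) = n := by rw [addOrderOf_neg, ho, hn]
  have hn0 : (n : ℚ) ≠ 0 := by positivity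
  -- a generic length computation
  have small : ∀ (u : G) (y : ι → ℕ) (i1 : ι), u ∈ S → u ∉ Set.range e → addOrderOf u = n → LCN (insert u (Set.range e)) →
      (∀ i, y i < n) → u + ∑ i, y i • e i = 0 → y i1 = 0 → 1 + ∑ i, y i = n := by
    intro u y i1 huS hur hou hLu hy hys hy1
    have hat := atomY1 h hn2 hur hy hys
    have hover : Over (insert u (e '' {i | i ≠ i1})) (Multiset.replicate 1 u + EM e y) := by
      apply (Over.replicate (Set.mem_insert _ _) _).add
      apply EM_over'
      intro i hi
      right
      refine ⟨i, ?_, rfl⟩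
      rintro rfl
      exact hi hy1
    have hsub : insert u (e '' {i | i ≠ i1}) ⊆ insert u (Set.range e) :=
      Set.insert_subset_insert (Set.image_subset_range _ _)
    have hsubS : insert u (e '' {i | i ≠ i1}) ⊆ S := by
      rintro g (rfl | ⟨i, _, rfl⟩)
      exacts [huS, heS i]
    have hnc : (insert u (e '' {i | i ≠ i1})).ncard ≤ d + 1 := by
      have h1 := Set.ncard_insert_le u (e '' {i | i ≠ i1})
      have h2 : (e '' {i | i ≠ i1}).ncard ≤ ({i | i ≠ i1} : Set ι).ncard := Set.ncard_image_le (Set.toFinite _)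
      have h3 : ({i | i ≠ i1} : Set ι).ncard = d := by
        have : ({i | i ≠ i1} : Set ι) = ((Finset.univ.erase i1 : Finset ι) : Set ι) := by ext; simp
        rw [this, Set.ncard_coe_finset, Finset.card_erase_of_mem (Finset.mem_univ _), Finset.card_univ, hc]
        omega
      omega
    have hk := HF_small (hS.mono hsubS) (hLu.mono hsub) hnc _ hat hover
    rw [k_add, k_replicate, EM_k h.ord, kk, hou] at hk
    field_simp at hk
    exact_mod_cast hk
  have hx1 : ∀ i, 1 ≤ x i := by
    by_contra hcon
    push Not at hcon
    obtain ⟨i1, hi1⟩ := hcon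
    have hi1 : x i1 = 0 := by omega
    have e1 := small g x i1 hgS hu (by rw [ho, hn]) hL1 hx hs hi1
    have e2 := small (-g) (fun i => if x i = 0 then 0 else n - x i) i1 hg' hu' ho' hL2
      (by intro i; (try dsimp only); split_ifs <;> omega)
      (by
        rw [← neg_rel h (fun i => (hx i).le) hs]
        congr 1
        apply Finset.sum_congr rfl
        intro i _
        split_ifs with h0
        · rw [h0, zero_smul, Nat.sub_zero, h.1 i]
        · rfl) (by simp [hi1])
    have e3 : ∑ i, x i + ∑ i, (if x i = 0 then 0 else n - x i) = n * ∑ i, (if x i = 0 then 0 else 1) := by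
      rw [← Finset.sum_add_distrib, Finset.mul_sum]
      apply Finset.sum_congr rfl
      intro i _
      have := hx i
      split_ifs <;> simp <;> omega
    have e4 : n ∣ 2 := by
      have h1 : 2 + n * ∑ i, (if x i = 0 then 0 else 1) = n * 2 := by omega
      exact (Nat.dvd_add_left (dvd_mul_right n _)).1 (h1 ▸ dvd_mul_right n 2)
    have := Nat.le_of_dvd (by omega) e4
    omega
  have hX1 := lemX hd hn hS h hc heS hgS hg' hu hu' (by rw [ho, hn]) hL1 hx1 hx hs
  have hX2 := lemX hd hn hS h hc heS hg' (by rwa [neg_neg]) hu' (by rwa [neg_neg]) ho' hL2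
    (x := fun i => n - x i) (fun i => by have := hx i; (try dsimp only); omega)
    (fun i => by have := hx i; have := hx1 i; (try dsimp only); omega) (neg_rel h (fun i => (hx i).le) hs)
  rcases hX1 with h1 | ⟨h1, h1'⟩
  · exfalso
    have hat := atomY1 h hn2 hu hx hs
    have hle : Multiset.replicate 1 g + EM e x ≤ A := by
      rw [← EM_ext]
      have hinj := ext_inj (h.inj hn2) hu
      rw [Multiset.le_iff_count]
      intro z
      by_cases hz : z ∈ Set.range (ext g e)
      · obtain ⟨o, rfl⟩ := hz
        rw [EM_count hinj]
        cases o with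
        | none => exact Multiset.one_le_count_iff_mem.2 hg
        | some i =>
          show x i ≤ _
          rw [h1 i]
          exact Multiset.one_le_count_iff_mem.2 (heA i)
      · rw [Multiset.count_eq_zero_of_notMem]
        · exact Nat.zero_le _
        · intro hz'
          exact hz (EM_over (S := Set.range (ext g e)) (fun i => ⟨i, rfl⟩) _ z hz')
    rw [← hat.eq_of_le hA hle, k_add, k_replicate, EM_k h.ord, kk, ho] at hk
    simp only [h1] at hk
    simp [hc, hn] at hk
    have hdd : (d : ℚ) + 2 ≠ 0 := by positivity
    field_simp at hk
    linarith
  · have h2 : ∀ i, x i = n - 1 := by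
      rcases hX2 with h2 | ⟨h2, _⟩
      · intro i; have := h2 i; have := hx i; omega
      · exfalso
        have : Nontrivial ι := Fintype.one_lt_card_iff_nontrivial.1 (by omega)
        obtain ⟨i, j, hij⟩ := exists_pair_ne ι
        have a1 := h1 i; have a2 := h1 j
        have b1 := h2 i; have b2 := h2 j
        have := hx i; have := hx j
        exact hij (h1' i j (by omega) (by omega))
    have h3 : ∀ i, x i • e i = - e i := by
      intro i
      rw [h2 i, eq_neg_iff_add_eq_zero, ← succ_nsmul, Nat.sub_add_cancel (by omega), h.1 i]
    simp only [h3, Finset.sum_neg_distrib] at hs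
    exact add_neg_eq_zero.1 hs
end ZS


namespace ZS
variable {G : Type*} [AddCommGroup G] [Finite G]

lemma struct3 {ι : Type*} [Fintype ι] {d n : ℕ} (hd : 2 ≤ d) (hn : n = d + 2) (hc : Fintype.card ι = d + 1)
    {x : ι → ℕ} (hx : ∀ i, x i < n)
    (H1 : ∀ i0, d ∣ (Finset.univ.filter (fun j => x j < x i0)).card)
    (H2 : ∀ i0, 1 ≤ x i0 → (d : ℤ) ∣ ((n - x i0 : ℕ) : ℤ) - ((Finset.univ.filter (fun j => x i0 ≤ x j)).card : ℤ)) :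
    ∃ i1, ∃ m M, x i1 = M ∧ (∀ i, i ≠ i1 → x i = m) ∧ 
      ((m = 0 ∧ M = 0) ∨ (m = 1 ∧ M = 1) ∨ (m = n - 1 ∧ M = n - 1) ∨ (m = 0 ∧ M = 1) ∨ (m = 0 ∧ M = n - 1)
        ∨ (m = 1 ∧ M = n - 1)) := by
  have hval : ∀ i, x i = 0 ∨ x i = 1 ∨ x i = n - 1 := by
    intro i
    by_cases h0 : x i = 0
    · exact Or.inl h0
    right
    have h2 := H2 i (by omega)
    have h1 := H1 i
    have h3 := Finset.card_filter_add_card_filter_not (s := (Finset.univ : Finset ι)) (fun j => x j < x i)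
    simp only [not_lt, Finset.card_univ, hc] at h3
    set c := (Finset.univ.filter (fun j => x j < x i)).card
    set c' := (Finset.univ.filter (fun j => x i ≤ x j)).card
    have h4 : (d : ℤ) ∣ (c : ℤ) := by exact_mod_cast h1
    have h5 : (d : ℤ) ∣ (x i : ℤ) - 1 := by
      have := dvd_sub h4 h2
      have h6 : (c : ℤ) - (((n - x i : ℕ) : ℤ) - c') = x i - 1 := by
        have := hx i
        omega
      rwa [h6] at this
    by_cases h6 : x i = 1
    · exact Or.inl h6
    right
    have h7 : d ∣ x i - 1 := by
      have : ((x i - 1 : ℕ) : ℤ) = x i - 1 := by omega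
      rw [← this] at h5
      exact_mod_cast h5
    have h8 := Nat.le_of_dvd (by omega) h7
    have := hx i
    omega
  haveI : Nontrivial ι := Fintype.one_lt_card_iff_nontrivial.1 (by omega)
  obtain ⟨i0, hi0⟩ := Finite.exists_max x
  obtain ⟨i', hi'⟩ := exists_ne i0
  rcases Nat.eq_zero_or_pos (Finset.univ.filter (fun j => x j < x i0)).card with hz | hz
  · have hall : ∀ i, x i = x i0 := by
      intro i
      rw [Finset.card_eq_zero] at hz
      have : i ∉ Finset.univ.filter (fun j => x j < x i0) := by rw [hz]; simp
      simp at this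
      exact le_antisymm (hi0 i) this
    refine ⟨i0, x i0, x i0, rfl, fun i _ => hall i, ?_⟩
    rcases hval i0 with h | h | h <;> simp [h]
  · have h1 := Nat.le_of_dvd hz (H1 i0)
    have hsub : Finset.univ.filter (fun j => x j < x i0) ⊆ Finset.univ.erase i0 := by
      intro j hj
      simp only [Finset.mem_filter] at hj
      simp only [Finset.mem_erase, Finset.mem_univ, and_true]
      rintro rfl
      omega
    have heq := Finset.eq_of_subset_of_card_le hsub (by
      rw [Finset.card_erase_of_mem (Finset.mem_univ _), Finset.card_univ, hc]; omega)
    have hlt : ∀ i, i ≠ i0 → x i < x i0 := by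
      intro i hi
      have : i ∈ Finset.univ.erase i0 := by simp [hi]
      rw [← heq] at this
      exact (Finset.mem_filter.1 this).2
    have hnl : ∀ i j, i ≠ i0 → j ≠ i0 → ¬ x i < x j := by
      intro i j hi hj hij
      have h2 : i ∈ Finset.univ.filter (fun k => x k < x j) := by simp [hij]
      have h3 := Nat.le_of_dvd (Finset.card_pos.2 ⟨i, h2⟩) (H1 j)
      have hsub : Finset.univ.filter (fun k => x k < x j) ⊆ (Finset.univ.erase i0).erase j := by
        intro k hk
        simp only [Finset.mem_filter] at hk
        simp only [Finset.mem_erase, Finset.mem_univ, and_true]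
        have := hlt j hj
        constructor
        · rintro rfl; omega
        · rintro rfl; omega
      have := Finset.card_le_card hsub
      rw [Finset.card_erase_of_mem (by simp [hj]), Finset.card_erase_of_mem (Finset.mem_univ _), Finset.card_univ, hc] at this
      omega
    refine ⟨i0, x i', x i0, rfl, ?_, ?_⟩
    · intro i hi
      have a1 := hnl i i' hi hi'
      have a2 := hnl i' i hi' hi
      omega
    · have := hlt i' hi'
      rcases hval i0 with h | h | h <;> rcases hval i' with h' | h' | h' <;> simp [h, h'] <;> omega

section
variable {ι : Type*} [Fintype ι] {e : ι → G} {n d : ℕ}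

lemma sum_gen (h : Ind n e) {g : G} (hg : g = ∑ i, e i) : g + ∑ i, (n - 1) • e i = 0 ∨ n = 0 := by
  by_cases hn : n = 0
  · exact Or.inr hn
  left
  rw [hg, ← Finset.sum_add_distrib]
  apply Finset.sum_eq_zero
  intro i _
  rw [← succ_nsmul', Nat.sub_add_cancel (by omega), h.1 i]

lemma part3 (hd : 2 ≤ d) (hn : n = d + 2) (h : Ind n e) (hc : Fintype.card ι = d + 1) {S : Set G} (hS : DSet d S)
    (heS : ∀ i, e i ∈ S) {g : G} (hg : g = ∑ i, e i) (hgS : g ∈ S) (hgS' : -g ∈ S)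
    (hgr : g ∉ Set.range e) (hgr' : -g ∉ Set.range e)
    {u : G} (huS : u ∈ S) (hug : u ≠ g) (hug' : u ≠ -g) (hur : u ∉ Set.range e)
    {x : ι → ℕ} (hx : ∀ i, x i < n) (hs : u + ∑ i, x i • e i = 0) :
    ∃ i1, ∃ m M, x i1 = M ∧ (∀ i, i ≠ i1 → x i = m) ∧ 
      ((m = 0 ∧ M = 0) ∨ (m = 1 ∧ M = 1) ∨ (m = n - 1 ∧ M = n - 1) ∨ (m = 0 ∧ M = 1) ∨ (m = 0 ∧ M = n - 1)
        ∨ (m = 1 ∧ M = n - 1)) := by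
  have hn2 : 2 ≤ n := by omega
  have hg1 : g + ∑ i, (n - 1) • e i = 0 := (sum_gen h hg).resolve_right (by omega)
  have hg2 : -g + ∑ i, 1 • e i = 0 := by simp [hg]
  -- generic transfer
  have gen : ∀ (v : G) (c : ℕ) (t : ℕ) (y w : ι → ℕ) (i0 : ι), v ∈ S → v ∉ Set.range e → u ≠ v → c < n →
      v + ∑ i, c • e i = 0 → (∀ i, x i + t * c = y i + n * w i) → (∀ i, y i < n) → t < n → y i0 = 0 → 
      (∀ s : ℕ, 0 < s → s < n → ¬ (n : ℤ) ∣ s * c) →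
      (d : ℤ) ∣ ((1 + t : ℕ) : ℤ) - ((1 + ∑ i, w i : ℕ) : ℤ) := by
    intro v c t y w i0 hvS hvr huv hcn hv hyw hy htn hy0 hcop
    have hA0 := atomY1 h hn2 hur hx hs
    have hA1 := atomY1 h hn2 hvr (x := fun _ => c) (fun _ => hcn) hv
    have heq : (Multiset.replicate 1 u + EM e x) + t • (Multiset.replicate 1 v + EM e (fun _ => c)) =
        ({u} + (Multiset.replicate t v + EM e y)) + EM e (fun i => n * w i) := by
      have e1 : EM e x + t • EM e (fun _ => c) = EM e y + EM e (fun i => n * w i) := by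
        rw [← EM_nsmul, ← EM_add, ← EM_add]
        congr 1
        funext i; exact hyw i
      rw [smul_add, Multiset.nsmul_replicate, mul_one, Multiset.replicate_one, add_add_add_comm, e1]
      abel
    have hA2 : Atom ({u} + (Multiset.replicate t v + EM e y)) := by
      apply atom2 h hn2 hvr hur huv hy
      · have h1 := congrArg Multiset.sum heq
        rw [Multiset.sum_add, Multiset.sum_nsmul, hA0.2.1, hA1.2.1, smul_zero, zero_add, Multiset.sum_add,
          Multiset.sum_add, Multiset.sum_add, EM_sum, EM_sum, Multiset.sum_replicate, Multiset.sum_singleton] at h1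
        have h2 : ∑ i, (n * w i) • e i = 0 := by
          apply Finset.sum_eq_zero
          intro i _
          rw [mul_comm, mul_smul, h.1 i, smul_zero]
        rw [h2, add_zero] at h1
        exact h1.symm
      · intro s hst z hz hsum
        have h1 := rel_dvd h hv hsum i0
        have h2 := hz i0
        have h3 : z i0 = 0 := by omega
        rw [h3] at h1
        by_contra hs0
        apply hcop s (by omega) (by omega)
        have h4 := (dvd_neg (α := ℤ)).2 h1
        simpa using h4
    apply hS ((Multiset.replicate 1 u + EM e x) + t • (Multiset.replicate 1 v + EM e (fun _ => c)))
    · exact ((Over.replicate huS _).add (EM_over heS _)).add (Over.nsmul ((Over.replicate hvS _).add (EM_over heS _)) _)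
    · have := hA0.hasLen.add (HasLen.nsmul hA1.hasLen t)
      simpa using this
    · rw [heq]
      exact hA2.hasLen.add (EM_len h.ord w)
  apply struct3 hd hn hc hx
  · intro i0
    have h1 := gen g (n - 1) (x i0) (fun i => if x i < x i0 then x i + n - x i0 else x i - x i0)
      (fun i => if x i < x i0 then x i0 - 1 else x i0) i0 hgS hgr hug (by omega) hg1
      (by
        intro i
        have h1 : x i0 * (n - 1) + x i0 = n * x i0 := by
          rw [← Nat.mul_succ, Nat.succ_eq_add_one, Nat.sub_add_cancel (by omega), mul_comm]
        (try dsimp only)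
        split_ifs with hif
        · have h2 : n * (x i0 - 1) + n = n * x i0 := by
            rw [← Nat.mul_succ, Nat.succ_eq_add_one, Nat.sub_add_cancel (by omega)]
          have := hx i0
          omega
        · omega)
      (by intro i; have := hx i; (try dsimp only); split_ifs <;> omega) (hx i0) (by simp)
      (by
        intro s hs0 hsn hdv
        have h2 : (n : ℤ) ∣ s := by
          have h3 : ((n - 1 : ℕ) : ℤ) = n - 1 := by omega
          rw [h3] at hdv
          have := dvd_sub (dvd_mul_left (n : ℤ) s) hdv
          have h4 : (s : ℤ) * n - s * (n - 1) = s := by ring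
          rwa [h4] at this
        exact not_dvd_of_pos (by omega) (by omega) h2)
    set b' := (Finset.univ.filter (fun j => x j < x i0)).card with hb'
    have hsumw : (∑ i, if x i < x i0 then x i0 - 1 else x i0) + b' = (d + 1) * x i0 := by
      have h1 : b' = ∑ i, if x i < x i0 then 1 else 0 := by rw [Finset.sum_boole]; simp [hb']
      rw [h1, ← Finset.sum_add_distrib]
      rw [Finset.sum_congr rfl (g := fun _ => x i0)]
      · simp [hc]
      · intro i _
        split_ifs <;> omega
    obtain ⟨Wn, hWn⟩ : ∃ Wn, Wn = ∑ i, if x i < x i0 then x i0 - 1 else x i0 := ⟨_, rfl⟩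
    rw [← hWn] at hsumw h1
    have h2 : (d : ℤ) ∣ b' := by
      have h3 : ((1 + x i0 : ℕ) : ℤ) - ((1 + Wn : ℕ) : ℤ) = b' - d * x i0 := by
        zify at hsumw
        push_cast
        linarith
      rw [h3] at h1
      have := dvd_add h1 (dvd_mul_right (d : ℤ) (x i0))
      simpa using this
    exact_mod_cast h2
  · intro i0 hi0
    have h1 := gen (-g) 1 (n - x i0) (fun i => if x i0 ≤ x i then x i - x i0 else x i + n - x i0)
      (fun i => if x i0 ≤ x i then 1 else 0) i0 hgS' hgr' hug' (by omega) hg2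
      (by
        intro i
        have := hx i0
        (try dsimp only)
        split_ifs with hif <;> omega)
      (by intro i; have := hx i; (try dsimp only); split_ifs <;> omega) (by omega) (by simp)
      (by
        intro s hs0 hsn hdv
        rw [Nat.cast_one, mul_one] at hdv
        exact not_dvd_of_pos (by omega) (by omega) hdv)
    rw [Finset.sum_boole] at h1
    have h2 : ((1 + (n - x i0) : ℕ) : ℤ) - ((1 + (Finset.univ.filter (fun j => x i0 ≤ x j)).card : ℕ) : ℤ) = 
       ((n - x i0 : ℕ) : ℤ) - ((Finset.univ.filter (fun j => x i0 ≤ x j)).card : ℤ) := by push_cast; ring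
    rw [← h2]
    exact_mod_cast h1
end
end ZS


namespace ZS
variable {G : Type*} [AddCommGroup G] [Finite G]
section
variable {ι : Type*} [Fintype ι] {e : ι → G} {n d : ℕ}

lemma neg_notMem_range (h : Ind n e) (hn : 3 ≤ n) (i : ι) : - e i ∉ Set.range e := by
  rintro ⟨j, hj⟩
  have h1 := h.nat (v := fun l => (if l = i then 1 else 0) + (if l = j then 1 else 0)) (by
    simp only [add_smul, Finset.sum_add_distrib, ite_smul, one_smul, zero_smul, Finset.sum_ite_eq',
      Finset.mem_univ, if_true]
    rw [hj]; simp) i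
  simp only [if_true] at h1
  have := Nat.le_of_dvd (by omega) h1
  split_ifs at this <;> omega

lemma neg_ne_sum (h : Ind n e) (hn : 3 ≤ n) (i : ι) : - e i ≠ ∑ j, e j := by
  intro hj
  have h1 := h.nat (v := fun l => (if l = i then 1 else 0) + 1) (by
    simp only [add_smul, Finset.sum_add_distrib, ite_smul, one_smul, zero_smul, Finset.sum_ite_eq',
      Finset.mem_univ, if_true]
    rw [← hj]; simp) i
  simp only [if_true] at h1
  have := Nat.le_of_dvd (by omega) h1
  omega

lemma excl_b (hd : 2 ≤ d) (hn : n = d + 2) (he : Expo G n) (h : Ind n e) (hc : Fintype.card ι = d + 1) {S : Set G} (hS : DSet d S)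
    (heS : ∀ i, e i ∈ S) {g : G} (hg : g = ∑ i, e i) (hgS' : -g ∈ S) (ho : addOrderOf g = n)
    (hgr' : -g ∉ Set.range e)
    {u : G} (huS : u ∈ S) (hug' : u ≠ -g) (hur : u ∉ Set.range e) (i1 : ι) (hu : u + g = 2 • e i1) : False := by
  have hn2 : 2 ≤ n := by omega
  have hg2 : -g + ∑ i, 1 • e i = 0 := by simp [hg]
  set x : ι → ℕ := fun i => if i = i1 then n - 2 else 0 with hxdef
  have hxs : ∑ i, x i • e i = (n - 2) • e i1 := by simp [hxdef, ite_smul]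
  haveI : Nontrivial ι := Fintype.one_lt_card_iff_nontrivial.1 (by omega)
  obtain ⟨i', hi'⟩ := exists_ne i1
  have hA : Atom ({u} + (Multiset.replicate (n - 1) (-g) + EM e x)) := by
    apply atom2 h hn2 hgr' hur hug'
    · intro i; simp only [hxdef]; split_ifs <;> omega
    · rw [hxs]
      have h1 : (n - 1) • (-g) = g := by
        have h2 : (n - 1) • g + g = 0 := by rw [← succ_nsmul, Nat.sub_add_cancel (by omega)]; exact he.2 g
        rw [smul_neg]; exact neg_eq_of_add_eq_zero_right h2
      rw [h1, ← add_assoc, hu, ← add_smul, show 2 + (n - 2) = n by omega]; exact he.2 _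
    · intro s hs y hy hsum
      have h1 := rel_dvd h hg2 hsum i'
      have h2 := hy i'
      simp only [hxdef, if_neg hi'] at h2
      have h3 : y i' = 0 := by omega
      rw [h3] at h1
      by_contra h0
      have h4 := (dvd_neg (α := ℤ)).2 h1
      simp at h4
      exact not_dvd_of_pos (by omega) (by omega) h4
  set U := ({u} + (Multiset.replicate (n - 1) (-g) + EM e x)) with hU
  have hUo : Over S U := by
    refine Over.add ?_ ((Over.replicate hgS' _).add (EM_over heS _))
    intro z hz
    rw [Multiset.mem_singleton.1 hz]; exact huS
  have hUo3 : Over ({u, -g, e i1} : Set G) U := by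
    refine Over.add ?_ ((Over.replicate (by simp) _).add (EM_over' ?_))
    · intro z hz
      rw [Multiset.mem_singleton.1 hz]; simp
    · intro i hi
      simp only [hxdef] at hi
      have : i = i1 := by by_contra h; simp [h] at hi
      simp [this]
  have hnp : NP d U := by
    intro z hz
    exfalso
    have h1 := congrArg Multiset.card hz
    rw [hU] at h1
    simp only [Multiset.card_add, Multiset.card_singleton, Multiset.card_replicate, Multiset.card_pair] at h1
    omega
  have hL : LCN (supp U) := nonpair_LCN (by omega) hS he hn.le hA hUo hnp
  have hk : 1 < k U := by
    have hn0 : (0 : ℚ) < n := by positivity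
    have hn4 : (4 : ℚ) ≤ n := by exact_mod_cast (by omega : 4 ≤ n)
    rw [hU, k_add, k_singleton, k_add, k_replicate, EM_k h.ord, kk, kk, addOrderOf_neg, ho]
    have h1 : ∑ i, x i = n - 2 := by simp [hxdef]
    rw [h1, Nat.cast_sub (by omega), Nat.cast_sub (by omega)]
    have h2 : (0 : ℚ) ≤ 1 / (addOrderOf u : ℚ) := by positivity
    have h3 : (1 : ℚ) < ((n : ℚ) - (1 : ℕ)) * (1 / n) + (n - (2 : ℕ)) / n := by
      push_cast
      rw [mul_one_div, ← add_div, lt_div_iff₀ hn0]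
      linarith
    linarith
  have h1 := HF_small_atom (hS.mono (fun x hx => hUo x hx)) hL hA (over_supp U) hk
  have h2 := toFinset_card_le hUo3
  have h3 : ({u, -g, e i1} : Set G).ncard ≤ 3 := by
    refine (Set.ncard_insert_le _ _).trans ?_
    have := Set.ncard_insert_le (-g) ({e i1} : Set G)
    rw [Set.ncard_singleton] at this
    omega
  omega

lemma excl_f (hd : 2 ≤ d) (hn : n = d + 2) (h : Ind n e) (hc : Fintype.card ι = d + 1) {S : Set G} (hS : DSet d S)
    (heS : ∀ i, e i ∈ S) {g : G} (hg : g = ∑ i, e i) (hgS : g ∈ S) (hgr : g ∉ Set.range e)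
    (i1 : ι) (hf : - e i1 ∈ S) : False := by
  have hn2 : 2 ≤ n := by omega
  have hg1 : g + ∑ i, (n - 1) • e i = 0 := (sum_gen h hg).resolve_right (by omega)
  have hW := atomY1 h hn2 hgr (x := fun _ => n - 1) (fun _ => by omega) hg1
  have hfr : - e i1 ∉ Set.range e := neg_notMem_range h (by omega) i1
  have hfg : - e i1 ≠ g := by rw [hg]; exact neg_ne_sum h (by omega) i1
  haveI : Nontrivial ι := Fintype.one_lt_card_iff_nontrivial.1 (by omega)
  obtain ⟨i', hi'⟩ := exists_ne i1
  set x : ι → ℕ := fun i => if i = i1 then 0 else n - 2 with hxdef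
  set w : ι → ℕ := fun i => if i = i1 then 2 else 1 with hwdef
  set B := Multiset.replicate 2 (- e i1) + (Multiset.replicate 2 g + EM e x) with hBdef
  have hxw : ∀ i, x i + n * w i = 2 * (n - 1) + (if i = i1 then 2 else 0) := by
    intro i
    simp only [hxdef, hwdef]
    split_ifs <;> omega
  have he1 : EM e (fun i => if i = i1 then 2 else 0) = Multiset.replicate 2 (e i1) := by
    unfold EM
    rw [Finset.sum_eq_single i1]
    · simp
    · intro j _ hj; simp [hj]
    · simp
  have heq : B + EM e (fun i => n * w i) = 2 • (Multiset.replicate 1 g + EM e (fun _ => n - 1)) +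
      2 • ({e i1, - e i1} : Multiset G) := by
    have e1 : EM e x + EM e (fun i => n * w i) = 2 • EM e (fun _ => n - 1) + Multiset.replicate 2 (e i1) := by
      rw [← he1, ← EM_nsmul, ← EM_add, ← EM_add]
      congr 1
      funext i; exact hxw i
    rw [hBdef, add_assoc, add_assoc, e1, pair_nsmul, smul_add, Multiset.nsmul_replicate, mul_one]
    abel
  have hp : Atom ({e i1, - e i1} : Multiset G) := by
    apply atom_pair
    intro h0
    have := h.ord i1
    rw [h0, addOrderOf_zero] at this
    omega
  have hBs : B.sum = 0 := by
    have h1 := congrArg Multiset.sum heq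
    rw [Multiset.sum_add B, Multiset.sum_add (2 • _), Multiset.sum_nsmul, Multiset.sum_nsmul, hW.2.1, hp.2.1, smul_zero,
      add_zero, EM_sum] at h1
    have h2 : ∑ i, (n * w i) • e i = 0 := by
      apply Finset.sum_eq_zero
      intro i _
      rw [mul_comm, mul_smul, h.1 i, smul_zero]
    rwa [h2, add_zero] at h1
  have hBat : Atom B := by
    have hrew : B = EM (ext (- e i1) (ext g e)) (ext 2 (ext 2 x)) := by
      rw [EM_ext, EM_ext]
    have hinj := ext_inj (ext_inj (h.inj hn2) hgr) (u := - e i1) (by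
      rintro ⟨o, ho⟩
      cases o
      · exact hfg ho.symm
      · exact hfr ⟨_, ho⟩)
    rw [hrew] at hBs ⊢
    rw [EM_sum] at hBs
    apply atom_EM hinj (i0 := none) (by show (2 : ℕ) ≠ 0; omega) hBs
    intro y hy hys
    have hy1 : y none ≤ 2 := hy none
    have hy0 : y (some none) ≤ 2 := hy (some none)
    have hyi : ∀ i, y (some (some i)) ≤ x i := fun i => hy (some (some i))
    rw [Fintype.sum_option, Fintype.sum_option] at hys
    change y none • (- e i1) + (y (some none) • g + ∑ i, y (some (some i)) • e i) = 0 at hys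
    have hz := h.int (z := fun i => (y (some (some i)) : ℤ) + y (some none) - if i = i1 then (y none : ℤ) else 0) (by
      simp only [add_smul, sub_smul, Finset.sum_add_distrib, Finset.sum_sub_distrib, ite_smul, zero_smul,
        Finset.sum_ite_eq', Finset.mem_univ, if_true, natCast_zsmul]
      rw [← Finset.smul_sum, ← hg, ← hys, smul_neg]
      abel)
    have h1 := hz i1
    have hy1' := hyi i1
    simp only [hxdef, if_true] at h1 hy1'
    have hst : y (some none) = y none := by
      by_contra hne
      have h2 := Int.eq_zero_of_abs_lt_dvd h1 (by rw [abs_lt]; omega)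
      omega
    have hoth : ∀ i, i ≠ i1 → (y (some none) = 0 ∧ y (some (some i)) = 0) ∨ (y (some none) = 2 ∧ y (some (some i)) = n - 2) := by
      intro i hi
      have h2 := hz i
      have h3 := hyi i
      simp only [hxdef, if_neg hi, sub_zero] at h2 h3
      by_cases h4 : y (some (some i)) + y (some none) = 0
      · left; omega
      · right
        have h5 : n ∣ y (some (some i)) + y (some none) := by exact_mod_cast h2
        have := Nat.le_of_dvd (by omega) h5
        omega
    rcases hoth i' hi' with h2 | h2
    · left
      intro o
      cases o with
      | none => omega
      | some o =>
        cases o with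
        | none => exact h2.1
        | some i =>
          by_cases hi : i = i1
          · subst hi; omega
          · rcases hoth i hi with h3 | h3 <;> omega
    · right
      intro o
      cases o with
      | none => show y none = 2; omega
      | some o =>
        cases o with
        | none => exact h2.1
        | some i =>
          show y (some (some i)) = x i
          by_cases hi : i = i1
          · subst hi; simp only [hxdef, if_true]; omega
          · simp only [hxdef, if_neg hi]
            rcases hoth i hi with h3 | h3 <;> omega
  have hBo : Over S B := (Over.replicate hf _).add ((Over.replicate hgS _).add (EM_over heS _))
  have hdv := hS _ (hBo.add (EM_over heS _)) _ _ (hBat.hasLen.add (EM_len h.ord w)) (by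
    rw [heq]
    exact (HasLen.nsmul hW.hasLen 2).add (HasLen.nsmul hp.hasLen 2))
  have hws : ∑ i, w i = d + 2 := by
    have : ∑ i, w i = ∑ i, (1 + if i = i1 then 1 else 0) := by
      apply Finset.sum_congr rfl
      intro i _
      simp only [hwdef]; split_ifs <;> rfl
    rw [this, Finset.sum_add_distrib]
    simp [hc]
  rw [hws] at hdv
  have h2 : (d : ℤ) ∣ (d : ℤ) - 1 := by
    convert hdv using 1
    push_cast; ring
  have h3 := Int.le_of_dvd (by omega) h2
  omega

lemma S_sub (hd : 2 ≤ d) (hn : n = d + 2) (he : Expo G n) (h : Ind n e) (hc : Fintype.card ι = d + 1) {S : Set G} (hS : DSet d S)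
    (heS : ∀ i, e i ∈ S) {g : G} (hg : g = ∑ i, e i) (hgS : g ∈ S) (hgS' : -g ∈ S) (ho : addOrderOf g = n)
    (hgr : g ∉ Set.range e) (hgr' : -g ∉ Set.range e)
    (hspan : ∀ u : G, ∃ x : ι → ℕ, (∀ i, x i < n) ∧ u + ∑ i, x i • e i = 0) {u : G} (huS : u ∈ S) :
    u = 0 ∨ u = g ∨ u = -g ∨ u ∈ Set.range e := by
  by_contra hcon
  push Not at hcon
  obtain ⟨hu0, hug, hug', hur⟩ := hcon
  obtain ⟨x, hx, hs⟩ := hspan u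
  obtain ⟨i1, m, M, hM, hm, hcase⟩ := part3 hd hn h hc hS heS hg hgS hgS' hgr hgr' huS hug hug' hur hx hs
  have hsum : ∑ i, x i • e i + m • e i1 = m • g + M • e i1 := by
    have h1 : ∀ i, x i • e i + (if i = i1 then m • e i else 0) = m • e i + (if i = i1 then M • e i else 0) := by
      intro i
      by_cases hi : i = i1
      · subst hi; simp [hM]; abel
      · simp [hi, hm i hi]
    have h2 := Finset.sum_congr (rfl : (Finset.univ : Finset ι) = Finset.univ) (fun i _ => h1 i)
    rw [Finset.sum_add_distrib, Finset.sum_add_distrib] at h2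
    simp only [Finset.sum_ite_eq', Finset.mem_univ, if_true] at h2
    rw [hg, Finset.smul_sum]; exact h2
  have hxs : ∑ i, x i • e i = -u := eq_neg_of_add_eq_zero_right hs
  rw [hxs] at hsum
  have hn1 : ∀ z : G, (n - 1) • z = -z := by
    intro x
    rw [eq_neg_iff_add_eq_zero, ← succ_nsmul, Nat.sub_add_cancel (by omega)]
    exact he.2 x
  rcases hcase with ⟨rfl, h2⟩ | ⟨rfl, h2⟩ | ⟨rfl, h2⟩ | ⟨rfl, h2⟩ | ⟨rfl, h2⟩ | ⟨rfl, h2⟩ <;> rw [h2] at hsum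
  · simp at hsum; exact hu0 hsum
  · simp at hsum; exact hug' (by rw [← hsum, neg_neg])
  · simp only [hn1] at hsum
    exact hug (neg_inj.1 (add_right_cancel hsum))
  · simp at hsum
    have : u = - e i1 := by rw [← hsum, neg_neg]
    exact excl_f hd hn h hc hS heS hg hgS hgr i1 (this ▸ huS)
  · simp [hn1] at hsum
    exact hur ⟨i1, hsum.symm⟩
  · simp only [hn1, one_smul] at hsum
    apply excl_b hd hn he h hc hS heS hg hgS' ho hgr' huS hug' hur i1
    have h3 : e i1 + e i1 = u + g := by
      calc e i1 + e i1 = (-u + e i1) + u + e i1 := by abel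
        _ = u + g := by rw [hsum]; abel
    rw [two_smul, h3]
end
end ZS


namespace ZS
variable {G : Type*} [AddCommGroup G] [Finite G]

lemma wt_two (g a : G) (c1 c2 : ℚ) (A : Multiset G) :
    wt (fun h => kk h + ((if h = g then c1 else 0) + if h = a then c2 else 0)) A =
      k A + (A.count g * c1 + A.count a * c2) := by
  induction A using Multiset.induction_on with
  | empty => simp [wt, k]
  | cons x A ih =>
    rw [wt_cons, ih, k_cons, Multiset.count_cons, Multiset.count_cons]
    push_cast
    by_cases h1 : x = g <;> by_cases h2 : x = a
    · subst h1; subst h2; simp; ring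
    · subst h1; simp [h2, Ne.symm h2]; ring
    · subst h2; simp [h1, Ne.symm h1]; ring
    · simp [h1, h2, Ne.symm h1, Ne.symm h2]; ring

lemma part4 {ι : Type*} [Fintype ι] {e : ι → G} {n d : ℕ} (hd : 2 ≤ d) (hn : n = d + 2) (he : Expo G n)
    (hRK : RK G d n) (hk4 : ∀ U : Multiset G, Atom U → k U < (d + 1 : ℕ))
    (h : Ind n e) (hc : Fintype.card ι = d + 1) {S : Set G} (hS : DSet d S)
    (heS : ∀ i, e i ∈ S) {g : G} (hg : g = ∑ i, e i) (hgS : g ∈ S) (hgS' : -g ∈ S) (ho : addOrderOf g = n)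
    (hgr : g ∉ Set.range e) (hgr' : -g ∉ Set.range e)
    (hspan : ∀ u : G, ∃ x : ι → ℕ, (∀ i, x i < n) ∧ u + ∑ i, x i • e i = 0) :
    ∃ w : G → ℚ, ∀ A, Atom A → Over S A → 1 ≤ wt w A ∧ wt w A ≤ 1 + d * (1 - 1 / (n : ℚ) ^ 2) := by
  have hn2 : 2 ≤ n := by omega
  have hn0 : (0 : ℚ) < n := by positivity
  have hd0 : (0 : ℚ) < d := by positivity
  have hnd : (n : ℚ) = d + 2 := by exact_mod_cast hn
  have hn1 : (1 : ℚ) ≤ n := by linarith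
  have hga : -g ≠ g := ord_gt_two_ne_neg (by omega)
  have hg2 : -g + ∑ i, 1 • e i = 0 := by simp [hg]
  refine ⟨fun h => kk h + ((if h = g then (d : ℚ) / n ^ 2 else 0) + if h = -g then ((1 - 1 / (n : ℚ)) * d / n : ℚ) else 0), ?_⟩
  intro A hA hAo
  rw [wt_two]
  have hSs : ∀ u ∈ A, u = 0 ∨ u = g ∨ u = -g ∨ u ∈ Set.range e := fun u hu =>
    S_sub hd hn he h hc hS heS hg hgS hgS' ho hgr hgr' hspan (hAo u hu)
  by_cases haA : -g ∈ A
  · by_cases hgA : g ∈ A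
    · -- the pair
      have hAp : ({g, -g} : Multiset G) = A := (atom_pair (by rintro rfl; simp at ho; omega)).eq_of_le hA (pair_le hgA haA hga)
      rw [← hAp]
      have : ({g, -g} : Multiset G) = g ::ₘ {-g} := rfl
      rw [this, k_cons, k_singleton, kk, kk, addOrderOf_neg, ho]
      rw [Multiset.count_cons_self, Multiset.count_cons_of_ne hga, Multiset.count_singleton_self,
        Multiset.count_singleton, if_neg hga.symm]
      have h1 : 1 / (n : ℚ) + 1 / n + (((0 + 1 : ℕ) : ℚ) * (d / n ^ 2) + ((1 : ℕ) : ℚ) * ((1 - 1 / n) * d / n)) = 1 := by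
        rw [hnd]
        have : (d : ℚ) + 2 ≠ 0 := by positivity
        push_cast
        field_simp
        ring
      rw [h1]
      refine ⟨le_refl _, ?_⟩
      have : 1 / (n : ℚ) ^ 2 ≤ 1 := by rw [div_le_one (by positivity)]; nlinarith
      have : 0 ≤ (d : ℚ) * (1 - 1 / n ^ 2) := by apply mul_nonneg hd0.le; linarith
      linarith
    · have h0A : (0 : G) ∉ A := by
        intro h0
        have : ({0} : Multiset G) = A := Atom.eq_of_le' (by simp) (by simp) hA (by simpa using h0)
        rw [← this, Multiset.mem_singleton, neg_eq_zero] at haA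
        rw [haA] at ho; simp at ho; omega
      have hg0 : A.count g = 0 := Multiset.count_eq_zero_of_notMem hgA
      by_cases hcnt : A.count (-g) = n
      · have hle : Multiset.replicate n (-g) ≤ A := Multiset.le_count_iff_replicate_le.1 hcnt.ge
        have hAr : Multiset.replicate n (-g) = A := by
          have h1 := atom_ord (-g)
          rw [addOrderOf_neg, ho] at h1
          exact h1.eq_of_le hA hle
        rw [hg0, hcnt, ← hAr, k_replicate, kk, addOrderOf_neg, ho]
        have h1 : (n : ℚ) * (1 / n) + (((0 : ℕ) : ℚ) * (d / n ^ 2) + n * ((1 - 1 / n) * d / n)) = 1 + d * (1 - 1 / n) := by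
          push_cast
          field_simp
          ring
        rw [h1]
        have h2 : 1 / (n : ℚ) ≤ 1 := by rw [div_le_one hn0]; exact hn1
        have h3 : 1 / (n : ℚ) ^ 2 ≤ 1 / n := by
          apply one_div_le_one_div_of_le hn0; nlinarith
        constructor
        · nlinarith
        · nlinarith
      · have hle' : A.count (-g) ≤ n := by
          have := hA.count_le (-g)
          rwa [addOrderOf_neg, ho] at this
        have hc1 : 1 ≤ A.count (-g) := Multiset.one_le_count_iff_mem.2 haA
        have hrep := over_repr_opt (-g) e (h.inj hn2) (fun i hi => hgr' ⟨i, hi⟩) (T := A) (by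
          intro u hu
          rcases hSs u hu with rfl | rfl | rfl | h1
          · exact absurd hu h0A
          · exact absurd hu hgA
          · exact Or.inl rfl
          · exact Or.inr h1)
        have hsum0 : A.count (-g) • (-g) + ∑ i, A.count (e i) • e i = 0 := by
          have h1 := congrArg Multiset.sum hrep
          rw [hA.2.1, Multiset.sum_add, Multiset.sum_replicate, sum_replicate_repr] at h1
          exact h1.symm
        have hei : ∀ i, 1 ≤ A.count (e i) := by
          intro i
          by_contra hcon
          have h1 := rel_dvd h hg2 hsum0 i
          have h2 : A.count (e i) = 0 := by omega
          rw [h2] at h1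
          have h4 := (dvd_neg (α := ℤ)).2 h1
          simp at h4
          exact not_dvd_of_pos (by omega) (by omega) h4
        have hat := atomY1 h hn2 hgr' (x := fun _ => 1) (fun _ => by omega) hg2
        have hle : Multiset.replicate 1 (-g) + EM e (fun _ => 1) ≤ A := by
          rw [hrep]
          apply add_le_add
          · exact (Multiset.replicate_le_replicate _).2 hc1
          · unfold EM
            exact Finset.sum_le_sum fun i _ => (Multiset.replicate_le_replicate _).2 (hei i)
        have hAeq := hat.eq_of_le hA hle
        have hkA : k A = 1 := by
          rw [← hAeq, k_add, k_replicate, EM_k h.ord, kk, addOrderOf_neg, ho]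
          simp [hc]
          rw [hnd]
          have : (d : ℚ) + 2 ≠ 0 := by positivity
          field_simp
          ring
        have hcA : A.count (-g) = 1 := by
          rw [← hAeq, Multiset.count_add, Multiset.count_replicate_self, Multiset.count_eq_zero_of_notMem]
          intro hmem
          exact hgr' (EM_over (S := Set.range e) (fun i => ⟨i, rfl⟩) _ _ hmem)
        rw [hkA, hg0, hcA]
        have h2 : 1 / (n : ℚ) ≤ 1 := by rw [div_le_one hn0]; exact hn1
        have h5 : 0 ≤ 1 / (n : ℚ) := by positivity
        have h3 : 1 / (n : ℚ) ^ 2 ≤ 1 / n := by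
          apply one_div_le_one_div_of_le hn0; nlinarith
        have h4 : (1 - 1 / (n : ℚ)) * d / n = d * (1 - 1 / n) * (1 / n) := by ring
        rw [h4]
        push_cast
        have h6 : 0 ≤ (d : ℚ) * (1 - 1 / n) := mul_nonneg hd0.le (by linarith)
        constructor
        · have := mul_nonneg h6 h5; linarith
        · have : (d : ℚ) * (1 - 1 / n) * (1 / n) ≤ d * (1 - 1 / n) * 1 := mul_le_mul_of_nonneg_left h2 h6
          have : (d : ℚ) * (1 - 1 / n) ≤ d * (1 - 1 / n ^ 2) := mul_le_mul_of_nonneg_left (by linarith) hd0.le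
          linarith
  · have ha0 : A.count (-g) = 0 := Multiset.count_eq_zero_of_notMem haA
    have hnp : NP d A := by
      rintro u rfl hou
      have h1 := hSs u (by simp)
      have h2 := hSs (-u) (by simp)
      rcases h1 with rfl | rfl | rfl | ⟨i, rfl⟩
      · simp at hou
      · simp at haA
      · simp at haA
      · exact excl_f hd hn h hc hS heS hg hgS hgr i (hAo _ (by simp))
    have hk1 : 1 ≤ k A := nonpair_LCN (by omega) hS he hn.le hA hAo hnp A hA (over_supp A)
    have hk2 := k_bound (by omega) he hn.le hRK (by omega) hS hA hAo hnp (by exact_mod_cast hk4 A hA)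
    have hk3 : k A ≤ 1 + d * (1 - 1 / n) := by
      have h1 : (k A - 1) ≤ d * (n - 1) / n := by rw [le_div_iff₀ hn0]; linarith
      have h2 : (d : ℚ) * (n - 1) / n = d * (1 - 1 / n) := by field_simp
      linarith
    rw [ha0]
    have hp : (0 : ℚ) ≤ A.count g * (d / n ^ 2) := by positivity
    refine ⟨by push_cast; linarith, ?_⟩
    by_cases hcnt : A.count g = n
    · have hle : Multiset.replicate n g ≤ A := Multiset.le_count_iff_replicate_le.1 hcnt.ge
      have hAr : Multiset.replicate n g = A := by
        have h1 := atom_ord g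
        rw [ho] at h1
        exact h1.eq_of_le hA hle
      rw [hcnt, ← hAr, k_replicate, kk, ho]
      have h1 : (n : ℚ) * (1 / n) + ((n : ℚ) * (d / n ^ 2) + ((0 : ℕ) : ℚ) * ((1 - 1 / n) * d / n)) = 1 + d * (1 / n) := by
        push_cast
        field_simp
        ring
      rw [h1]
      have h3 : 1 / (n : ℚ) ^ 2 ≤ 1 / n := by
        apply one_div_le_one_div_of_le hn0; nlinarith
      have h4 : 1 / (n : ℚ) ≤ 1 / 2 := by
        apply one_div_le_one_div_of_le (by norm_num); linarith
      nlinarith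
    · have hle' : A.count g ≤ n := by
        have := hA.count_le g
        rwa [ho] at this
      have h1 : (A.count g : ℚ) ≤ n - 1 := by
        have : A.count g + 1 ≤ n := by omega
        have : (A.count g : ℚ) + 1 ≤ n := by exact_mod_cast this
        linarith
      have h2 : (A.count g : ℚ) * (d / n ^ 2) ≤ (n - 1) * (d / n ^ 2) := mul_le_mul_of_nonneg_right h1 (by positivity)
      have h3 : 1 + d * (1 - 1 / (n : ℚ)) + (n - 1) * (d / n ^ 2) = 1 + d * (1 - 1 / n ^ 2) := by
        field_simp
        ring
      push_cast
      linarith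

theorem P5 {n d p s : ℕ} (hd : 2 ≤ d) (hp : p.Prime) (hs : 1 ≤ s) (hn : n = d + 2) (hps : n = p ^ s) (he : Expo G n)
    (hRK : RK G d n) (f : G →+ (Fin (d + 1) → ZMod n)) (hf : Function.Injective f) :
    Elast G d (1 + d * (1 - 1 / (n : ℚ) ^ 2)) := by
  haveI : Fact p.Prime := ⟨hp⟩
  have hn2 : 2 ≤ n := by omega
  have hn0 : (0 : ℚ) < n := by positivity
  have hd0 : (0 : ℚ) < d := by positivity
  have hnd : (n : ℚ) = d + 2 := by exact_mod_cast hn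
  have hk4 : ∀ U : Multiset G, Atom U → k U < (d + 1 : ℕ) := fun U hU => P4 hps f hf (by omega) (by omega) hU
  have h3 : 1 / (n : ℚ) ^ 2 ≤ 1 / n := by
    apply one_div_le_one_div_of_le hn0; nlinarith
  have h4 : 1 / (n : ℚ) ≤ 1 / 2 := by
    apply one_div_le_one_div_of_le (by norm_num); linarith
  have hR1 : 1 + (d : ℚ) / 2 ≤ 1 + d * (1 - 1 / (n : ℚ) ^ 2) := by nlinarith
  apply elast_of_wt
  intro S hS
  by_cases hb : ∃ A, Atom A ∧ Over S A ∧ NP d A ∧ 1 < k A ∧ ∃ g ∈ A, -g ∈ S ∧ addOrderOf g = d + 2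
  · obtain ⟨A, hA, hAo, hnp, hk, g, hg, hg', ho⟩ := hb
    have hv : A.count g < d + 2 := by
      have h1 := hA.count_le g
      rw [ho] at h1
      refine lt_of_le_of_ne h1 fun heq => ?_
      have hle : Multiset.replicate (d + 2) g ≤ A := Multiset.le_count_iff_replicate_le.1 heq.ge
      have h2 := atom_ord g
      rw [ho] at h2
      rw [← h2.eq_of_le hA hle] at hk
      have h3 := k_ord g
      rw [ho] at h3
      rw [h3] at hk
      exact lt_irrefl _ hk
    obtain ⟨E, hE, hEc, hInd⟩ := caseB1 (by omega) hp hs hn hps he (hRK.1 p hp) hS hA hAo hnp hg hg' ho hv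
    have hcard : Fintype.card E = d + 1 := by rw [Fintype.card_coe, hEc]
    have hspan := spanning hn2 hInd hcard f hf
    obtain ⟨x, hx, hxs⟩ := hspan g
    have heA : ∀ i : E, (i : G) ∈ A := fun i => (hE i.2).1
    have heg : ∀ i : E, (i : G) ≠ g := fun i => (hE i.2).2
    have hgs := caseB2 hd hn he hInd hcard hS hA hAo hnp hk hg hg' ho heA heg hx hxs
    have hgA := hnp.notMem (by omega) hA hg ho
    exact part4 hd hn he hRK hk4 hInd hcard hS (fun i => hAo _ (heA i)) hgs (hAo g hg) hg' (by rw [ho, hn])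
      (by rintro ⟨i, hi⟩; exact heg i hi) (by rintro ⟨i, hi⟩; exact hgA (hi ▸ heA i)) hspan
  · push Not at hb
    set P : Set G := {g | g ∈ S ∧ -g ∈ S ∧ addOrderOf g = d + 2} with hP
    refine ⟨hw P, fun A hA hAo => ?_⟩
    by_cases hnp : NP d A
    · have hk1 : 1 ≤ k A := nonpair_LCN (by omega) hS he hn.le hA hAo hnp A hA (over_supp A)
      by_cases hg : ∃ g ∈ A, g ∈ P
      · obtain ⟨g, hgA, hgP⟩ := hg
        have hkA : k A = 1 := by
          by_contra hne
          exact hb A hA hAo hnp (lt_of_le_of_ne hk1 (Ne.symm hne)) g hgA hgP.2.1 hgP.2.2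
        have hkP : ∀ x ∈ P, kk x = 1 / n := by
          intro x hx
          rw [kk, hx.2.2, ← hn]
        constructor
        · rw [← hkA]
          apply wt_mono
          intro x hx
          unfold hw
          split_ifs with hxP
          · rw [hkP x hxP]; exact h4
          · exact le_refl _
        · have h5 : wt (hw P) A ≤ wt (fun x => (n / 2 : ℚ) * kk x) A := by
            apply wt_mono
            intro x hx
            unfold hw
            split_ifs with hxP
            · rw [hkP x hxP]
              have : (n : ℚ) / 2 * (1 / n) = 1 / 2 := by field_simp
              rw [this]
            · have := kk_nonneg x
              have h6 : (1 : ℚ) ≤ n / 2 := by rw [hnd]; linarith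
              nlinarith
          have h6 : wt (fun x => (n / 2 : ℚ) * kk x) A = n / 2 * k A := by
            unfold k wt
            rw [← Multiset.sum_map_mul_left]
          rw [h6, hkA, mul_one] at h5
          refine h5.trans (le_trans ?_ hR1)
          rw [hnd]; linarith
      · push Not at hg
        have h1 : wt (hw P) A = k A := wt_congr (fun g hgA => by rw [hw, if_neg (hg g hgA)])
        rw [h1]
        refine ⟨hk1, ?_⟩
        have hk2 := k_bound (by omega) he hn.le hRK (by omega) hS hA hAo hnp (by exact_mod_cast hk4 A hA)
        have h1 : (k A - 1) ≤ d * (n - 1) / n := by rw [le_div_iff₀ hn0]; linarith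
        have h2 : (d : ℚ) * (n - 1) / n = d * (1 - 1 / n) := by field_simp
        nlinarith
    · unfold NP at hnp
      push Not at hnp
      obtain ⟨g, rfl, ho⟩ := hnp
      have h1 : g ∈ P := ⟨hAo g (by simp), hAo (-g) (by simp), ho⟩
      have h2 : -g ∈ P := ⟨hAo (-g) (by simp), by rw [neg_neg]; exact hAo g (by simp), by rw [addOrderOf_neg, ho]⟩
      have : ({g, -g} : Multiset G) = g ::ₘ {-g} := rfl
      rw [this, wt_cons, wt_singleton, hw, hw, if_pos h1, if_pos h2]
      constructor <;> linarith
end ZS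


namespace ZS

lemma atom_card_le {G : Type*} [AddCommGroup G] [Finite G] {A : Multiset G} (hA : Atom A) :
    Multiset.card A ≤ Nat.card G := by
  obtain ⟨l, rfl⟩ := Quot.exists_rep A
  change Atom (l : Multiset G) at hA
  change l.length ≤ _
  have key : ∀ i j : ℕ, i < j → j < l.length → (l.take i).sum ≠ (l.take j).sum := by
    intro i j hij hj heq
    have h1 : (l.take j).sum = ((l.take j).take i).sum + ((l.take j).drop i).sum :=
      (List.sum_take_add_sum_drop (l.take j) i).symm
    rw [List.take_take, min_eq_left hij.le] at h1
    have h2 : ((l.take j).drop i).sum = 0 := by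
      rw [heq] at h1; simpa using h1
    have h3 : (((l.take j).drop i : List G) : Multiset G) ≤ (l : Multiset G) :=
      ((List.drop_sublist _ _).trans (List.take_sublist _ _)).subperm
    have hlen : ((l.take j).drop i).length = j - i := by simp; omega
    rcases hA.2.2 _ h3 (by simpa using h2) with h | h
    · have := congrArg Multiset.card h
      simp only [Multiset.coe_card, hlen, Multiset.card_zero] at this
      omega
    · have := congrArg Multiset.card h
      simp only [Multiset.coe_card, hlen] at this
      omega
  have hinj : Function.Injective (fun i : Fin l.length => (l.take i).sum) := by
    intro i j h
    rcases lt_trichotomy i j with h' | h' | h'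
    · exact absurd h (key _ _ h' j.2)
    · exact h'
    · exact absurd h.symm (key _ _ h' i.2)
  have := Nat.card_le_card_of_injective _ hinj
  simpa using this

lemma elast_small {G : Type*} [AddCommGroup G] [Finite G] (h : Nat.card G ≤ 4) : Elast G 1 2 := by
  apply elast_of_wt
  intro S hS
  refine ⟨fun g => if g = 0 then 1 else 1 / 2, fun A hA hAo => ?_⟩
  by_cases h0 : (0 : G) ∈ A
  · have : ({0} : Multiset G) = A := Atom.eq_of_le' (by simp) (by simp) hA (by simpa using h0)
    rw [← this]; simp
  · have h1 : wt (fun g : G => if g = 0 then (1 : ℚ) else 1 / 2) A = Multiset.card A / 2 := by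
      rw [wt_congr (w' := fun _ => (1 / 2 : ℚ))
        (fun g hg => if_neg (by rintro rfl; exact h0 hg))]
      simp [wt, div_eq_mul_inv]
    rw [h1]
    have h2 : 2 ≤ Multiset.card A := by
      have hne : Multiset.card A ≠ 0 := fun h => hA.1 (Multiset.card_eq_zero.1 h)
      have hne1 : Multiset.card A ≠ 1 := by
        intro h
        obtain ⟨a, ha⟩ := Multiset.card_eq_one.1 h
        have := hA.2.1
        rw [ha, Multiset.sum_singleton] at this
        exact h0 (by rw [ha, this]; simp)
      omega
    have h3 : Multiset.card A ≤ 4 := (atom_card_le hA).trans h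
    have h2' : (2 : ℚ) ≤ Multiset.card A := by exact_mod_cast h2
    have h3' : (Multiset.card A : ℚ) ≤ 4 := by exact_mod_cast h3
    constructor <;> linarith

lemma len_neg {G : Type*} [AddCommGroup G] (W : Multiset G) (h : (0 : G) ∉ W) :
    HasLen (W + W.map (fun x => -x)) (Multiset.card W) := by
  induction W using Multiset.induction_on with
  | empty => simpa using HasLen.zero
  | cons a W ih =>
    have ha : a ≠ 0 := by rintro rfl; simp at h
    have h1 := (atom_pair ha).hasLen.add (ih (fun hh => h (Multiset.mem_cons_of_mem hh)))
    have h2 : ({a, -a} : Multiset G) + (W + W.map (fun x => -x)) =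
        a ::ₘ W + (a ::ₘ W).map (fun x => -x) := by
      rw [Multiset.map_cons]
      change (a ::ₘ ({-a} : Multiset G)) + _ = _
      rw [← Multiset.singleton_add a, ← Multiset.singleton_add a, ← Multiset.singleton_add (-a)]
      abel
    rw [h2] at h1
    simpa [add_comm] using h1

lemma Atom.map_neg {G : Type*} [AddCommGroup G] {W : Multiset G} (h : Atom W) :
    Atom (W.map (fun x => -x)) := by
  have hinv : ∀ T : Multiset G, (T.map (fun x => -x)).map (fun x => -x) = T := by
    intro T; simp [Multiset.map_map]
  refine ⟨fun h0 => h.1 (by simpa using h0), by rw [Multiset.sum_map_neg', h.2.1, neg_zero], ?_⟩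
  intro T hT hs
  have h1 : T.map (fun x => -x) ≤ W := by
    have := Multiset.map_le_map (f := fun x : G => -x) hT
    rwa [hinv] at this
  rcases h.2.2 _ h1 (by rw [Multiset.sum_map_neg', hs, neg_zero]) with h2 | h2
  · left; simpa using h2
  · right; rw [← h2, hinv]

lemma elast_C3 {G ι : Type*} [AddCommGroup G] [Finite G] [Fintype ι] {e : ι → G} (h : Ind 3 e)
    (hc : Fintype.card ι = 2) : ¬ Elast G 1 2 := by
  intro hE
  have hW := W_atom h (by norm_num) hc.ge
  set W := ({∑ j, e j} : Multiset G) + ∑ i, Multiset.replicate (3 - 1) (e i) with hWd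
  have hcard : Multiset.card W = 5 := by simp [hWd, hc]
  have h0 : (0 : G) ∉ W := by
    intro h0
    have : ({0} : Multiset G) = W := Atom.eq_of_le' (by simp) (by simp) hW (by simpa using h0)
    rw [← this] at hcard; simp at hcard
  have h5 := len_neg W h0
  have h2 := hW.hasLen.add hW.map_neg.hasLen
  have := hE Set.univ (fun B _ l1 l2 _ _ => by simp) _ (fun _ _ => Set.mem_univ _) _ _ h2 h5
  rw [hcard] at this
  norm_num at this

section types
variable {G : Type*} [AddCommGroup G] [Finite G] {d : ℕ} (n : Fin (d + 1) → ℕ)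

lemma expo_of (hn : ∀ i, 1 < n i) (hdvd : ∀ i j, i ≤ j → n i ∣ n j)
    (φ : G ≃+ (∀ i : Fin (d + 1), ZMod (n i))) : Expo G (n (Fin.last d)) := by
  refine ⟨by have := hn (Fin.last d); omega, fun g => ?_⟩
  apply φ.injective
  rw [map_nsmul, map_zero]
  funext i
  obtain ⟨c, hc⟩ := hdvd i _ (Fin.le_last i)
  simp [hc]

lemma tors_pow (hn : ∀ i, 1 < n i) (φ : G ≃+ (∀ i : Fin (d + 1), ZMod (n i))) {d' : ℕ} (h : d + 1 ≤ d')
    (q : ℕ) (hq : q.Prime) : tors G q ≤ q ^ d' :=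
  ((RK_of n hn φ).1 q hq).trans (Nat.pow_le_pow_right hq.pos h)

lemma ord_of (hn : ∀ i, 1 < n i) (φ : G ≃+ (∀ i : Fin (d + 1), ZMod (n i))) (i : Fin (d + 1)) :
    ∃ g : G, addOrderOf g = n i := by
  refine ⟨φ.symm (Pi.single i 1), ?_⟩
  rw [AddEquiv.addOrderOf_eq]
  have h1 := addOrderOf_injective (AddMonoidHom.single (fun i => ZMod (n i)) i)
    (fun a b h => Pi.single_injective (M := fun i => ZMod (n i)) i h) (1 : ZMod (n i))
  rw [ZMod.addOrderOf_one] at h1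
  exact h1

lemma ind_of (hn : ∀ i, 1 < n i) (hdvd : ∀ i j, i ≤ j → n i ∣ n j)
    (φ : G ≃+ (∀ i : Fin (d + 1), ZMod (n i))) : ∃ e : Fin (d + 1) → G, Ind (n 0) e := by
  have hc : ∀ i, n 0 * (n i / n 0) = n i := fun i => Nat.mul_div_cancel' (hdvd 0 i (Fin.zero_le i))
  refine ⟨fun i => φ.symm (Pi.single i ((n i / n 0 : ℕ) : ZMod (n i))), ?_, ?_⟩
  · intro i
    apply φ.injective
    rw [map_nsmul, map_zero, φ.apply_symm_apply]
    rw [← Pi.single_smul, nsmul_eq_mul, ← Nat.cast_mul, hc]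
    simp
  · intro z hz i
    have h1 := congrArg (fun x => φ x i) hz
    simp only [map_sum, map_zsmul, φ.apply_symm_apply, map_zero] at h1
    rw [Finset.sum_apply, Finset.sum_eq_single i] at h1
    · simp only [Pi.smul_apply, Pi.single_eq_same, Pi.zero_apply] at h1
      rw [zsmul_eq_mul] at h1
      have h2 : ((z i * (n i / n 0 : ℕ) : ℤ) : ZMod (n i)) = 0 := by
        rw [Int.cast_mul, Int.cast_natCast]; exact h1
      rw [ZMod.intCast_zmod_eq_zero_iff_dvd] at h2
      have h3 : (n i : ℤ) = n 0 * (n i / n 0 : ℕ) := by exact_mod_cast (hc i).symm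
      rw [h3] at h2
      refine Int.dvd_of_mul_dvd_mul_right ?_ h2
      have : 0 < n i / n 0 := Nat.pos_of_ne_zero (by intro h; have := hc i; rw [h] at this; have := hn i; omega)
      exact_mod_cast this.ne'
    · intro j _ hj
      simp [Pi.single_eq_of_ne hj.symm]
    · simp
end types

lemma main {G G' : Type*} [AddCommGroup G] [Finite G] [AddCommGroup G'] [Finite G'] {d d' : ℕ}
    (n : Fin (d + 1) → ℕ) (hn : ∀ i, 1 < n i)
    (hdvd : ∀ i j, i ≤ j → n i ∣ n j) (φ : G ≃+ (∀ i : Fin (d + 1), ZMod (n i)))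
    (n' : Fin (d' + 1) → ℕ) (hn' : ∀ i, 1 < n' i)
    (hdvd' : ∀ i j, i ≤ j → n' i ∣ n' j) (φ' : G' ≃+ (∀ i : Fin (d' + 1), ZMod (n' i)))
    (hL : systemL (Set.univ : Set G) = systemL (Set.univ : Set G'))
    (hcond : n (Fin.last d) ≤ d + 2) (hne2 : n 0 ≠ 2) (hpp : IsPrimePow (n (Fin.last d))) :
    d = d' ∧ n 0 = n' 0 := by
  have he := expo_of n hn hdvd φ
  have he' := expo_of n' hn' hdvd' φ'
  obtain ⟨e, hind⟩ := ind_of n hn hdvd φ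
  obtain ⟨e', hind'⟩ := ind_of n' hn' hdvd' φ'
  have hle : ∀ i, n i ≤ n (Fin.last d) := fun i => Nat.le_of_dvd he.1 (hdvd i _ (Fin.le_last i))
  have hle' : ∀ i, n' i ≤ n' (Fin.last d') := fun i => Nat.le_of_dvd he'.1 (hdvd' i _ (Fin.le_last i))
  have h3 : 3 ≤ n 0 := by have := hn 0; omega
  have h2' : 2 ≤ n' 0 := hn' 0
  have h30 := hle 0
  have hd1 : 1 ≤ d := by omega
  -- Step 0
  have hdd : d' ≤ d := by
    by_contra hcon
    push Not at hcon
    have h1 := transfer (by norm_num) hL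
      (P0 (d := d') (by omega) he (by omega) (fun q hq => tors_pow n hn φ (by omega) q hq))
    have h2 := elast_W1 hind' h2' (by simp; omega) (ρ := 1) (by simpa using h1)
    have h4 : (1 : ℚ) < d' := by exact_mod_cast (by omega : 1 < d')
    simp at h2
    linarith
  have hexp' : n' (Fin.last d') ≤ d + 2 := by
    by_contra hcon
    push Not at hcon
    obtain ⟨g, hg⟩ := ord_of n' hn' φ' (Fin.last d')
    have h1 := transfer (by norm_num) hL
      (P0 (d := n' (Fin.last d') - 2) (by omega) he (by omega)
        (fun q hq => tors_pow n hn φ (by omega) q hq))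
    have h2 := elast_pair hg (by omega) h1
    have h4 : (2 : ℚ) < n' (Fin.last d') := by exact_mod_cast (by omega : 2 < n' (Fin.last d'))
    linarith
  rcases Nat.lt_or_ge d 2 with hd2 | hd2
  · -- the group of type (3,3)
    have hd : d = 1 := by omega
    subst hd
    have hn3 : n 0 = 3 := by omega
    rw [hn3] at hind
    have hnot : ¬ Nat.card G' ≤ 4 := fun h4 =>
      elast_C3 hind (by simp) (transfer (by norm_num) hL.symm (elast_small h4))
    have hcard : Nat.card G' = ∏ i, n' i := by
      rw [Nat.card_congr φ'.toEquiv, Nat.card_pi]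
      simp
    rw [hcard] at hnot
    rcases Nat.lt_or_ge d' 1 with h | h
    · have : d' = 0 := by omega
      subst this
      simp at hnot hexp'
      omega
    · have : d' = 1 := by omega
      subst this
      refine ⟨rfl, ?_⟩
      have h10 := hle' 0
      have hdv := hdvd' 0 1 (by simp)
      rw [Fin.prod_univ_two] at hnot
      rw [hn3]
      change n' 1 ≤ 3 at hexp'
      change n' 0 ≤ n' 1 at h10
      by_contra hcon
      have h20 : n' 0 = 2 := by omega
      rw [h20] at hdv hnot
      omega
  have hd0 : (0 : ℚ) < d := by positivity
  have hc2 : 2 ≤ Fintype.card (Fin (d + 1)) := by simp; omega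
  have h3q : (3 : ℚ) ≤ n 0 := by exact_mod_cast h3
  have h2q' : (2 : ℚ) ≤ n' 0 := by exact_mod_cast h2'
  have hdeq : d = d' := by
    by_contra hcon
    have h1 := transfer (by positivity) hL.symm
      (P1 (d := d) (by omega) he' hexp' (fun q hq => tors_pow n' hn' φ' (by omega) q hq))
    have h2 := elast_WN hind (by omega) hc2 (ρ := 1 + d / 2) (by simpa using h1)
    simp at h2
    nlinarith
  subst hdeq
  refine ⟨rfl, ?_⟩
  obtain ⟨p, s, hp, hs, hps⟩ := (isPrimePow_nat_iff _).1 hpp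
  haveI : Fact p.Prime := ⟨hp⟩
  obtain ⟨f, hf⟩ := embed he.1 n (fun i => hdvd i _ (Fin.le_last i)) φ
  have hRK := RK_of n hn φ
  have hRK' := RK_of n' hn' φ'
  have hGb : n 0 < d + 2 → Elast G d (1 + d * (n 0 - 1) / n 0) := by
    intro hlt
    refine P2 (by omega) he hcond hRK (by omega) hlt ?_ ?_
    · have : (d : ℚ) / 2 ≤ d * (n 0 - 1) / n 0 := by
        rw [div_le_div_iff₀ (by norm_num) (by linarith)]
        nlinarith
      linarith
    · intro S hS A hA hAo hnp
      have h4 : k A < d + 1 := by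
        have := P4 hps.symm f hf (by omega) (by omega) hA
        push_cast at this
        exact this
      have h5 := k_bound (by omega) he hcond hRK (by omega) hS hA hAo hnp h4
      have h6 : k A - 1 ≤ d * (n 0 - 1) / n 0 := by
        rw [le_div_iff₀ (by linarith)]
        linarith
      linarith
  have hWN : ∀ R : ℚ, Elast G d R → 1 + (d : ℚ) * (n 0 - 1) / n 0 ≤ R := by
    intro R hE
    have h2 := elast_WN hind (by omega) hc2 (ρ := R) (by simpa using hE)
    simp at h2
    have : (d : ℚ) * (n 0 - 1) / n 0 ≤ R - 1 := by
      rw [div_le_iff₀ (by linarith)]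
      linarith
    linarith
  have hWN' : ∀ R : ℚ, Elast G' d R → 1 + (d : ℚ) * (n' 0 - 1) / n' 0 ≤ R := by
    intro R hE
    have h2 := elast_WN hind' (by omega) hc2 (ρ := R) (by simpa using hE)
    simp at h2
    have : (d : ℚ) * (n' 0 - 1) / n' 0 ≤ R - 1 := by
      rw [div_le_iff₀ (by linarith)]
      linarith
    linarith
  have hmono : ∀ a b : ℚ, 2 ≤ a → a < b → (d : ℚ) * (a - 1) / a < d * (b - 1) / b := by
    intro a b ha hab
    rw [div_lt_div_iff₀ (by linarith) (by linarith)]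
    nlinarith
  rcases lt_trichotomy (n 0) (n' 0) with hlt | heq | hlt
  · exfalso
    have h00 := hle' 0
    have h1 := hWN' _ (transfer (by
      have : 0 ≤ (d : ℚ) * (n 0 - 1) / n 0 := div_nonneg (mul_nonneg hd0.le (by linarith)) (by linarith)
      linarith) hL (hGb (by omega)))
    have h2 := hmono (n 0) (n' 0) (by linarith) (by exact_mod_cast hlt)
    linarith
  · exact heq
  · exfalso
    have hm' : n' 0 < d + 2 := by omega
    have hpos : 0 ≤ (d : ℚ) * (n' 0 - 1) / n' 0 :=
      div_nonneg (mul_nonneg hd0.le (by linarith)) (by linarith)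
    by_cases hall : ∀ S : Set G', DSet d S → ∀ A, Atom A → Over S A → NP d A → k A < d + 1
    · have hE : Elast G' d (1 + d * (n' 0 - 1) / n' 0) := by
        refine P2 (by omega) he' hexp' hRK' (by omega) hm' ?_ ?_
        · have : (d : ℚ) / 2 ≤ d * (n' 0 - 1) / n' 0 := by
            rw [div_le_div_iff₀ (by norm_num) (by linarith)]
            nlinarith
          linarith
        · intro S hS A hA hAo hnp
          have h5 := k_bound (by omega) he' hexp' hRK' (by omega) hS hA hAo hnp
            (hall S hS A hA hAo hnp)
          have h6 : k A - 1 ≤ d * (n' 0 - 1) / n' 0 := by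
            rw [le_div_iff₀ (by linarith)]
            linarith
          linarith
      have h1 := hWN _ (transfer (by linarith) hL.symm hE)
      have h2 := hmono (n' 0) (n 0) h2q' (by exact_mod_cast hlt)
      linarith
    · push Not at hall
      obtain ⟨S, hS, A, hA, hAo, hnp, hk⟩ := hall
      have hno : ∀ R : ℚ, 0 ≤ R → R < d + 1 → ¬ Elast G d R := by
        intro R hR0 hR hE
        have hE' := transfer hR0 hL hE
        obtain ⟨l, hl, hl2, -⟩ := nsmul_len he' A
        have h1 := hE' S hS _ (hAo.nsmul _) _ _ (hA.hasLen.nsmul _) hl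
        rw [hl2] at h1
        have h4 : (0 : ℚ) < n' (Fin.last d) := by exact_mod_cast he'.1
        simp at h1
        nlinarith
      rcases Nat.lt_or_ge (n 0) (d + 2) with hn0 | hn0
      · refine hno _ ?_ ?_ (hGb hn0)
        · have : 0 ≤ (d : ℚ) * (n 0 - 1) / n 0 := div_nonneg (mul_nonneg hd0.le (by linarith)) (by linarith)
          linarith
        · have : (d : ℚ) * (n 0 - 1) / n 0 < d := by
            rw [div_lt_iff₀ (by linarith)]
            nlinarith
          linarith
      · have hnl : n (Fin.last d) = d + 2 := by omega
        have hn0l : n 0 = n (Fin.last d) := by omega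
        rw [hn0l] at hRK
        have hE := P5 hd2 hp hs hnl hps.symm he hRK f hf
        have hx : (0 : ℚ) < 1 / (n (Fin.last d) : ℚ) ^ 2 := by
          have : (0 : ℚ) < n (Fin.last d) := by exact_mod_cast he.1
          positivity
        have hx1 : 1 / (n (Fin.last d) : ℚ) ^ 2 ≤ 1 := by
          have : (1 : ℚ) ≤ n (Fin.last d) := by exact_mod_cast he.1
          rw [div_le_one (by positivity)]
          nlinarith
        refine hno _ ?_ ?_ hE
        · have : 0 ≤ (d : ℚ) * (1 - 1 / (n (Fin.last d) : ℚ) ^ 2) := mul_nonneg hd0.le (by linarith)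
          linarith
        · nlinarith

end ZS


end ZSProof

/-- If `G ≅ C_{n₁} ⊕ … ⊕ C_{n_r}`, `G' ≅ C_{n₁'} ⊕ … ⊕ C_{n'_{r'}}`
(invariant factor decompositions), `D(G) ≥ 4`, `𝓛(G) = 𝓛(G')`, `r ≥ n_r − 1`,
`n₁ ≠ 2` and `n_r` a prime power, then `r(G) = r(G')` and `n₁ = n₁'`. -/
theorem stmt3 {G G' : Type*} [AddCommGroup G] [Fintype G] [AddCommGroup G'] [Fintype G']
    (r : ℕ) (hr : 0 < r) (n : Fin r → ℕ) (hn : ∀ i, 1 < n i)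
    (hdvd : ∀ i j : Fin r, i ≤ j → n i ∣ n j)
    (hG : Nonempty (G ≃+ (∀ i : Fin r, ZMod (n i))))
    (r' : ℕ) (hr' : 0 < r') (n' : Fin r' → ℕ) (hn' : ∀ i, 1 < n' i)
    (hdvd' : ∀ i j : Fin r', i ≤ j → n' i ∣ n' j)
    (hG' : Nonempty (G' ≃+ (∀ i : Fin r', ZMod (n' i))))
    (hD : 4 ≤ davenport G)
    (hL : systemL (Set.univ : Set G) = systemL (Set.univ : Set G'))
    (hcond : n ⟨r - 1, by omega⟩ - 1 ≤ r) (hne2 : n ⟨0, hr⟩ ≠ 2) (hpp : IsPrimePow (n ⟨r - 1, by omega⟩)) :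
    r = r' ∧ n ⟨0, hr⟩ = n' ⟨0, hr'⟩ := by
  obtain ⟨φ⟩ := hG
  obtain ⟨φ'⟩ := hG'
  obtain ⟨d, rfl⟩ : ∃ d, r = d + 1 := ⟨r - 1, by omega⟩
  obtain ⟨d', rfl⟩ : ∃ d', r' = d' + 1 := ⟨r' - 1, by omega⟩
  have hlast : (⟨d + 1 - 1, by omega⟩ : Fin (d + 1)) = Fin.last d := rfl
  rw [hlast] at hcond hpp
  have h := ZS.main n hn hdvd φ n' hn' hdvd' φ' hL (by omega) hne2 hpp
  exact ⟨by rw [h.1], h.2⟩
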